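/- arXiv:2409.16279 — 2 statements merged into one kernel-verified Lean document; each statement's English description precedes it below -/
import Mathlib

section
/- Let G be a 1-planar graph that admits a 1-planar drawing in the plane with at most γ ×-crossings. Then the cop-number of G is at most γ + 21. -/
/-!
Common definitions: the game of Cops and Robbers (strategies, plays, capture,
cop number), 1-planar drawings in the plane, crossings, ×-crossings, kite
edges, guarding of vertices and crossing points, subgraphs of the
planarization, cop territory, robber territory, and the edge sets `S_H(v)`.
-/

namespace CopsRobbersOnePlanar

/-- `f` parametrizes a simple (injective) arc from `p` to `q` over `[0,1]`. -/
structure IsArc (f : ℝ → ℝ × ℝ) (p q : ℝ × ℝ) : Prop where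
  continuousOn : ContinuousOn f (Set.Icc 0 1)
  injOn : Set.InjOn f (Set.Icc 0 1)
  source : f 0 = p
  target : f 1 = q

/-- A 1-planar drawing of a simple graph `G` in the plane: vertices are mapped to
distinct points, each edge to a simple arc joining its endpoints whose interior
avoids all vertices; arcs of distinct edges meet only at shared endpoints or at
interior points; each edge has at most one interior intersection point with the
other arcs (each edge is crossed at most once); arcs of edges sharing an
endpoint do not cross; and no three arcs pass through a common interior point. -/
structure OnePlanarDrawing {V : Type} (G : SimpleGraph V) where
  vpos : V → ℝ × ℝ
  vpos_inj : Function.Injective vpos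
  arc : Sym2 V → ℝ → ℝ × ℝ
  arc_spec : ∀ u v : V, G.Adj u v →
    IsArc (arc s(u, v)) (vpos u) (vpos v) ∨ IsArc (arc s(u, v)) (vpos v) (vpos u)
  arc_avoids_vertices : ∀ e ∈ G.edgeSet, ∀ w : V,
    vpos w ∉ arc e '' Set.Ioo (0 : ℝ) 1
  arcs_meet_properly : ∀ e ∈ G.edgeSet, ∀ f ∈ G.edgeSet, e ≠ f →
    ∀ p ∈ (arc e '' Set.Icc (0 : ℝ) 1) ∩ (arc f '' Set.Icc (0 : ℝ) 1),
      (∃ w : V, w ∈ e ∧ w ∈ f ∧ p = vpos w) ∨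
        p ∈ (arc e '' Set.Ioo (0 : ℝ) 1) ∩ (arc f '' Set.Ioo (0 : ℝ) 1)
  crossed_at_most_once : ∀ e ∈ G.edgeSet,
    Set.Subsingleton {p : ℝ × ℝ | ∃ f ∈ G.edgeSet, f ≠ e ∧
      p ∈ (arc e '' Set.Ioo (0 : ℝ) 1) ∩ (arc f '' Set.Ioo (0 : ℝ) 1)}
  no_adjacent_crossing : ∀ e ∈ G.edgeSet, ∀ f ∈ G.edgeSet, e ≠ f →
    (∃ w : V, w ∈ e ∧ w ∈ f) →
    (arc e '' Set.Ioo (0 : ℝ) 1) ∩ (arc f '' Set.Ioo (0 : ℝ) 1) = ∅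
  no_triple_point : ∀ e ∈ G.edgeSet, ∀ f ∈ G.edgeSet, ∀ g ∈ G.edgeSet,
    e ≠ f → e ≠ g → f ≠ g →
    (arc e '' Set.Ioo (0 : ℝ) 1) ∩ (arc f '' Set.Ioo (0 : ℝ) 1) ∩
      (arc g '' Set.Ioo (0 : ℝ) 1) = ∅

variable {V : Type}

/-- Two edges cross in the drawing `D`: their arcs share an interior point. -/
def OnePlanarDrawing.Crosses {G : SimpleGraph V} (D : OnePlanarDrawing G)
    (e f : Sym2 V) : Prop :=
  e ∈ G.edgeSet ∧ f ∈ G.edgeSet ∧ e ≠ f ∧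
    ((D.arc e '' Set.Ioo (0 : ℝ) 1) ∩ (D.arc f '' Set.Ioo (0 : ℝ) 1)).Nonempty

/-- An edge is uncrossed in the drawing `D`. -/
def OnePlanarDrawing.Uncrossed {G : SimpleGraph V} (D : OnePlanarDrawing G)
    (e : Sym2 V) : Prop :=
  ∀ f, ¬ D.Crosses e f

/-- An ×-crossing: a crossing such that `G` contains no edge joining any two
consecutive endpoints (i.e. endpoints of the two different crossing edges). -/
def OnePlanarDrawing.IsXCrossing {G : SimpleGraph V} (D : OnePlanarDrawing G)
    (e f : Sym2 V) : Prop :=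
  D.Crosses e f ∧ ∀ u w : V, u ∈ e → w ∈ f → ¬ G.Adj u w

/-- The drawing has a kite edge at every crossing: an uncrossed edge of `G`
joining two consecutive endpoints of the crossing. -/
def OnePlanarDrawing.HasKites {G : SimpleGraph V} (D : OnePlanarDrawing G) : Prop :=
  ∀ e f, D.Crosses e f →
    ∃ u w : V, u ∈ e ∧ w ∈ f ∧ G.Adj u w ∧ D.Uncrossed s(u, w)

/-- A strategy for `k` cops on `G`: an initial placement, and a move function
(depending on the current cop positions and the robber's position) under which
every cop either stays put or moves to an adjacent vertex. -/
structure CopStrategy (G : SimpleGraph V) (k : ℕ) where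
  init : Fin k → V
  move : (Fin k → V) → V → Fin k → V
  move_valid : ∀ c r i, move c r i = c i ∨ G.Adj (c i) (move c r i)

/-- A play of the game with `k` cops on `G`: `cop n` is the cop configuration
after the cops' turn of round `n`, and `rob n` is the robber's vertex after the
robber's turn of round `n` (round `0` being the initial placements, cops first).
In each turn every player either stays or moves to an adjacent vertex. -/
structure GamePlay (G : SimpleGraph V) (k : ℕ) where
  cop : ℕ → Fin k → V
  rob : ℕ → V
  cop_valid : ∀ n i, cop (n + 1) i = cop n i ∨ G.Adj (cop n i) (cop (n + 1) i)
  rob_valid : ∀ n, rob (n + 1) = rob n ∨ G.Adj (rob n) (rob (n + 1))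

/-- The cops in the play `π` follow the strategy `cs`. -/
def GamePlay.Follows {G : SimpleGraph V} {k : ℕ} (π : GamePlay G k)
    (cs : CopStrategy G k) : Prop :=
  π.cop 0 = cs.init ∧ ∀ n, π.cop (n + 1) = cs.move (π.cop n) (π.rob n)

/-- The robber is captured at round `n`: some cop occupies the robber's vertex,
either when the robber lands on it, or when the cops move in the next round. -/
def GamePlay.CapturedAt {G : SimpleGraph V} {k : ℕ} (π : GamePlay G k) (n : ℕ) : Prop :=
  ∃ i, π.cop n i = π.rob n ∨ π.cop (n + 1) i = π.rob n

/-- `k` cops have a winning strategy on `G`. -/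
def CopsWin (G : SimpleGraph V) (k : ℕ) : Prop :=
  ∃ cs : CopStrategy G k, ∀ π : GamePlay G k, π.Follows cs → ∃ n, π.CapturedAt n

/-- The cop number of `G`: the least number of cops that can win on `G`. -/
noncomputable def copNumber (G : SimpleGraph V) : ℕ :=
  sInf {k | CopsWin G k}

/-- From time `N` on, the designated cop `i0` guards the vertex `v` in the play
`π`: whenever the robber is on `v`, either he was already captured earlier, or
cop `i0` occupies `v` now or at the next cops' turn (immediate capture). -/
def GamePlay.GuardsVertexBy {G : SimpleGraph V} {k : ℕ} (π : GamePlay G k)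
    (i0 : Fin k) (N : ℕ) (v : V) : Prop :=
  ∀ n, N ≤ n → π.rob n = v →
    (∃ m < n, π.CapturedAt m) ∨ π.cop n i0 = v ∨ π.cop (n + 1) i0 = v

/-- From time `N` on, the cops guard the vertex `v` in the play `π`: the robber
cannot land on `v` (he is captured before) or is captured immediately after
landing on `v`. -/
def GamePlay.GuardsVertex {G : SimpleGraph V} {k : ℕ} (π : GamePlay G k)
    (N : ℕ) (v : V) : Prop :=
  ∀ n, N ≤ n → π.rob n = v →
    (∃ m < n, π.CapturedAt m) ∨ ∃ i, π.cop n i = v ∨ π.cop (n + 1) i = v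

/-- From time `N` on, the cops prevent the robber from traversing the edge `e`
(from one endpoint to the opposite endpoint): the robber was captured before
completing such a move, or is captured immediately after making it.  Guarding a
crossing point means preventing traversal of both edges of the crossing. -/
def GamePlay.GuardsTraversal {G : SimpleGraph V} {k : ℕ} (π : GamePlay G k)
    (N : ℕ) (e : Sym2 V) : Prop :=
  ∀ n, N ≤ n → ∀ u w : V, e = s(u, w) → π.rob n = u → π.rob (n + 1) = w →
    (∃ m < n + 1, π.CapturedAt m) ∨
      ∃ i, π.cop (n + 1) i = w ∨ π.cop (n + 2) i = w

/-- As `GamePlay.GuardsTraversal`, but the capturing cop right after the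
traversal is required to come from the index set `I`. -/
def GamePlay.GuardsTraversalOn {G : SimpleGraph V} {k : ℕ} (π : GamePlay G k)
    (I : Set (Fin k)) (N : ℕ) (e : Sym2 V) : Prop :=
  ∀ n, N ≤ n → ∀ u w : V, e = s(u, w) → π.rob n = u → π.rob (n + 1) = w →
    (∃ m < n + 1, π.CapturedAt m) ∨
      ∃ i ∈ I, π.cop (n + 1) i = w ∨ π.cop (n + 2) i = w

/-- A subgraph `H` of the planarization `G×`, recorded by its vertex set:
`gverts` is its set of `G`-vertices, and `dummies` is the set of crossed edges
of `G` whose crossing point (dummy vertex) belongs to `H`; the latter is closed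
under crossing partners since both edges of a crossing carry the same dummy
vertex. -/
structure PlanSubgraph (G : SimpleGraph V) (D : OnePlanarDrawing G) where
  gverts : Set V
  dummies : Set (Sym2 V)
  dummies_crossed : ∀ e ∈ dummies, ∃ f, D.Crosses e f
  dummies_closed : ∀ e ∈ dummies, ∀ f, D.Crosses e f → f ∈ dummies

/-- The subgraph `H` of `G×` is guarded from time `N` on in the play `π`: all
its `G`-vertices are guarded and all its dummy vertices (crossing points) are
guarded. -/
def GuardedSubgraph {G : SimpleGraph V} {D : OnePlanarDrawing G} {k : ℕ}
    (π : GamePlay G k) (N : ℕ) (H : PlanSubgraph G D) : Prop :=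
  (∀ v ∈ H.gverts, π.GuardsVertex N v) ∧
    (∀ e ∈ H.dummies, π.GuardsTraversal N e)

/-- The edge set of the cop territory `C(H)`: edges `e` of `G` with
`e× ∩ H ≠ ∅`, i.e. an endpoint of `e` is a `G`-vertex of `H`, or the crossing
point of `e` is a dummy vertex of `H`. -/
def copTerritoryEdges {G : SimpleGraph V} {D : OnePlanarDrawing G}
    (H : PlanSubgraph G D) : Set (Sym2 V) :=
  {e | e ∈ G.edgeSet ∧ ((∃ v ∈ e, v ∈ H.gverts) ∨ e ∈ H.dummies)}

/-- The vertex set of the robber territory `R(H)`: the connected component of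
`G` minus the edges of the cop territory that contains the robber's current
vertex `r`. -/
def robberTerritory {G : SimpleGraph V} {D : OnePlanarDrawing G}
    (H : PlanSubgraph G D) (r : V) : Set V :=
  {w | (G.deleteEdges (copTerritoryEdges H)).Reachable r w}

/-- The edge set of the robber territory `R(H)`. -/
def robberTerritoryEdges {G : SimpleGraph V} {D : OnePlanarDrawing G}
    (H : PlanSubgraph G D) (r : V) : Set (Sym2 V) :=
  {e | e ∈ (G.deleteEdges (copTerritoryEdges H)).edgeSet ∧
    ∀ v ∈ e, v ∈ robberTerritory H r}

/-- `S_H(v)` for a `G`-vertex `v` of `H` (with the robber at `r`): the edges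
`e` of `G` joining `v` to a vertex of the robber territory `R(H)` such that
`e× ∩ H = {v}`. -/
def SH {G : SimpleGraph V} {D : OnePlanarDrawing G}
    (H : PlanSubgraph G D) (r v : V) : Set (Sym2 V) :=
  {e | ∃ w : V, e = s(v, w) ∧ G.Adj v w ∧ w ∈ robberTerritory H r ∧
    w ∉ H.gverts ∧ e ∉ H.dummies}

end CopsRobbersOnePlanar

namespace CopsRobbersOnePlanar

section Topology

open Complex

lemma exists_continuous_log {F : ℝ × ℝ → ℂ} (hF : Continuous F) (h0 : ∀ x, F x ≠ 0) :
    ∃ L : ℝ × ℝ → ℂ, Continuous L ∧ ∀ x, exp (L x) = F x := by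
  have hU : IsSimplyConnected (Set.univ : Set (ℝ × ℝ)) :=
    have := (convex_univ (𝕜 := ℝ) (E := ℝ × ℝ)).contractibleSpace Set.univ_nonempty
    SimplyConnectedSpace.ofContractible _
  obtain ⟨L, hL, h⟩ := exists_continuousOn_eqOn_exp_comp hU isOpen_univ hF.continuousOn
    (by rintro ⟨x, -, hx⟩; exact h0 x hx)
  exact ⟨L, continuousOn_univ.1 hL, fun x => h (Set.mem_univ x)⟩

lemma log_change_unique {L L' : ℝ → ℂ} (hL : Continuous L) (hL' : Continuous L')
    (h : ∀ s, exp (L s) = exp (L' s)) : L 1 - L 0 = L' 1 - L' 0 := by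
  have key : L = fun s => L' s + (L 0 - L' 0) := by
    refine isCoveringMap_exp.eq_of_comp_eq hL (by fun_prop) ?_ 0 (by ring)
    funext s
    apply Subtype.ext
    simp [exp_add, exp_sub, h]
  have : L 1 = L' 1 + (L 0 - L' 0) := congrFun key 1
  rw [this]; ring

/-- There is no drawing of `K₃,₃` in the plane by curves in which independent edges are disjoint. -/
theorem not_independent_disjoint_K33 (v w : Fin 3 → ℂ) (f : Fin 3 → Fin 3 → ℝ → ℂ)
    (hf : ∀ i j, Continuous (f i j)) (h0 : ∀ i j, f i j 0 = v i) (h1 : ∀ i j, f i j 1 = w j)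
    (hd : ∀ i j k l, i ≠ k → j ≠ l → ∀ s t, f i j s ≠ f k l t) : False := by
  have hv : ∀ i k, i ≠ k → v i - v k ≠ 0 := by
    intro i k hik
    obtain ⟨j, l, hjl⟩ : ∃ j l : Fin 3, j ≠ l := ⟨0, 1, by decide⟩
    have := hd i j k l hik hjl 0 0
    rwa [h0, h0, ← sub_ne_zero] at this
  have hw : ∀ j l, j ≠ l → w j - w l ≠ 0 := by
    intro j l hjl
    have := hd 0 j 1 l (by decide) hjl 1 1
    rwa [h1, h1, ← sub_ne_zero] at this
  have hvw : ∀ i j, w j - v i ≠ 0 := by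
    intro i j
    obtain ⟨k, hk⟩ : ∃ k : Fin 3, k ≠ i := exists_ne i
    obtain ⟨l, hl⟩ : ∃ l : Fin 3, l ≠ j := exists_ne j
    have := hd k j i l hk hl.symm 1 0
    rwa [h1, h0, ← sub_ne_zero] at this
  let ε : Fin 3 → Fin 3 → ℤ := fun i k => if i < k then 1 else -1
  have branch : ∀ z : Fin 3 → ℂ, (∀ i k, i ≠ k → z i - z k ≠ 0) → ∃ a : Fin 3 → Fin 3 → ℂ,
      (∀ i k, i ≠ k → exp (a i k) = z i - z k) ∧
      ∀ i k, i ≠ k → a k i - a i k = ε i k * (Real.pi * I) := by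
    intro z hz
    refine ⟨fun i k => if i < k then log (z i - z k) else log (z k - z i) + Real.pi * I, ?_, ?_⟩
    · intro i k hik
      dsimp only
      split_ifs with h
      · exact exp_log (hz i k hik)
      · rw [exp_add, exp_log (hz k i hik.symm), exp_pi_mul_I]; ring
    · intro i k hik
      rcases lt_or_gt_of_ne hik with h | h
      · simp [ε, h, h.not_gt]
      · simp [ε, h, h.not_gt]
  obtain ⟨a, ha, ha'⟩ := branch v hv
  obtain ⟨b, hb, hb'⟩ := branch w hw
  obtain ⟨c, hc⟩ : ∃ c : Fin 3 → Fin 3 → ℂ, ∀ i j, exp (c i j) = w j - v i :=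
    ⟨fun i j => log (w j - v i), fun i j => exp_log (hvw i j)⟩
  have hex : ∀ i j k l, i ≠ k → j ≠ l → ∃ L : ℝ × ℝ → ℂ, Continuous L ∧
      ∀ x, exp (L x) = f i j x.1 - f k l x.2 := by
    intro i j k l hik hjl
    refine exists_continuous_log (F := fun x => f i j x.1 - f k l x.2) ?_ ?_
    · have := hf i j
      have := hf k l
      fun_prop
    · intro x
      exact sub_ne_zero.2 (hd i j k l hik hjl _ _)
  have hdv : ∀ k i j, ∃ d : ℂ, i ≠ k → ∀ L : ℝ → ℂ, Continuous L →
      (∀ s, exp (L s) = f i j s - v k) → L 1 - L 0 = d := by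
    intro k i j
    by_cases hik : i ≠ k
    · obtain ⟨l, hl⟩ : ∃ l : Fin 3, l ≠ j := exists_ne j
      obtain ⟨L, hL, hLe⟩ := hex i j k l hik hl.symm
      refine ⟨L (1, 0) - L (0, 0), fun _ L' hL' hLe' => ?_⟩
      refine log_change_unique (L' := fun s => L (s, 0)) hL' (by fun_prop) (fun s => ?_)
      rw [hLe', hLe, h0]
    · exact ⟨0, fun h => absurd h hik⟩
  have hdw : ∀ l i j, ∃ d : ℂ, j ≠ l → ∀ L : ℝ → ℂ, Continuous L →
      (∀ s, exp (L s) = f i j s - w l) → L 1 - L 0 = d := by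
    intro l i j
    by_cases hjl : j ≠ l
    · obtain ⟨k, hk⟩ : ∃ k : Fin 3, k ≠ i := exists_ne i
      obtain ⟨L, hL, hLe⟩ := hex i j k l hk.symm hjl
      refine ⟨L (1, 1) - L (0, 1), fun _ L' hL' hLe' => ?_⟩
      refine log_change_unique (L' := fun s => L (s, 1)) hL' (by fun_prop) (fun s => ?_)
      rw [hLe', hLe, h1]
    · exact ⟨0, fun h => absurd h hjl⟩
  choose dv hdv using hdv
  choose dw hdw using hdw
  have hrel : ∀ i j k l, i ≠ k → j ≠ l →
      dv k i j + dw j k l = dv i k l + dw l i j := by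
    intro i j k l hik hjl
    obtain ⟨L, hL, hLe⟩ := hex i j k l hik hjl
    have e1 := hdv k i j hik (fun s => L (s, 0)) (by fun_prop) (fun s => by rw [hLe, h0])
    have e2 := hdw l i j hjl (fun s => L (s, 1)) (by fun_prop) (fun s => by rw [hLe, h1])
    have e3 := hdv i k l hik.symm (fun t => L (0, t) + Real.pi * I) (by fun_prop) (fun t => by
      rw [exp_add, hLe, h0, exp_pi_mul_I]; ring)
    have e4 := hdw j k l hjl.symm (fun t => L (1, t) + Real.pi * I) (by fun_prop) (fun t => by
      rw [exp_add, hLe, h1, exp_pi_mul_I]; ring)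
    rw [← e1, ← e2, ← e3, ← e4]; ring
  have hn : ∀ k i j, ∃ n : ℤ, i ≠ k →
      dv k i j = c k j - a i k + n * (2 * Real.pi * I) := by
    intro k i j
    by_cases hik : i ≠ k
    · obtain ⟨l, hl⟩ : ∃ l : Fin 3, l ≠ j := exists_ne j
      obtain ⟨L, hL, hLe⟩ := hex i j k l hik hl.symm
      have e1 := hdv k i j hik (fun s => L (s, 0)) (by fun_prop) (fun s => by rw [hLe, h0])
      have : exp (dv k i j) = exp (c k j - a i k) := by
        rw [← e1, exp_sub, exp_sub, hLe, hLe, hc, ha i k hik, h0, h0, h1]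
      obtain ⟨n, hn⟩ := exp_eq_exp_iff_exists_int.1 this
      exact ⟨n, fun _ => hn⟩
    · exact ⟨0, fun h => absurd h hik⟩
  have hm : ∀ l i j, ∃ n : ℤ, j ≠ l →
      dw l i j = b j l - (c i l + Real.pi * I) + n * (2 * Real.pi * I) := by
    intro l i j
    by_cases hjl : j ≠ l
    · obtain ⟨k, hk⟩ : ∃ k : Fin 3, k ≠ i := exists_ne i
      obtain ⟨L, hL, hLe⟩ := hex i j k l hk.symm hjl
      have e1 := hdw l i j hjl (fun s => L (s, 1)) (by fun_prop) (fun s => by rw [hLe, h1])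
      have : exp (dw l i j) = exp (b j l - (c i l + Real.pi * I)) := by
        rw [← e1, exp_sub, exp_sub, hLe, hLe, exp_add, hc, hb j l hjl, exp_pi_mul_I, h0, h1, h1]
        congr 1; ring
      obtain ⟨n, hn⟩ := exp_eq_exp_iff_exists_int.1 this
      exact ⟨n, fun _ => hn⟩
    · exact ⟨0, fun h => absurd h hjl⟩
  choose n hn using hn
  choose m hm using hm
  have hinter : ∀ i j k l, i ≠ k → j ≠ l →
      ε i k + ε j l + 2 * (n k i j + m j k l - n i k l - m l i j) = 0 := by
    intro i j k l hik hjl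
    have h := hrel i j k l hik hjl
    rw [hn k i j hik, hn i k l hik.symm, hm j k l hjl.symm, hm l i j hjl] at h
    have hpi : (Real.pi * I : ℂ) ≠ 0 := by simp [Real.pi_ne_zero]
    have h2 : ((ε i k + ε j l + 2 * (n k i j + m j k l - n i k l - m l i j) : ℤ) : ℂ)
        * (Real.pi * I) = 0 := by
      push_cast
      linear_combination h - ha' i k hik - hb' j l hjl
    rcases mul_eq_zero.1 h2 with h3 | h3
    · exact_mod_cast h3
    · exact absurd h3 hpi
  have e : ∀ i k : Fin 3, i < k → ∀ j l : Fin 3, j < l →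
      (1 + (n k i j + m j k l - n i k l - m l i j) = 0) ∧
      (n k i l + m l k j - n i k j - m j i l = 0) := by
    intro i k hik j l hjl
    have h1 := hinter i j k l hik.ne hjl.ne
    have h2 := hinter i l k j hik.ne hjl.ne'
    simp only [ε, hik, hjl, hjl.not_gt, if_true, if_false] at h1 h2
    omega
  have e1 := e 0 1 (by decide) 0 1 (by decide)
  have e2 := e 0 1 (by decide) 0 2 (by decide)
  have e3 := e 0 1 (by decide) 1 2 (by decide)
  have e4 := e 0 2 (by decide) 0 1 (by decide)
  have e5 := e 0 2 (by decide) 0 2 (by decide)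
  have e6 := e 0 2 (by decide) 1 2 (by decide)
  have e7 := e 1 2 (by decide) 0 1 (by decide)
  have e8 := e 1 2 (by decide) 0 2 (by decide)
  have e9 := e 1 2 (by decide) 1 2 (by decide)
  omega

/-- Version of `not_independent_disjoint_K33` for path-connected pieces of the real plane. -/
theorem not_joinedIn_K33 (v w : Fin 3 → ℝ × ℝ) (F : Fin 3 → Fin 3 → Set (ℝ × ℝ))
    (hj : ∀ i j, JoinedIn (F i j) (v i) (w j))
    (hd : ∀ i j k l, i ≠ k → j ≠ l → Disjoint (F i j) (F k l)) : False := by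
  let e : ℝ × ℝ → ℂ := fun p => equivRealProdCLM.symm p
  have he : Continuous e := equivRealProdCLM.symm.continuous
  have hinj : Function.Injective e := equivRealProdCLM.symm.injective
  refine not_independent_disjoint_K33 (fun i => e (v i)) (fun j => e (w j))
    (fun i j t => e ((hj i j).somePath.extend t)) (fun i j => ?_) (fun i j => ?_) (fun i j => ?_) ?_
  · exact he.comp (hj i j).somePath.continuous_extend
  · simp
  · simp
  · intro i j k l hik hjl s t h
    have h' := hinj h
    have m1 : (hj i j).somePath.extend s ∈ F i j := (hj i j).somePath_mem _
    have m2 : (hj k l).somePath.extend t ∈ F k l := (hj k l).somePath_mem _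
    rw [h'] at m1
    exact Set.disjoint_left.1 (hd i j k l hik hjl) m1 m2

end Topology

end CopsRobbersOnePlanar

namespace CopsRobbersOnePlanar

section Planarization

variable {V X : Type}

/-- Adjacency of the planarization, given the uncrossed edges and the incidences between
vertices and crossing points. -/
def planAdj (direct : V → V → Prop) (inc : V → X → Prop) : V ⊕ X → V ⊕ X → Prop
  | .inl a, .inl b => direct a b
  | .inl a, .inr d => inc a d
  | .inr d, .inl a => inc a d
  | .inr _, .inr _ => False

/-- `a` and `b` are joined by a path of the relation `r` inside the set `S`. -/
def LinkedIn {α : Type} (r : α → α → Prop) (S : Set α) (a b : α) : Prop :=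
  a ∈ S ∧ Relation.ReflTransGen (fun x y => x ∈ S ∧ y ∈ S ∧ r x y) a b

/-- A combinatorial record of the planarization of the drawing of the subgraph `G₀` of `G`.
The four endpoints of a crossing `d` are numbered by `pos d` along a path of `G` whose first and
last edges are the two crossing edges. -/
structure Plan (G G₀ : SimpleGraph V) (X : Type) where
  direct : V → V → Prop
  inc : V → X → Prop
  pos : X → V → ℤ
  direct_symm : ∀ a b, direct a b → direct b a
  direct_adj : ∀ a b, direct a b → G.Adj a b
  pos_mem : ∀ v d, inc v d → 0 ≤ pos d v ∧ pos d v ≤ 3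
  pos_inj : ∀ v w d, inc v d → inc w d → pos d v = pos d w → v = w
  dist_le : ∀ v w d, inc v d → inc w d → (G.dist v w : ℤ) ≤ |pos d v - pos d w|
  cover : ∀ v w, G₀.Adj v w → direct v w ∨
    ∃ d, inc v d ∧ inc w d ∧ (pos d v + pos d w = 1 ∨ pos d v + pos d w = 5)
  not_K33 : ∀ (v w : Fin 3 → V ⊕ X) (S : Fin 3 → Fin 3 → Set (V ⊕ X)),
    (∀ i j, LinkedIn (planAdj direct inc) (S i j) (v i) (w j)) →
    (∀ i j k l, i ≠ k → j ≠ l → Disjoint (S i j) (S k l)) → False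

namespace OnePlanarDrawing

variable {G : SimpleGraph V} (D : OnePlanarDrawing G) (G₀ : SimpleGraph V)

/-- The crossing points of pairs of edges of the subgraph `G₀`. -/
def crossPts : Set (ℝ × ℝ) :=
  {p | ∃ e ∈ G₀.edgeSet, ∃ f ∈ G₀.edgeSet, e ≠ f ∧
    p ∈ D.arc e '' Set.Ioo 0 1 ∧ p ∈ D.arc f '' Set.Ioo 0 1}

/-- The position of a vertex of the planarization. -/
def nodePos : V ⊕ D.crossPts G₀ → ℝ × ℝ
  | .inl v => D.vpos v
  | .inr d => d

/-- The part of the drawing of the planarization spanned by a set of its vertices. -/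
def drawn (S : Set (V ⊕ D.crossPts G₀)) : Set (ℝ × ℝ) :=
  {p | p ∈ D.nodePos G₀ '' S ∨ ∃ e ∈ G₀.edgeSet, ∃ s t : ℝ, 0 ≤ s ∧ t ≤ 1 ∧
    D.arc e s ∈ D.nodePos G₀ '' S ∧ D.arc e t ∈ D.nodePos G₀ '' S ∧
    (∀ x ∈ Set.Ioo s t, D.arc e x ∉ Set.range (D.nodePos G₀)) ∧ p ∈ D.arc e '' Set.Ioo s t}

/-- Incidence of vertices and crossing points. -/
def incident (v : V) (d : D.crossPts G₀) : Prop :=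
  ∃ e ∈ G₀.edgeSet, v ∈ e ∧ (d : ℝ × ℝ) ∈ D.arc e '' Set.Ioo 0 1

/-- Edges of `G₀` without crossing points. -/
def directAdj (a b : V) : Prop :=
  G₀.Adj a b ∧ ∀ d : D.crossPts G₀, (d : ℝ × ℝ) ∉ D.arc s(a, b) '' Set.Ioo 0 1

variable {G₀}

lemma isArc_of_mem {e : Sym2 V} (he : e ∈ G.edgeSet) :
    ∃ a b, e = s(a, b) ∧ IsArc (D.arc e) (D.vpos a) (D.vpos b) := by
  induction e with
  | h a b =>
    rcases D.arc_spec a b he with h | h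
    · exact ⟨a, b, rfl, h⟩
    · exact ⟨b, a, Sym2.eq_swap, h⟩

lemma isArc_of_mem_of_mem {e : Sym2 V} (he : e ∈ G.edgeSet) {a : V} (ha : a ∈ e) :
    ∃ b, e = s(a, b) ∧ (IsArc (D.arc e) (D.vpos a) (D.vpos b) ∨
      IsArc (D.arc e) (D.vpos b) (D.vpos a)) := by
  obtain ⟨b, rfl⟩ := Sym2.mem_iff_exists.1 ha
  exact ⟨b, rfl, D.arc_spec a b he⟩

lemma edge_le (hle : G₀ ≤ G) {e : Sym2 V} (he : e ∈ G₀.edgeSet) : e ∈ G.edgeSet :=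
  SimpleGraph.edgeSet_mono hle he

lemma nodePos_injective (hle : G₀ ≤ G) : Function.Injective (D.nodePos G₀) := by
  have aux : ∀ v (d : D.crossPts G₀), D.vpos v ≠ d := by
    rintro v ⟨p, e, he, f, hf, hne, hp, hp'⟩ rfl
    exact D.arc_avoids_vertices e (edge_le hle he) v hp
  rintro (a | d) (b | d') h
  · exact congrArg _ (D.vpos_inj h)
  · exact absurd h (aux a d')
  · exact absurd h.symm (aux b d)
  · exact congrArg _ (Subtype.ext h)

lemma drawn_disjoint (hle : G₀ ≤ G) {S S' : Set (V ⊕ D.crossPts G₀)} (h : Disjoint S S') :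
    Disjoint (D.drawn G₀ S) (D.drawn G₀ S') := by
  have hpts : Disjoint (D.nodePos G₀ '' S) (D.nodePos G₀ '' S') :=
    (Set.disjoint_image_iff (D.nodePos_injective hle)).2 h
  rw [Set.disjoint_left]
  rintro p (hp | ⟨e, he, s, t, hs, ht, hS, hT, hfree, x, hx, rfl⟩)
    (hp' | ⟨e', he', s', t', hs', ht', hS', hT', hfree', x', hx', hp'⟩)
  · exact Set.disjoint_left.1 hpts hp hp'
  · obtain ⟨y, -, rfl⟩ := hp
    exact hfree' x' hx' ⟨y, hp'.symm⟩
  · obtain ⟨y, -, hy⟩ := hp'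
    exact hfree x hx ⟨y, hy⟩
  · have hx01 : x ∈ Set.Ioo (0 : ℝ) 1 := ⟨hs.trans_lt hx.1, hx.2.trans_le ht⟩
    have hx01' : x' ∈ Set.Ioo (0 : ℝ) 1 := ⟨hs'.trans_lt hx'.1, hx'.2.trans_le ht'⟩
    by_cases hee : e = e'
    · subst hee
      obtain ⟨a, b, -, harc⟩ := D.isArc_of_mem (edge_le hle he)
      have hxx : x' = x := harc.injOn (Set.Ioo_subset_Icc_self hx01')
        (Set.Ioo_subset_Icc_self hx01) hp'
      subst hxx
      have hrS := Set.image_subset_range _ _ hS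
      have hrS' := Set.image_subset_range _ _ hS'
      have hss : s = s' := by
        rcases lt_trichotomy s s' with hlt | heq | hlt
        · exact absurd hrS' (hfree s' ⟨hlt, hx'.1.trans hx.2⟩)
        · exact heq
        · exact absurd hrS (hfree' s ⟨hlt, hx.1.trans hx'.2⟩)
      subst hss
      exact Set.disjoint_left.1 hpts hS hS'
    · exact hfree x hx ⟨.inr ⟨D.arc e x, e, he, e', he', hee, ⟨x, hx01, rfl⟩, ⟨x', hx01', hp'⟩⟩, rfl⟩

lemma joinedIn_drawn_piece (hle : G₀ ≤ G) {S : Set (V ⊕ D.crossPts G₀)} {e : Sym2 V}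
    (he : e ∈ G₀.edgeSet)
    {s t : ℝ} (hs : 0 ≤ s) (hst : s < t) (ht : t ≤ 1) {a b : V ⊕ D.crossPts G₀}
    (ha : a ∈ S) (hb : b ∈ S) (hsa : D.arc e s = D.nodePos G₀ a) (htb : D.arc e t = D.nodePos G₀ b)
    (hfree : ∀ x ∈ Set.Ioo s t, D.arc e x ∉ Set.range (D.nodePos G₀)) :
    JoinedIn (D.drawn G₀ S) (D.nodePos G₀ a) (D.nodePos G₀ b) := by
  obtain ⟨_, _, -, harc⟩ := D.isArc_of_mem (edge_le hle he)
  have hpc : IsPathConnected (D.arc e '' Set.Icc s t) :=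
    ((convex_Icc s t).isPathConnected ⟨s, le_rfl, hst.le⟩).image'
      (harc.continuousOn.mono (Set.Icc_subset_Icc hs ht))
  have hJ := hpc.joinedIn (D.arc e s) ⟨s, ⟨le_rfl, hst.le⟩, rfl⟩ (D.arc e t) ⟨t, ⟨hst.le, le_rfl⟩, rfl⟩
  rw [hsa, htb] at hJ
  refine hJ.mono ?_
  rintro _ ⟨x, hx, rfl⟩
  rcases hx.1.eq_or_lt with rfl | h1
  · exact Or.inl ⟨a, ha, hsa.symm⟩
  rcases hx.2.eq_or_lt with rfl | h2
  · exact Or.inl ⟨b, hb, htb.symm⟩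
  exact Or.inr ⟨e, he, s, t, hs, ht, ⟨a, ha, hsa.symm⟩, ⟨b, hb, htb.symm⟩, hfree, x, ⟨h1, h2⟩, rfl⟩

lemma eq_of_crossPt (hle : G₀ ≤ G) {e : Sym2 V} (he : e ∈ G₀.edgeSet) {p q : ℝ × ℝ}
    (hp : p ∈ D.crossPts G₀) (hq : q ∈ D.crossPts G₀)
    (hpe : p ∈ D.arc e '' Set.Ioo 0 1) (hqe : q ∈ D.arc e '' Set.Ioo 0 1) : p = q := by
  have aux : ∀ p ∈ D.crossPts G₀, p ∈ D.arc e '' Set.Ioo 0 1 → ∃ f ∈ G.edgeSet, f ≠ e ∧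
      p ∈ (D.arc e '' Set.Ioo (0 : ℝ) 1) ∩ (D.arc f '' Set.Ioo (0 : ℝ) 1) := by
    rintro p ⟨f, hf, g, hg, hfg, hpf, hpg⟩ hpe
    by_cases h : f = e
    · exact ⟨g, edge_le hle hg, fun h' => hfg (h.trans h'.symm), hpe, hpg⟩
    · exact ⟨f, edge_le hle hf, h, hpe, hpf⟩
  exact D.crossed_at_most_once e (edge_le hle he) (aux p hp hpe) (aux q hq hqe)

lemma joinedIn_drawn_inc (hle : G₀ ≤ G) {S : Set (V ⊕ D.crossPts G₀)} {a : V} {d : D.crossPts G₀}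
    (h : D.incident G₀ a d) (ha : .inl a ∈ S) (hd : .inr d ∈ S) :
    JoinedIn (D.drawn G₀ S) (D.vpos a) d := by
  obtain ⟨e, he, hae, t, ht, htd⟩ := h
  have hfree : ∀ x ∈ Set.Ioo (0 : ℝ) 1, x ≠ t → D.arc e x ∉ Set.range (D.nodePos G₀) := by
    rintro x hx hxt ⟨v | d', hy⟩
    · exact D.arc_avoids_vertices e (edge_le hle he) v ⟨x, hx, hy.symm⟩
    · obtain ⟨_, _, -, harc⟩ := D.isArc_of_mem (edge_le hle he)
      refine hxt (harc.injOn (Set.Ioo_subset_Icc_self hx) (Set.Ioo_subset_Icc_self ht) ?_)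
      rw [htd, ← hy]
      exact D.eq_of_crossPt hle he d'.2 d.2 ⟨x, hx, hy.symm⟩ ⟨t, ht, htd⟩
  obtain ⟨b, -, harc | harc⟩ := D.isArc_of_mem_of_mem (edge_le hle he) hae
  · exact D.joinedIn_drawn_piece hle he (a := .inl a) (b := .inr d) le_rfl ht.1 ht.2.le ha hd
      harc.source htd (fun x hx => hfree x ⟨hx.1, hx.2.trans ht.2⟩ hx.2.ne)
  · exact (D.joinedIn_drawn_piece hle he (a := .inr d) (b := .inl a) ht.1.le ht.2 le_rfl hd ha
      htd harc.target (fun x hx => hfree x ⟨ht.1.trans hx.1, hx.2⟩ hx.1.ne')).symm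

lemma joinedIn_drawn_direct (hle : G₀ ≤ G) {S : Set (V ⊕ D.crossPts G₀)} {a b : V}
    (h : D.directAdj G₀ a b) (ha : .inl a ∈ S) (hb : .inl b ∈ S) :
    JoinedIn (D.drawn G₀ S) (D.vpos a) (D.vpos b) := by
  have he : s(a, b) ∈ G₀.edgeSet := h.1
  have hfree : ∀ x ∈ Set.Ioo (0 : ℝ) 1, D.arc s(a, b) x ∉ Set.range (D.nodePos G₀) := by
    rintro x hx ⟨v | d', hy⟩
    · exact D.arc_avoids_vertices _ (edge_le hle he) v ⟨x, hx, hy.symm⟩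
    · exact h.2 d' ⟨x, hx, hy.symm⟩
  rcases D.arc_spec a b (hle h.1) with harc | harc
  · exact D.joinedIn_drawn_piece hle he (a := .inl a) (b := .inl b) le_rfl one_pos le_rfl ha hb
      harc.source harc.target hfree
  · exact (D.joinedIn_drawn_piece hle he (a := .inl b) (b := .inl a) le_rfl one_pos le_rfl hb ha
      harc.source harc.target hfree).symm

lemma joinedIn_drawn (hle : G₀ ≤ G) {S : Set (V ⊕ D.crossPts G₀)} {a b : V ⊕ D.crossPts G₀}
    (h : LinkedIn (planAdj (D.directAdj G₀) (D.incident G₀)) S a b) :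
    JoinedIn (D.drawn G₀ S) (D.nodePos G₀ a) (D.nodePos G₀ b) := by
  obtain ⟨ha, h⟩ := h
  induction h with
  | refl => exact JoinedIn.refl (Or.inl ⟨a, ha, rfl⟩)
  | @tail x y _ hxy ih =>
    refine ih.trans ?_
    obtain ⟨hx, hy, hxy⟩ := hxy
    rcases x with x | x <;> rcases y with y | y
    · exact D.joinedIn_drawn_direct hle hxy hx hy
    · exact D.joinedIn_drawn_inc hle hxy hx hy
    · exact (D.joinedIn_drawn_inc hle hxy hy hx).symm
    · exact hxy.elim

lemma finite_crossPts (hle : G₀ ≤ G) [Finite V] : Finite (D.crossPts G₀) := by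
  choose e he _ _ _ hpe _ using fun d : D.crossPts G₀ => d.2
  refine Finite.of_injective e fun d d' h => Subtype.ext ?_
  exact D.eq_of_crossPt hle (he d) d.2 d'.2 (hpe d) (h ▸ hpe d')

lemma exists_crossing_endpoints (hle : G₀ ≤ G)
    (hX : ∀ e ∈ G₀.edgeSet, ∀ f ∈ G₀.edgeSet, ¬ D.IsXCrossing e f) (d : D.crossPts G₀) :
    ∃ a a' b b' : V, [a, a', b, b'].Nodup ∧ G.Adj a a' ∧ G.Adj a' b ∧ G.Adj b b' ∧
      ∀ e ∈ G₀.edgeSet, (d : ℝ × ℝ) ∈ D.arc e '' Set.Ioo 0 1 → e = s(a, a') ∨ e = s(b, b') := by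
  obtain ⟨e, he, f, hf, hne, hde, hdf⟩ := d.2
  have heG := edge_le hle he
  have hfG := edge_le hle hf
  have hkite := hX e he f hf
  simp only [IsXCrossing, not_and, not_forall, not_not] at hkite
  obtain ⟨a', b, ha', hb, hab⟩ := hkite ⟨heG, hfG, hne, d, hde, hdf⟩
  have hshare : ∀ w, w ∈ e → w ∈ f → False := fun w hwe hwf => by
    have := D.no_adjacent_crossing e heG f hfG hne ⟨w, hwe, hwf⟩
    exact Set.eq_empty_iff_forall_notMem.1 this d ⟨hde, hdf⟩
  obtain ⟨a, rfl⟩ := Sym2.mem_iff_exists.1 ha'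
  obtain ⟨b', rfl⟩ := Sym2.mem_iff_exists.1 hb
  have h1 : G.Adj a' a := heG
  have h2 : G.Adj b b' := hfG
  refine ⟨a, a', b, b', ?_, h1.symm, hab, h2, ?_⟩
  · have e1 := hshare a
    have e2 := hshare a'
    simp only [Sym2.mem_iff] at e1 e2
    have := h1.ne
    have := h2.ne
    simp only [List.nodup_cons, List.mem_cons, List.not_mem_nil, not_or, not_false_eq_true, or_false]
    grind
  · intro g hg hdg
    by_contra! hcon
    have h3 : s(a', a) ≠ g := fun h => hcon.1 (h ▸ Sym2.eq_swap)
    have := D.no_triple_point _ heG _ hfG g (edge_le hle hg) hne h3 hcon.2.symm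
    exact Set.eq_empty_iff_forall_notMem.1 this d ⟨⟨hde, hdf⟩, hdg⟩

/-- The planarization of the drawing of a subgraph without ×-crossings. -/
theorem exists_plan (hle : G₀ ≤ G) (hconn : G.Connected)
    (hX : ∀ e ∈ G₀.edgeSet, ∀ f ∈ G₀.edgeSet, ¬ D.IsXCrossing e f) :
    Nonempty (Plan G G₀ (D.crossPts G₀)) := by
  classical
  choose A A' B B' hnd hAA hAB hBB honly using D.exists_crossing_endpoints hle hX
  let pos : D.crossPts G₀ → V → ℤ := fun d v =>
    if v = A d then 0 else if v = A' d then 1 else if v = B d then 2 else 3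
  have hinc : ∀ v d, D.incident G₀ v d →
      (v = A d ∧ pos d v = 0) ∨ (v = A' d ∧ pos d v = 1) ∨
      (v = B d ∧ pos d v = 2) ∨ (v = B' d ∧ pos d v = 3) := by
    rintro v d ⟨e, he, hve, hde⟩
    have := hnd d
    simp only [List.nodup_cons, List.mem_cons, List.not_mem_nil, not_or, not_false_eq_true,
      or_false] at this
    have hv : (v = A d ∨ v = A' d) ∨ (v = B d ∨ v = B' d) := by
      rcases honly d e he hde with rfl | rfl
      · exact Or.inl (Sym2.mem_iff.1 hve)
      · exact Or.inr (Sym2.mem_iff.1 hve)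
    simp only [pos]
    grind
  refine ⟨⟨D.directAdj G₀, D.incident G₀, pos, ?_, ?_, ?_, ?_, ?_, ?_, ?_⟩⟩
  · rintro a b ⟨h, h'⟩
    exact ⟨h.symm, by rwa [Sym2.eq_swap]⟩
  · exact fun a b h => hle h.1
  · intro v d h
    have := hinc v d h
    omega
  · intro v w d hv hw h
    rcases hinc v d hv with ⟨h1, h2⟩ | ⟨h1, h2⟩ | ⟨h1, h2⟩ | ⟨h1, h2⟩ <;>
      rcases hinc w d hw with ⟨h3, h4⟩ | ⟨h3, h4⟩ | ⟨h3, h4⟩ | ⟨h3, h4⟩ <;>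
      first | exact h1.trans h3.symm | omega
  · intro v w d hv hw
    have d1 : G.dist (A d) (A' d) = 1 := SimpleGraph.dist_eq_one_iff_adj.2 (hAA d)
    have d2 : G.dist (A' d) (B d) = 1 := SimpleGraph.dist_eq_one_iff_adj.2 (hAB d)
    have d3 : G.dist (B d) (B' d) = 1 := SimpleGraph.dist_eq_one_iff_adj.2 (hBB d)
    have t1 := hconn.dist_triangle (u := A d) (v := A' d) (w := B d)
    have t2 := hconn.dist_triangle (u := A' d) (v := B d) (w := B' d)
    have t3 := hconn.dist_triangle (u := A d) (v := B d) (w := B' d)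
    rcases hinc v d hv with ⟨h1, h2⟩ | ⟨h1, h2⟩ | ⟨h1, h2⟩ | ⟨h1, h2⟩ <;>
      rcases hinc w d hw with ⟨h3, h4⟩ | ⟨h3, h4⟩ | ⟨h3, h4⟩ | ⟨h3, h4⟩ <;>
      rw [h2, h4, h1, h3] <;> first | simp only [SimpleGraph.dist_self] | skip
    all_goals first | (norm_num; omega) | (rw [SimpleGraph.dist_comm]; norm_num; omega) | norm_num
  · intro v w hvw
    by_cases h : D.directAdj G₀ v w
    · exact Or.inl h
    · simp only [directAdj, not_and, not_forall, not_not] at h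
      obtain ⟨d, hd⟩ := h hvw
      have hv : D.incident G₀ v d := ⟨s(v, w), hvw, Sym2.mem_mk_left v w, hd⟩
      have hw : D.incident G₀ w d := ⟨s(v, w), hvw, Sym2.mem_mk_right v w, hd⟩
      refine Or.inr ⟨d, hv, hw, ?_⟩
      have hne := hvw.ne
      have := hnd d
      simp only [List.nodup_cons, List.mem_cons, List.not_mem_nil, not_or, not_false_eq_true,
        or_false] at this
      have i1 := hinc v d hv
      have i2 := hinc w d hw
      have := honly d _ hvw hd
      simp only [Sym2.eq_iff] at this
      grind
  · intro v w S hS hd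
    exact not_joinedIn_K33 (fun i => D.nodePos G₀ (v i)) (fun j => D.nodePos G₀ (w j))
      (fun i j => D.drawn G₀ (S i j)) (fun i j => D.joinedIn_drawn hle (hS i j))
      (fun i j k l hik hjl => D.drawn_disjoint hle (hd i j k l hik hjl))

end OnePlanarDrawing

end Planarization

end CopsRobbersOnePlanar

namespace CopsRobbersOnePlanar

section Game

variable {V ι : Type}

/-- The cops, moving on `G`, win from the position `c`, `r` (cops to move) against a robber
who moves on `R`. -/
inductive Win (G R : SimpleGraph V) : (ι → V) → V → Prop
  | capture (c : ι → V) (r : V) (i : ι) : (c i = r ∨ G.Adj (c i) r) → Win G R c r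
  | step (c : ι → V) (r : V) (c' : ι → V) : (∀ i, c' i = c i ∨ G.Adj (c i) (c' i)) →
      (∀ r', (r' = r ∨ R.Adj r r') → Win G R c' r') → Win G R c r

/-- The cops win from the position `c`, `r` within `n + 1` moves. -/
def WinIn (G : SimpleGraph V) : ℕ → (ι → V) → V → Prop
  | 0, c, r => ∃ i, c i = r ∨ G.Adj (c i) r
  | n + 1, c, r => WinIn G n c r ∨ ∃ c' : ι → V, (∀ i, c' i = c i ∨ G.Adj (c i) (c' i)) ∧
      ∀ r', (r' = r ∨ G.Adj r r') → WinIn G n c' r'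

variable {G : SimpleGraph V}

lemma WinIn.mono {m n : ℕ} (h : m ≤ n) {c : ι → V} {r : V} (hw : WinIn G m c r) :
    WinIn G n c r := by
  induction h with
  | refl => exact hw
  | step _ ih => exact Or.inl ih

lemma Win.exists_winIn [Finite V] {c : ι → V} {r : V} (h : Win G G c r) :
    ∃ n, WinIn G n c r := by
  induction h with
  | capture c r i h => exact ⟨0, i, h⟩
  | step c r c' hc _ ih =>
    choose! n hn using ih
    obtain ⟨N, hN⟩ := (Set.finite_range n).bddAbove
    exact ⟨N + 1, Or.inr ⟨c', hc, fun r' hr' => (hn r' hr').mono (hN ⟨r', rfl⟩)⟩⟩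

lemma exists_good_move {c : ι → V} {r : V} (n : ℕ) (h : WinIn G n c r)
    (hmin : ∀ m < n, ¬ WinIn G m c r) :
    ∃ c' : ι → V, (∀ i, c' i = c i ∨ G.Adj (c i) (c' i)) ∧
      ((∃ i, c' i = r) ∨ ∀ r', (r' = r ∨ G.Adj r r') → ∃ m < n, WinIn G m c' r') := by
  classical
  cases n with
  | zero =>
    obtain ⟨i, hi⟩ := h
    refine ⟨Function.update c i r, fun j => ?_, Or.inl ⟨i, by simp⟩⟩
    by_cases hj : j = i
    · subst hj; simpa [eq_comm] using hi
    · simp [hj]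
  | succ n =>
    rcases h with h | ⟨c', hc', h⟩
    · exact absurd h (hmin n n.lt_succ_self)
    · exact ⟨c', hc', Or.inr fun r' hr' => ⟨n, n.lt_succ_self, h r' hr'⟩⟩

theorem copsWin_of_win [Finite V] {k : ℕ} (c₀ : Fin k → V) (h : ∀ r, Win G G c₀ r) :
    CopsWin G k := by
  classical
  have key : ∀ (c : Fin k → V) (r : V), ∃ c' : Fin k → V,
      (∀ i, c' i = c i ∨ G.Adj (c i) (c' i)) ∧ ∀ n, WinIn G n c r →
      ((∃ i, c' i = r) ∨ ∀ r', (r' = r ∨ G.Adj r r') → ∃ m < n, WinIn G m c' r') := by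
    intro c r
    by_cases hw : ∃ n, WinIn G n c r
    · obtain ⟨c', hc', hg⟩ := exists_good_move (Nat.find hw) (Nat.find_spec hw)
        (fun m hm => Nat.find_min hw hm)
      refine ⟨c', hc', fun n hn => hg.imp id fun hg r' hr' => ?_⟩
      obtain ⟨m, hm, hmw⟩ := hg r' hr'
      exact ⟨m, hm.trans_le (Nat.find_min' hw hn), hmw⟩
    · exact ⟨c, fun i => Or.inl rfl, fun n hn => absurd ⟨n, hn⟩ hw⟩
  choose mv hmv hgood using key
  refine ⟨⟨c₀, mv, hmv⟩, fun π ⟨hπ0, hπ⟩ => ?_⟩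
  have descent : ∀ n t, WinIn G n (π.cop t) (π.rob t) → ∃ s, π.CapturedAt s := by
    intro n
    induction n using Nat.strong_induction_on with
    | _ n ih =>
      intro t hw
      rcases hgood _ _ n hw with ⟨i, hi⟩ | hg
      · exact ⟨t, i, Or.inr (by rw [hπ]; exact hi)⟩
      · obtain ⟨m, hm, hmw⟩ := hg (π.rob (t + 1)) (π.rob_valid t)
        exact ih m hm (t + 1) (by rw [hπ]; exact hmw)
  obtain ⟨n, hn⟩ := (h (π.rob 0)).exists_winIn
  refine descent n 0 ?_
  rw [hπ0]
  exact hn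

lemma Win.comp_equiv {κ : Type} {R : SimpleGraph V} (e : κ ≃ ι) {c : ι → V} {r : V}
    (h : Win G R c r) : Win G R (c ∘ e) r := by
  induction h with
  | capture c r i h => exact .capture _ _ (e.symm i) (by simpa using h)
  | step c r c' hc _ ih => exact .step _ _ (c' ∘ e) (fun i => hc (e i)) ih

/-- Extra cops standing on the vertices of `S` confine the robber to the complement of `S`. -/
lemma Win.sum_static {S : Set V} {R : SimpleGraph V}
    (hR : ∀ a b, a ∉ S → b ∉ S → G.Adj a b → R.Adj a b) {c : ι → V} {r : V}
    (h : Win G R c r) (hr : r ∉ S) :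
    Win G G (Sum.elim (fun s : S => (s : V)) c) r := by
  induction h with
  | capture c r i h => exact .capture _ _ (.inr i) h
  | step c r c' hc _ ih =>
    refine .step _ _ (Sum.elim (fun s : S => (s : V)) c') ?_ fun r' hr' => ?_
    · rintro (i | i)
      · exact Or.inl rfl
      · exact hc i
    · by_cases hS : r' ∈ S
      · exact .capture _ _ (.inl ⟨r', hS⟩) (Or.inl rfl)
      · exact ih r' (hr'.imp id (hR r r' hr hS)) hS

end Game

end CopsRobbersOnePlanar

namespace CopsRobbersOnePlanar

section Guarding

variable {V X : Type}

/-- A vertex `h` of the planarization guarded by cops travelling along a walk `p : ℤ → V`: the walk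
is at `pl` at time `lo` and at `ph` at time `hi`. If `h` is a crossing point then a robber on
a vertex `s` incident with `h` is supposed to be shadowed by a time between `dn s` and `up s`. -/
structure Station (V X : Type) where
  h : V ⊕ X
  lo : ℤ
  hi : ℤ
  pl : V
  ph : V
  dn : V → ℤ
  up : V → ℤ

variable {G G₀ : SimpleGraph V} (K : Plan G G₀ X)

/-- Adjacency in the planarization. -/
abbrev Plan.Adj : V ⊕ X → V ⊕ X → Prop := planAdj K.direct K.inc

/-- `a` and `b` are joined by an uncrossed edge or share a crossing point in `T`; `c` bounds the
distance between them. -/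
def Plan.Link (T : Set (V ⊕ X)) (a b : V) (c : ℤ) : Prop :=
  (K.direct a b ∧ c = 1) ∨
    ∃ d, .inr d ∈ T ∧ K.inc a d ∧ K.inc b d ∧ c = |K.pos d a - K.pos d b|

/-- The function `φ` is Lipschitz on the vertices in `T`. -/
def Plan.Lip (T : Set (V ⊕ X)) (φ : V → ℤ) : Prop :=
  ∀ a b c, .inl a ∈ T → .inl b ∈ T → K.Link T a b c → φ b ≤ φ a + c

/-- The vertex `s` of `T` sees the station `σ`, and should be shadowed between `l` and `u`. -/
def Plan.Sees (T : Set (V ⊕ X)) (σ : Station V X) (s : V) (u l : ℤ) : Prop :=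
  .inl s ∈ T ∧
    ((∃ x c, σ.h = .inl x ∧ K.Link T x s c ∧ u = σ.lo + c ∧ l = σ.lo - c) ∨
      ∃ d, σ.h = .inr d ∧ K.inc s d ∧ u = σ.up s ∧ l = σ.dn s)

/-- Cops which are around time `m` on a walk serving `σ` prevent the robber on `s` from traversing
the crossing point `d`. -/
def Plan.Catches (σ : Station V X) (m : ℤ) (d : X) (s : V) : Prop :=
  ∀ r, K.inc r d → (K.pos d s + K.pos d r = 1 ∨ K.pos d s + K.pos d r = 5) →
    ∃ j v, ((j = σ.lo ∧ v = σ.pl) ∨ (j = σ.hi ∧ v = σ.ph)) ∧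
      ((|j - m| ≤ 2 ∧ G.dist v s ≤ 1) ∨ (|j - m| ≤ 3 ∧ G.dist v r ≤ 1))

/-- The station `σ` is served by the walk `p` against a robber in `T`. -/
def Plan.StationOK (T : Set (V ⊕ X)) (p : ℤ → V) (σ : Station V X) : Prop :=
  σ.h ∉ T ∧ .inl σ.pl ∉ T ∧ .inl σ.ph ∉ T ∧ p σ.lo = σ.pl ∧ p σ.hi = σ.ph ∧
  ((∃ x, σ.h = .inl x ∧ σ.pl = x ∧ σ.ph = x ∧ σ.lo = σ.hi) ∨
    ∃ d, σ.h = .inr d ∧ σ.lo < σ.hi ∧ K.inc σ.pl d ∧ K.inc σ.ph d ∧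
      (∀ s, .inl s ∈ T → K.inc s d → σ.lo + |K.pos d σ.pl - K.pos d s| ≤ σ.up s ∧
        σ.dn s ≤ σ.hi - |K.pos d σ.ph - K.pos d s|) ∧
      ((σ.pl ≠ σ.ph ∧ ∀ s, .inl s ∈ T → K.inc s d → σ.up s = σ.lo + |K.pos d σ.pl - K.pos d s| ∧
        σ.dn s = σ.hi - |K.pos d σ.ph - K.pos d s|) ∨
      ∀ s, .inl s ∈ T → K.inc s d → (∀ s', .inl s' ∈ T → K.inc s' d → s' = s) ∧
        ∀ m, σ.dn s ≤ m → m ≤ σ.up s → K.Catches σ m d s))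

/-- Cops following the walk `p` at the times given by `φ` guard the stations in the list `Q`. -/
structure Plan.Route (T : Set (V ⊕ X)) (p : ℤ → V) (φ : V → ℤ) (Q : List (Station V X)) :
    Prop where
  lazy : ∀ m, G.dist (p m) (p (m + 1)) ≤ 1
  lip : K.Lip T φ
  ok : ∀ σ ∈ Q, K.StationOK T p σ
  guard : ∀ σ ∈ Q, ∀ s u l, K.Sees T σ s u l → l ≤ φ s ∧ φ s ≤ u
  ordered : Q.Pairwise fun σ τ => σ.hi ≤ τ.lo

variable {K}

lemma Plan.adj_symm {a b : V ⊕ X} (h : K.Adj a b) : K.Adj b a := by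
  rcases a with a | a <;> rcases b with b | b
  · exact K.direct_symm _ _ h
  · exact h
  · exact h
  · exact h

lemma Plan.Link.symm {T : Set (V ⊕ X)} {a b : V} {c : ℤ} (h : K.Link T a b c) : K.Link T b a c := by
  rcases h with ⟨h, rfl⟩ | ⟨d, hd, ha, hb, rfl⟩
  · exact Or.inl ⟨K.direct_symm _ _ h, rfl⟩
  · exact Or.inr ⟨d, hd, hb, ha, abs_sub_comm _ _⟩

lemma Plan.Link.mono {T T' : Set (V ⊕ X)} (hT : T' ⊆ T) {a b : V} {c : ℤ}
    (h : K.Link T' a b c) : K.Link T a b c :=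
  h.imp id fun ⟨d, hd, h⟩ => ⟨d, hT hd, h⟩

lemma Plan.Link.dist_le {T : Set (V ⊕ X)} {a b : V} {c : ℤ} (h : K.Link T a b c) :
    (G.dist a b : ℤ) ≤ c := by
  rcases h with ⟨h, rfl⟩ | ⟨d, hd, ha, hb, rfl⟩
  · rw [SimpleGraph.dist_eq_one_iff_adj.2 (K.direct_adj _ _ h)]; rfl
  · exact K.dist_le _ _ d ha hb

lemma Plan.Link.nonneg {T : Set (V ⊕ X)} {a b : V} {c : ℤ} (h : K.Link T a b c) : 0 ≤ c :=
  le_trans (by positivity) h.dist_le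

lemma Plan.Link.pos_of_ne {T : Set (V ⊕ X)} {a b : V} {c : ℤ} (h : K.Link T a b c) (hab : a ≠ b) :
    0 < c := by
  rcases h with ⟨h, rfl⟩ | ⟨d, hd, ha, hb, rfl⟩
  · exact one_pos
  · exact abs_pos.2 fun h => hab (K.pos_inj _ _ d ha hb (by omega))

lemma Plan.Lip.mono {T T' : Set (V ⊕ X)} (hT : T' ⊆ T) {φ : V → ℤ} (h : K.Lip T φ) : K.Lip T' φ :=
  fun a b c ha hb hl => h a b c (hT ha) (hT hb) (hl.mono hT)

lemma Plan.Sees.mono {T T' : Set (V ⊕ X)} (hT : T' ⊆ T) {σ : Station V X} {s : V} {u l : ℤ}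
    (h : K.Sees T' σ s u l) : K.Sees T σ s u l :=
  ⟨hT h.1, h.2.imp (fun ⟨x, c, h1, h2, h3⟩ => ⟨x, c, h1, h2.mono hT, h3⟩) id⟩

lemma Plan.StationOK.mono {T T' : Set (V ⊕ X)} (hT : T' ⊆ T) {p : ℤ → V} {σ : Station V X}
    (h : K.StationOK T p σ) : K.StationOK T' p σ := by
  obtain ⟨h1, h2, h3, h4, h5, h6⟩ := h
  refine ⟨fun h => h1 (hT h), fun h => h2 (hT h), fun h => h3 (hT h), h4, h5, h6.imp id ?_⟩
  rintro ⟨d, hd, hlt, i1, i2, hb, hf⟩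
  refine ⟨d, hd, hlt, i1, i2, fun s hs => hb s (hT hs), hf.imp ?_ ?_⟩
  · exact fun ⟨hne, h⟩ => ⟨hne, fun s hs => h s (hT hs)⟩
  · exact fun h s hs hi => ⟨fun s' hs' => (h s (hT hs) hi).1 s' (hT hs'), (h s (hT hs) hi).2⟩

lemma Plan.Route.mono {T T' : Set (V ⊕ X)} (hT : T' ⊆ T) {p : ℤ → V} {φ : V → ℤ}
    {Q Q' : List (Station V X)} (h : K.Route T p φ Q) (hQ : Q'.Sublist Q) : K.Route T' p φ Q' :=
  ⟨h.lazy, h.lip.mono hT, fun σ hσ => (h.ok σ (hQ.subset hσ)).mono hT,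
    fun σ hσ s u l hs => h.guard σ (hQ.subset hσ) s u l (hs.mono hT), h.ordered.sublist hQ⟩

lemma dist_le_one_iff (hG : G.Connected) {a b : V} : G.dist a b ≤ 1 ↔ b = a ∨ G.Adj a b := by
  rw [Nat.le_one_iff_eq_zero_or_eq_one, hG.dist_eq_zero_iff, SimpleGraph.dist_eq_one_iff_adj,
    eq_comm]

lemma Plan.catches_of_pos {σ : Station V X} {d : X} {s : V} {m : ℤ} (i1 : K.inc σ.pl d)
    (i2 : K.inc σ.ph d) (hi : K.inc s d)
    (h : ∀ r, 0 ≤ r → r ≤ 3 → (K.pos d s + r = 1 ∨ K.pos d s + r = 5) →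
      (|σ.lo - m| ≤ 3 ∧ |K.pos d σ.pl - r| ≤ 1) ∨
        (|σ.lo - m| ≤ 2 ∧ |K.pos d σ.pl - K.pos d s| ≤ 1) ∨
        (|σ.hi - m| ≤ 3 ∧ |K.pos d σ.ph - r| ≤ 1) ∨
        (|σ.hi - m| ≤ 2 ∧ |K.pos d σ.ph - K.pos d s| ≤ 1)) :
    K.Catches σ m d s := by
  intro r hr hsum
  have d1 := K.dist_le _ _ d i1 hi
  have d2 := K.dist_le _ _ d i2 hi
  have d3 := K.dist_le _ _ d i1 hr
  have d4 := K.dist_le _ _ d i2 hr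
  obtain ⟨b1, b2⟩ := K.pos_mem _ d hr
  rcases h (K.pos d r) b1 b2 hsum with h | h | h | h
  · exact ⟨_, _, Or.inl ⟨rfl, rfl⟩, Or.inr ⟨h.1, by omega⟩⟩
  · exact ⟨_, _, Or.inl ⟨rfl, rfl⟩, Or.inl ⟨h.1, by omega⟩⟩
  · exact ⟨_, _, Or.inr ⟨rfl, rfl⟩, Or.inr ⟨h.1, by omega⟩⟩
  · exact ⟨_, _, Or.inr ⟨rfl, rfl⟩, Or.inl ⟨h.1, by omega⟩⟩

lemma Plan.StationOK.catches {T : Set (V ⊕ X)} {p : ℤ → V} {σ : Station V X}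
    (h : K.StationOK T p σ) {d : X} (hd : σ.h = .inr d) {s : V} (hs : .inl s ∈ T) (hi : K.inc s d)
    {m : ℤ} (h1 : σ.dn s ≤ m) (h2 : m ≤ σ.up s) : K.Catches σ m d s := by
  obtain ⟨-, hpl, hph, e1, e2, ⟨x, hx, -⟩ | ⟨d', hd', hlt, i1, i2, hb, ⟨hne, hf⟩ | hf⟩⟩ := h
  · rw [hd] at hx; cases hx
  · rw [hd] at hd'; cases hd'
    refine catches_of_pos i1 i2 hi fun r hr0 hr3 hsum => ?_
    obtain ⟨f1, f2⟩ := hf s hs hi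
    rw [f2] at h1
    rw [f1] at h2
    have n1 : K.pos d σ.pl ≠ K.pos d s := fun h => hpl (K.pos_inj _ _ d i1 hi h ▸ hs)
    have n2 : K.pos d σ.ph ≠ K.pos d s := fun h => hph (K.pos_inj _ _ d i2 hi h ▸ hs)
    have n3 : K.pos d σ.pl ≠ K.pos d σ.ph := fun h => hne (K.pos_inj _ _ d i1 i2 h)
    have b1 := K.pos_mem _ d i1
    have b2 := K.pos_mem _ d i2
    have b3 := K.pos_mem _ d hi
    simp only [abs_eq_max_neg] at h1 h2 ⊢
    omega
  · rw [hd] at hd'; cases hd'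
    exact (hf s hs hi).2 m h1 h2

end Guarding

end CopsRobbersOnePlanar

namespace CopsRobbersOnePlanar

section Play

variable {V X : Type} {G G₀ : SimpleGraph V} {K : Plan G G₀ X}

variable (K) in
/-- The robber on `r` is confined to the connected territory `T` by the groups of cops in `A`: each
group `g ∈ A` consists of seven consecutive cops on the walk `p g` following the shadow `φ g` of
the robber, and guards the stations in `Q g`. -/
structure Plan.Confined (c : Fin 3 × Fin 7 → V) (r : V) (T : Set (V ⊕ X)) (A : Set (Fin 3))
    (p : Fin 3 → ℤ → V) (φ : Fin 3 → V → ℤ) (Q : Fin 3 → List (Station V X)) : Prop where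
  mem : .inl r ∈ T
  conn : ∀ z ∈ T, ∀ z' ∈ T, LinkedIn K.Adj T z z'
  bound : ∀ z ∈ T, ∀ z' ∉ T, K.Adj z z' → ∃ g ∈ A, ∃ σ ∈ Q g, σ.h = z'
  route : ∀ g ∈ A, K.Route T (p g) (φ g) (Q g)
  cops : ∀ g ∈ A, ∃ m, |m - φ g r| ≤ 1 ∧ ∀ i : Fin 7, c (g, i) = p g (m + i - 3)

lemma exists_fin_seven {c : Fin 3 × Fin 7 → V} {g : Fin 3} {p : ℤ → V} {m j : ℤ}
    (h : ∀ i : Fin 7, c (g, i) = p (m + i - 3)) (hj : |j - m| ≤ 3) : ∃ i, c i = p j := by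
  rw [abs_le] at hj
  refine ⟨(g, ⟨(j - m + 3).toNat, by omega⟩), ?_⟩
  rw [h]
  congr 1
  simp only
  omega

lemma dist_lazy_le {p : ℤ → V} (hp : ∀ m, G.dist (p m) (p (m + 1)) ≤ 1)
    {m n : ℤ} (h : |m - n| ≤ 1) : G.dist (p m) (p n) ≤ 1 := by
  rw [abs_le] at h
  rcases (by omega : n = m ∨ n = m + 1 ∨ m = n + 1) with rfl | rfl | rfl
  · simp
  · exact hp m
  · rw [SimpleGraph.dist_comm]; exact hp n

lemma Plan.Confined.step (hG : G.Connected) {c : Fin 3 × Fin 7 → V} {r : V} {T : Set (V ⊕ X)}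
    {A : Set (Fin 3)} {p : Fin 3 → ℤ → V} {φ : Fin 3 → V → ℤ} {Q : Fin 3 → List (Station V X)}
    (h : K.Confined c r T A p φ Q) (f : Fin 3 × Fin 7 → V) (hf : ∀ i, G.dist (c i) (f i) ≤ 1)
    (hnext : ∀ c' r', (∀ g ∉ A, ∀ i, c' (g, i) = f (g, i)) →
      (∀ ψ, K.Lip T ψ → |ψ r' - ψ r| ≤ 1) → K.Confined c' r' T A p φ Q → Win G G₀ c' r') :
    Win G G₀ c r := by
  classical
  by_cases hcap : ∃ i, G.dist (c i) r ≤ 1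
  · obtain ⟨i, hi⟩ := hcap
    exact .capture _ _ i (((dist_le_one_iff hG).1 hi).imp Eq.symm id)
  let c' : Fin 3 × Fin 7 → V := fun x => if x.1 ∈ A then p x.1 (φ x.1 r + x.2 - 3) else f x
  have hc'A : ∀ g ∈ A, ∀ i : Fin 7, c' (g, i) = p g (φ g r + i - 3) := fun g hg i => if_pos hg
  have hc'f : ∀ g ∉ A, ∀ i, c' (g, i) = f (g, i) := fun g hg i => if_neg hg
  refine .step _ _ c' ?_ ?_
  · rintro ⟨g, i⟩
    rw [← dist_le_one_iff hG]
    by_cases hg : g ∈ A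
    · obtain ⟨m, hm, hcm⟩ := h.cops g hg
      rw [hc'A g hg, hcm]
      refine dist_lazy_le (h.route g hg).lazy ?_
      rw [abs_le] at hm ⊢
      omega
    · rw [hc'f g hg]
      exact hf _
  intro r' hr'
  have stay : .inl r' ∈ T → (∀ ψ, K.Lip T ψ → |ψ r' - ψ r| ≤ 1) → Win G G₀ c' r' := by
    intro hT hψ
    refine hnext c' r' hc'f hψ ⟨hT, h.conn, h.bound, h.route, fun g hg => ⟨φ g r, ?_, hc'A g hg⟩⟩
    rw [abs_sub_comm]
    exact hψ _ (h.route g hg).lip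
  have hcatch : ∀ g ∈ A, ∀ j, |j - φ g r| ≤ 3 → G.dist (p g j) r' ≤ 1 → Win G G₀ c' r' := by
    intro g hg j hj hd
    obtain ⟨i, hi⟩ := exists_fin_seven (hc'A g hg) hj
    rw [← hi, dist_le_one_iff hG] at hd
    exact .capture _ _ i (hd.imp Eq.symm id)
  have hlink : K.Link T r r' 1 → Win G G₀ c' r' := by
    intro hl
    by_cases hT : .inl r' ∈ T
    · refine stay hT fun ψ hψ => ?_
      have h1 := hψ r r' 1 h.mem hT hl
      have h2 := hψ r' r 1 hT h.mem hl.symm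
      rw [abs_le]; omega
    · have : ∃ z ∈ T, K.Adj z (.inl r') := by
        rcases hl with ⟨hd, -⟩ | ⟨d, hd, -, hi, -⟩
        · exact ⟨_, h.mem, hd⟩
        · exact ⟨_, hd, hi⟩
      obtain ⟨z, hz, hadj⟩ := this
      obtain ⟨g, hg, σ, hσ, hσh⟩ := h.bound z hz _ hT hadj
      have hgd := (h.route g hg).guard σ hσ r (σ.lo + 1) (σ.lo - 1)
        ⟨h.mem, Or.inl ⟨r', 1, hσh, hl.symm, rfl, rfl⟩⟩
      obtain ⟨-, -, -, e1, -, ⟨x, hx, e2, -⟩ | ⟨d, hd, -⟩⟩ := (h.route g hg).ok σ hσ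
      · rw [hσh] at hx
        cases hx
        refine hcatch g hg σ.lo ?_ ?_
        · rw [abs_le]; omega
        · rw [e1, e2]; simp
      · rw [hσh] at hd; cases hd
  rcases hr' with rfl | hr'
  · exact stay h.mem (fun ψ _ => by simp)
  rcases K.cover r r' hr' with hd | ⟨d, i1, i2, hsum⟩
  · exact hlink (Or.inl ⟨hd, rfl⟩)
  by_cases hdT : .inr d ∈ T
  · refine hlink (Or.inr ⟨d, hdT, i1, i2, ?_⟩)
    have b1 := K.pos_mem _ d i1
    have b2 := K.pos_mem _ d i2
    have hne : K.pos d r ≠ K.pos d r' := by omega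
    have : ¬ (K.pos d r = 0 ∧ K.pos d r' = 5) := by omega
    rw [abs_eq_max_neg]; omega
  · obtain ⟨g, hg, σ, hσ, hσh⟩ := h.bound _ h.mem _ hdT i1
    have hok := (h.route g hg).ok σ hσ
    have hgd := (h.route g hg).guard σ hσ r _ _ ⟨h.mem, Or.inr ⟨d, hσh, i1, rfl, rfl⟩⟩
    obtain ⟨j, v, hjv, hjd⟩ := hok.catches hσh h.mem i1 hgd.1 hgd.2 r' i2 hsum
    have hv : v = p g j := by
      rcases hjv with ⟨rfl, rfl⟩ | ⟨rfl, rfl⟩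
      · exact hok.2.2.2.1.symm
      · exact hok.2.2.2.2.1.symm
    subst hv
    rcases hjd with ⟨hj, hjd⟩ | ⟨hj, hjd⟩
    · exfalso
      obtain ⟨m, hm, hcm⟩ := h.cops g hg
      obtain ⟨i, hi⟩ := exists_fin_seven hcm (j := j) (by rw [abs_le] at *; omega)
      exact hcap ⟨i, hi ▸ hjd⟩
    · exact hcatch g hg j hj hjd

lemma exists_closer (hG : G.Connected) {a b : V} {n : ℕ} (h : G.dist a b ≤ n + 1) :
    ∃ a', G.dist a a' ≤ 1 ∧ G.dist a' b ≤ n := by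
  by_cases hn : G.dist a b ≤ n
  · exact ⟨a, by simp, hn⟩
  obtain ⟨w, hw⟩ := hG.exists_walk_length_eq_dist a b
  cases w with
  | nil => simp at hn
  | cons hadj w' =>
    rename_i a'
    refine ⟨a', (dist_le_one_iff hG).2 (Or.inr hadj), ?_⟩
    have := SimpleGraph.dist_le w'
    rw [SimpleGraph.Walk.length_cons] at hw
    omega

/-- While the robber is confined, a free group of cops can catch up with the robber's shadow `ψ` on
a walk `q`. -/
lemma Plan.Confined.establish [Finite V] (hG : G.Connected) {T : Set (V ⊕ X)}
    {A : Set (Fin 3)} {p : Fin 3 → ℤ → V} {φ : Fin 3 → V → ℤ} {Q : Fin 3 → List (Station V X)}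
    {g : Fin 3} (hg : g ∉ A) {q : ℤ → V} (hq : ∀ m, G.dist (q m) (q (m + 1)) ≤ 1) {ψ : V → ℤ}
    (hψ : K.Lip T ψ)
    (hwin : ∀ c r, K.Confined c r T A p φ Q →
      (∃ m, |m - ψ r| ≤ 1 ∧ ∀ i : Fin 7, c (g, i) = q (m + i - 3)) → Win G G₀ c r)
    {c : Fin 3 × Fin 7 → V} {r : V} (h : K.Confined c r T A p φ Q) : Win G G₀ c r := by
  classical
  obtain ⟨B, hB⟩ := (Set.finite_range ψ).bddAbove
  obtain ⟨b, hb⟩ := (Set.finite_range ψ).bddBelow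
  have hB' : ∀ s, ψ s ≤ B := fun s => hB ⟨s, rfl⟩
  have hb' : ∀ s, b ≤ ψ s := fun s => hb ⟨s, rfl⟩
  have run : ∀ (N : ℕ) (n : ℤ) (c : Fin 3 × Fin 7 → V) (r : V), K.Confined c r T A p φ Q →
      (∀ i : Fin 7, c (g, i) = q (n + i - 3)) → n ≤ ψ r → B - n ≤ N → Win G G₀ c r := by
    intro N
    induction N with
    | zero =>
      intro n c r h hc hn hN
      have := hB' r
      exact hwin c r h ⟨n, by rw [abs_le]; push_cast at hN; omega, hc⟩
    | succ N ih =>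
      intro n c r h hc hn hN
      by_cases hfin : ψ r ≤ n + 1
      · exact hwin c r h ⟨n, by rw [abs_le]; omega, hc⟩
      refine h.step hG (fun x => if x.1 = g then q (n + 1 + x.2 - 3) else c x) ?_ ?_
      · rintro ⟨g', i⟩
        by_cases hg' : g' = g
        · subst hg'
          simp only [if_true]
          rw [hc]
          exact dist_lazy_le hq (by rw [abs_le]; omega)
        · simp [hg']
      · intro c' r' hc' hψ' h'
        refine ih (n + 1) c' r' h' (fun i => by rw [hc' g hg]; simp) ?_ ?_
        · have := abs_le.1 (hψ' ψ hψ); omega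
        · push_cast at hN; omega
  have gather : ∀ (D : ℕ) (c : Fin 3 × Fin 7 → V) (r : V), K.Confined c r T A p φ Q →
      (∀ i : Fin 7, G.dist (c (g, i)) (q (b + i - 3)) ≤ D) → Win G G₀ c r := by
    intro D
    induction D with
    | zero =>
      intro c r h hc
      refine run (B - b).toNat b c r h (fun i => ?_) (hb' r) (by omega)
      exact hG.dist_eq_zero_iff.1 (Nat.le_zero.1 (hc i))
    | succ D ih =>
      intro c r h hc
      choose a ha ha' using fun i => exists_closer hG (hc i)
      refine h.step hG (fun x => if x.1 = g then a x.2 else c x) ?_ ?_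
      · rintro ⟨g', i⟩
        by_cases hg' : g' = g
        · subst hg'
          simpa using ha i
        · simp [hg']
      · intro c' r' hc' _ h'
        refine ih c' r' h' (fun i => ?_)
        rw [hc' g hg]
        simpa using ha' i
  obtain ⟨D, hD⟩ := (Set.finite_range fun i : Fin 7 => G.dist (c (g, i)) (q (b + i - 3))).bddAbove
  exact gather D c r h fun i => hD ⟨i, rfl⟩

/-- A free group of cops takes up a new route through the vertices `N` of the territory `T`; then
the robber is confined to a part of `T` avoiding `N`. -/
lemma Plan.Confined.extend [Finite V] (hG : G.Connected) {T N : Set (V ⊕ X)}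
    {A : Set (Fin 3)} {p : Fin 3 → ℤ → V} {φ : Fin 3 → V → ℤ} {Q : Fin 3 → List (Station V X)}
    {g : Fin 3} (hg : g ∉ A) {q : ℤ → V} (hq : ∀ m, G.dist (q m) (q (m + 1)) ≤ 1) {ψ : V → ℤ}
    (hψ : K.Lip T ψ) {R : List (Station V X)} (hNR : ∀ z ∈ N, ∃ σ ∈ R, σ.h = z)
    (hR : ∀ T' ⊆ T \ N, K.Route T' q ψ R) (hN : ∀ s, .inl s ∈ N → q (ψ s) = s)
    (hwin : ∀ c r, ∀ T' ⊆ T \ N, (∀ z ∈ T', ∀ z' ∉ T', K.Adj z z' →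
        (∃ h ∈ A, ∃ σ ∈ Q h, σ.h = z') ∨ z' ∈ N) →
      K.Confined c r T' (insert g A) (Function.update p g q) (Function.update φ g ψ)
        (Function.update Q g R) → Win G G₀ c r)
    {c : Fin 3 × Fin 7 → V} {r : V} (h : K.Confined c r T A p φ Q) : Win G G₀ c r := by
  classical
  refine h.establish hG hg hq hψ fun c r h ⟨m, hm, hc⟩ => ?_
  by_cases hr : .inl r ∈ N
  · obtain ⟨i, hi⟩ := exists_fin_seven (j := ψ r) hc (by rw [abs_le] at *; omega)
    exact .capture _ _ i (Or.inl (hi.trans (hN r hr)))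
  set T' : Set (V ⊕ X) := {z | LinkedIn K.Adj (T \ N) (.inl r) z} with hT'
  have hT'sub : T' ⊆ T \ N := by
    rintro z ⟨h0, hz⟩
    induction hz with
    | refl => exact h0
    | tail _ hxy _ => exact hxy.2.1
  have hrT' : .inl r ∈ T' := ⟨⟨h.mem, hr⟩, .refl⟩
  have hext : ∀ z ∈ T', ∀ z' ∈ T \ N, K.Adj z z' → z' ∈ T' := fun z hz z' hz' hadj =>
    ⟨hz.1, hz.2.tail ⟨hT'sub hz, hz', hadj⟩⟩
  have hroot : ∀ z ∈ T', Relation.ReflTransGen (fun x y => x ∈ T' ∧ y ∈ T' ∧ K.Adj x y)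
      (.inl r) z := by
    rintro z ⟨h0, hz⟩
    induction hz with
    | refl => exact .refl
    | @tail x y hx hxy ih =>
      have hxT : x ∈ T' := ⟨h0, hx⟩
      exact ih.tail ⟨hxT, hext x hxT y hxy.2.1 hxy.2.2, hxy.2.2⟩
  have hbd : ∀ z ∈ T', ∀ z' ∉ T', K.Adj z z' → (∃ h ∈ A, ∃ σ ∈ Q h, σ.h = z') ∨ z' ∈ N := by
    intro z hz z' hz' hadj
    by_cases hN' : z' ∈ N
    · exact Or.inr hN'
    · refine Or.inl (h.bound z (hT'sub hz).1 z' (fun hzT => hz' (hext z hz z' ⟨hzT, hN'⟩ hadj)) hadj)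
  have hne : ∀ h ∈ A, h ≠ g := fun h hh e => hg (e ▸ hh)
  refine hwin c r T' hT'sub hbd ⟨hrT', ?_, ?_, ?_, ?_⟩
  · intro z hz z' hz'
    refine ⟨hz, Relation.ReflTransGen.trans ?_ (hroot z' hz')⟩
    have : Std.Symm fun x y => x ∈ T' ∧ y ∈ T' ∧ K.Adj x y :=
      ⟨fun x y hxy => ⟨hxy.2.1, hxy.1, Plan.adj_symm hxy.2.2⟩⟩
    exact Relation.ReflTransGen.stdSymm.symm _ _ (hroot z hz)
  · intro z hz z' hz' hadj
    rcases hbd z hz z' hz' hadj with ⟨k, hk, σ, hσ, e⟩ | hz'N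
    · exact ⟨k, Set.mem_insert_of_mem _ hk, σ, by rwa [Function.update_of_ne (hne k hk)], e⟩
    · obtain ⟨σ, hσ, e⟩ := hNR z' hz'N
      exact ⟨g, Set.mem_insert _ _, σ, by rwa [Function.update_self], e⟩
  · rintro k (rfl | hk)
    · simpa using hR T' hT'sub
    · simp only [Function.update_of_ne (hne k hk)]
      exact (h.route k hk).mono (hT'sub.trans Set.sdiff_subset) (List.Sublist.refl _)
  · rintro k (rfl | hk)
    · simpa using ⟨m, hm, hc⟩
    · simp only [Function.update_of_ne (hne k hk)]
      exact h.cops k hk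

/-- Guards which are not needed may be dismissed. -/
lemma Plan.Confined.restrict {c : Fin 3 × Fin 7 → V} {r : V} {T : Set (V ⊕ X)} {A A' : Set (Fin 3)}
    {p : Fin 3 → ℤ → V} {φ : Fin 3 → V → ℤ} {Q Q' : Fin 3 → List (Station V X)}
    (h : K.Confined c r T A p φ Q) (hA : A' ⊆ A) (hQ : ∀ g ∈ A', (Q' g).Sublist (Q g))
    (hb : ∀ z ∈ T, ∀ z' ∉ T, K.Adj z z' → ∃ g ∈ A', ∃ σ ∈ Q' g, σ.h = z') :
    K.Confined c r T A' p φ Q' :=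
  ⟨h.mem, h.conn, hb, fun g hg => (h.route g (hA hg)).mono subset_rfl (hQ g hg),
    fun g hg => h.cops g (hA hg)⟩

end Play

end CopsRobbersOnePlanar

namespace CopsRobbersOnePlanar

section Cutting

lemma cut_key {a b t s r lo hi m : ℤ} (hlt : lo < hi) (ha : 0 ≤ a) (ha' : a ≤ 3) (hb : 0 ≤ b)
    (hb' : b ≤ 3) (ht : 0 ≤ t) (ht' : t ≤ 3) (hs : 0 ≤ s) (hs' : s ≤ 3) (hab : a ≠ b)
    (hat : a ≠ t) (hbt : b ≠ t) (has : a ≠ s) (hbs : b ≠ s) (hts : t ≠ s)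
    (hr : s + r = 1 ∨ s + r = 5) (hr0 : 0 ≤ r) (hr3 : r ≤ 3)
    (h1 : min (hi - |b - s|) (lo + |a - t| - |t - s|) ≤ m) (h2 : m ≤ lo + |a - s|) :
    (|lo - m| ≤ 3 ∧ |a - r| ≤ 1) ∨ (|lo - m| ≤ 2 ∧ |a - s| ≤ 1) ∨
      (|lo + |a - t| - m| ≤ 3 ∧ |t - r| ≤ 1) ∨ (|lo + |a - t| - m| ≤ 2 ∧ |t - s| ≤ 1) := by
  obtain rfl : b = 6 - a - t - s := by omega
  obtain rfl : r = if s ≤ 1 then 1 - s else 5 - s := by grind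
  clear hr hr0 hr3 hb hb' hab hbt hbs
  interval_cases a <;> interval_cases s <;> try exact absurd rfl has
  all_goals
    interval_cases t <;> first | exact absurd rfl hts | exact absurd rfl hat | skip
  all_goals
    norm_num [abs_le] at h1 h2 ⊢
    omega

variable {V X : Type} {G G₀ : SimpleGraph V} {K : Plan G G₀ X}

/-- The station `σ` served `k` time units later. -/
def Station.shift (k : ℤ) (σ : Station V X) : Station V X :=
  ⟨σ.h, σ.lo + k, σ.hi + k, σ.pl, σ.ph, fun s => σ.dn s + k, fun s => σ.up s + k⟩

variable (K) in
/-- The walk serving `σ` is redirected to be at the vertex `t` incident with `d` at time `n`. -/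
def Station.cutHi (d : X) (n : ℤ) (t : V) (σ : Station V X) : Station V X :=
  { σ with hi := n, ph := t, dn := fun s => min (σ.dn s) (n - |K.pos d t - K.pos d s|) }

variable (K) in
/-- The walk serving `σ` is replaced by one which is at the vertex `t` incident with `d`
at time `n`. -/
def Station.cutLo (d : X) (n : ℤ) (t : V) (σ : Station V X) : Station V X :=
  { σ with lo := n, pl := t, up := fun s => max (σ.up s) (n + |K.pos d t - K.pos d s|) }

lemma Plan.StationOK.lo_le_hi {T : Set (V ⊕ X)} {p : ℤ → V} {σ : Station V X}
    (h : K.StationOK T p σ) : σ.lo ≤ σ.hi := by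
  obtain ⟨-, -, -, -, -, ⟨x, -, -, -, h⟩ | ⟨d, -, h, -⟩⟩ := h
  · exact h.le
  · exact h.le

lemma Plan.StationOK.congr {T : Set (V ⊕ X)} {p q : ℤ → V} {σ : Station V X}
    (h : K.StationOK T p σ) (hlo : q σ.lo = p σ.lo) (hhi : q σ.hi = p σ.hi) :
    K.StationOK T q σ := by
  obtain ⟨h1, h2, h3, h4, h5, h6⟩ := h
  exact ⟨h1, h2, h3, hlo.trans h4, hhi.trans h5, h6⟩

lemma Plan.StationOK.sees_bounds {T : Set (V ⊕ X)} {p : ℤ → V} {σ : Station V X}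
    (h : K.StationOK T p σ) {s : V} {u l : ℤ} (hs : K.Sees T σ s u l) : σ.lo ≤ u ∧ l ≤ σ.hi := by
  obtain ⟨hsT, ⟨x, c, -, hl, rfl, rfl⟩ | ⟨d, hd, hi, rfl, rfl⟩⟩ := hs
  · have := h.lo_le_hi
    have := hl.nonneg
    omega
  · obtain ⟨-, -, -, -, -, ⟨x, hx, -⟩ | ⟨d', hd', hlt, i1, i2, hb, -⟩⟩ := h
    · rw [hd] at hx; cases hx
    · rw [hd] at hd'; cases hd'
      obtain ⟨h1, h2⟩ := hb s hsT hi
      have := abs_nonneg (K.pos d σ.pl - K.pos d s)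
      have := abs_nonneg (K.pos d σ.ph - K.pos d s)
      omega

lemma Plan.StationOK.sees_dist {T : Set (V ⊕ X)} {p : ℤ → V} {σ : Station V X}
    (h : K.StationOK T p σ) {s : V} {u l : ℤ} (hs : K.Sees T σ s u l) :
    G.dist σ.pl s ≤ u - σ.lo ∧ G.dist s σ.ph ≤ σ.hi - l := by
  obtain ⟨hsT, ⟨x, c, hx, hl, rfl, rfl⟩ | ⟨d, hd, hi, rfl, rfl⟩⟩ := hs
  · obtain ⟨-, -, -, -, -, ⟨x', hx', rfl, e2, e3⟩ | ⟨d', hd', -⟩⟩ := h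
    · rw [hx] at hx'; cases hx'
      rw [e2]
      have h1 := hl.dist_le
      have h2 := hl.symm.dist_le
      omega
    · rw [hx] at hd'; cases hd'
  · obtain ⟨-, -, -, -, -, ⟨x, hx, -⟩ | ⟨d', hd', hlt, i1, i2, hb, -⟩⟩ := h
    · rw [hd] at hx; cases hx
    · rw [hd] at hd'; cases hd'
      obtain ⟨h1, h2⟩ := hb s hsT hi
      have := K.dist_le _ _ d i1 hi
      have := K.dist_le _ _ d hi i2
      rw [abs_sub_comm (K.pos d s)] at this
      omega

lemma Plan.StationOK.cutHi {T T' : Set (V ⊕ X)} {p q : ℤ → V} {σ : Station V X}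
    (h : K.StationOK T p σ) {d : X} (hd : σ.h = .inr d) {t : V} (ht : .inl t ∈ T)
    (hi : K.inc t d) (hT : T' ⊆ T) (ht' : .inl t ∉ T') (hlo : q σ.lo = σ.pl)
    (hn : q (σ.up t) = t) : K.StationOK T' q (σ.cutHi K d (σ.up t) t) := by
  obtain ⟨h1, h2, h3, h4, h5, ⟨x, hx, -⟩ | ⟨d', hd', hlt, i1, i2, hb, hf⟩⟩ := h
  · rw [hd] at hx; cases hx
  rw [hd] at hd'; cases hd'
  have npt : K.pos d σ.pl ≠ K.pos d t := fun h => h2 (K.pos_inj _ _ d i1 hi h ▸ ht)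
  have hbt := (hb t ht hi).1
  have := abs_pos.2 (sub_ne_zero.2 npt)
  refine ⟨fun h => h1 (hT h), fun h => h2 (hT h), ht', hlo, hn,
    Or.inr ⟨d, hd, ?_, i1, hi, fun s hs hs' => ⟨(hb s (hT hs) hs').1, min_le_right _ _⟩,
      Or.inr fun s hs hsd => ?_⟩⟩
  · simp only [Station.cutHi]; omega
  rcases hf with ⟨hne, hf⟩ | hf
  · have n3 : K.pos d σ.pl ≠ K.pos d σ.ph := fun h => hne (K.pos_inj _ _ d i1 i2 h)
    have pht : K.pos d σ.ph ≠ K.pos d t := fun h => h3 (K.pos_inj _ _ d i2 hi h ▸ ht)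
    have b1 := K.pos_mem _ d i1
    have b2 := K.pos_mem _ d i2
    have b3 := K.pos_mem _ d hi
    have key : ∀ s, .inl s ∈ T' → K.inc s d → K.pos d σ.pl ≠ K.pos d s ∧
        K.pos d σ.ph ≠ K.pos d s ∧ K.pos d t ≠ K.pos d s ∧ 0 ≤ K.pos d s ∧ K.pos d s ≤ 3 :=
      fun s hs hsd => ⟨fun h => h2 (K.pos_inj _ _ d i1 hsd h ▸ hT hs),
        fun h => h3 (K.pos_inj _ _ d i2 hsd h ▸ hT hs),
        fun h => ht' (K.pos_inj _ _ d hi hsd h ▸ hs), K.pos_mem _ d hsd⟩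
    refine ⟨fun s' hs' hsd' => K.pos_inj _ _ d hsd' hsd ?_, fun m hm1 hm2 => ?_⟩
    · have := key s hs hsd
      have := key s' hs' hsd'
      omega
    · refine catches_of_pos i1 hi hsd fun r hr0 hr3 hsum => ?_
      have k1 := key s hs hsd
      obtain ⟨f1, f2⟩ := hf s (hT hs) hsd
      obtain ⟨g1, g2⟩ := hf t ht hi
      simp only [Station.cutHi, f1, f2, g1] at hm1 hm2 ⊢
      exact cut_key hlt b1.1 b1.2 b2.1 b2.2 b3.1 b3.2 k1.2.2.2.1 k1.2.2.2.2 n3 npt pht k1.1 k1.2.1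
        k1.2.2.1 hsum hr0 hr3 hm1 hm2
  · exact absurd ((hf s (hT hs) hsd).1 t ht hi ▸ hs) ht'

lemma Plan.StationOK.cutLo {T T' : Set (V ⊕ X)} {p q : ℤ → V} {σ : Station V X}
    (h : K.StationOK T p σ) {d : X} (hd : σ.h = .inr d) {t : V} (ht : .inl t ∈ T)
    (hi : K.inc t d) (hT : T' ⊆ T) (ht' : .inl t ∉ T') (hhi : q σ.hi = σ.ph)
    (hn : q (σ.dn t) = t) : K.StationOK T' q (σ.cutLo K d (σ.dn t) t) := by
  obtain ⟨h1, h2, h3, h4, h5, ⟨x, hx, -⟩ | ⟨d', hd', hlt, i1, i2, hb, hf⟩⟩ := h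
  · rw [hd] at hx; cases hx
  rw [hd] at hd'; cases hd'
  have npt : K.pos d σ.ph ≠ K.pos d t := fun h => h3 (K.pos_inj _ _ d i2 hi h ▸ ht)
  have hbt := (hb t ht hi).2
  have := abs_pos.2 (sub_ne_zero.2 npt)
  refine ⟨fun h => h1 (hT h), ht', fun h => h3 (hT h), hn, hhi,
    Or.inr ⟨d, hd, ?_, hi, i2, fun s hs hs' => ⟨le_max_right _ _, (hb s (hT hs) hs').2⟩,
      Or.inr fun s hs hsd => ?_⟩⟩
  · simp only [Station.cutLo]; omega
  rcases hf with ⟨hne, hf⟩ | hf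
  · have n3 : K.pos d σ.pl ≠ K.pos d σ.ph := fun h => hne (K.pos_inj _ _ d i1 i2 h)
    have pht : K.pos d σ.pl ≠ K.pos d t := fun h => h2 (K.pos_inj _ _ d i1 hi h ▸ ht)
    have b1 := K.pos_mem _ d i1
    have b2 := K.pos_mem _ d i2
    have b3 := K.pos_mem _ d hi
    have key : ∀ s, .inl s ∈ T' → K.inc s d → K.pos d σ.pl ≠ K.pos d s ∧
        K.pos d σ.ph ≠ K.pos d s ∧ K.pos d t ≠ K.pos d s ∧ 0 ≤ K.pos d s ∧ K.pos d s ≤ 3 :=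
      fun s hs hsd => ⟨fun h => h2 (K.pos_inj _ _ d i1 hsd h ▸ hT hs),
        fun h => h3 (K.pos_inj _ _ d i2 hsd h ▸ hT hs),
        fun h => ht' (K.pos_inj _ _ d hi hsd h ▸ hs), K.pos_mem _ d hsd⟩
    refine ⟨fun s' hs' hsd' => K.pos_inj _ _ d hsd' hsd ?_, fun m hm1 hm2 => ?_⟩
    · have := key s hs hsd
      have := key s' hs' hsd'
      omega
    · refine catches_of_pos hi i2 hsd fun r hr0 hr3 hsum => ?_
      have k1 := key s hs hsd
      obtain ⟨f1, f2⟩ := hf s (hT hs) hsd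
      obtain ⟨g1, g2⟩ := hf t ht hi
      simp only [Station.cutLo, f1, f2, g2] at hm1 hm2 ⊢
      have := cut_key (m := -m) (neg_lt_neg hlt) b2.1 b2.2 b1.1 b1.2 b3.1 b3.2 k1.2.2.2.1 k1.2.2.2.2
        n3.symm npt pht k1.2.1 k1.1 k1.2.2.1 hsum hr0 hr3 (by omega) (by omega)
      rw [abs_sub_comm, abs_sub_comm _ (-m)] at this
      rw [show -m - -σ.hi = σ.hi - m by ring, show -m - (-σ.hi + |K.pos d σ.ph - K.pos d t|) =
        σ.hi - |K.pos d σ.ph - K.pos d t| - m by ring] at this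
      tauto
  · exact absurd ((hf s (hT hs) hsd).1 t ht hi ▸ hs) ht'

lemma Plan.Sees.shift {T : Set (V ⊕ X)} {σ : Station V X} {s : V} {u l k : ℤ}
    (h : K.Sees T σ s u l) : K.Sees T (σ.shift k) s (u + k) (l + k) := by
  obtain ⟨hsT, ⟨x, c, hx, hl, rfl, rfl⟩ | ⟨d, hd, hi, rfl, rfl⟩⟩ := h
  · exact ⟨hsT, Or.inl ⟨x, c, hx, hl, by simp only [Station.shift]; omega,
      by simp only [Station.shift]; omega⟩⟩
  · exact ⟨hsT, Or.inr ⟨d, hd, hi, rfl, rfl⟩⟩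

lemma Plan.Sees.unshift {T : Set (V ⊕ X)} {σ : Station V X} {s : V} {u l k : ℤ}
    (h : K.Sees T (σ.shift k) s u l) : K.Sees T σ s (u - k) (l - k) := by
  have := h.shift (k := -k)
  simpa [Station.shift, sub_eq_add_neg] using this

lemma Plan.Route.shift {T : Set (V ⊕ X)} {p : ℤ → V} {φ : V → ℤ} {Q : List (Station V X)}
    (h : K.Route T p φ Q) (k : ℤ) :
    K.Route T (fun m => p (m - k)) (fun s => φ s + k) (Q.map (Station.shift k)) := by
  refine ⟨fun m => ?_, fun a b c ha hb hl => ?_, fun σ hσ => ?_, fun σ hσ s u l hs => ?_, ?_⟩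
  · have := h.lazy (m - k)
    rwa [sub_add_eq_add_sub] at this
  · have := h.lip a b c ha hb hl
    omega
  · obtain ⟨σ', hσ', rfl⟩ := List.mem_map.1 hσ
    obtain ⟨h1, h2, h3, h4, h5, h6⟩ := h.ok σ' hσ'
    refine ⟨h1, h2, h3, by simpa [Station.shift] using h4, by simpa [Station.shift] using h5, ?_⟩
    refine h6.imp ?_ ?_
    · exact fun ⟨x, hx, e1, e2, e3⟩ => ⟨x, hx, e1, e2, by simp only [Station.shift]; omega⟩
    · rintro ⟨d, hd, hlt, i1, i2, hb, hf⟩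
      refine ⟨d, hd, by simp only [Station.shift]; omega, i1, i2, fun s hs hsd => ?_, hf.imp ?_ ?_⟩
      · have := hb s hs hsd
        simp only [Station.shift]
        omega
      · refine fun ⟨hne, hf⟩ => ⟨hne, fun s hs hsd => ?_⟩
        have := hf s hs hsd
        simp only [Station.shift]
        omega
      · refine fun hf s hs hsd => ⟨(hf s hs hsd).1, fun m hm1 hm2 r hr hsum => ?_⟩
        simp only [Station.shift] at hm1 hm2 ⊢
        obtain ⟨j, v, hjv, hj⟩ := (hf s hs hsd).2 (m - k) (by omega) (by omega) r hr hsum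
        refine ⟨j + k, v, hjv.imp (And.imp_left fun h => by omega) (And.imp_left fun h => by omega), ?_⟩
        rwa [show j + k - m = j - (m - k) by ring]
  · obtain ⟨σ', hσ', rfl⟩ := List.mem_map.1 hσ
    have := h.guard σ' hσ' s _ _ hs.unshift
    omega
  · rw [List.pairwise_map]
    exact h.ordered.imp fun h => by simp only [Station.shift]; omega

end Cutting

end CopsRobbersOnePlanar

namespace CopsRobbersOnePlanar

section Trails

variable {V X : Type} {G G₀ : SimpleGraph V} {K : Plan G G₀ X}

variable (K) in
/-- The lengths of paths in `T` from stations in `Q` to a vertex, offset by the times at which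
the stations are served. -/
inductive Plan.Cost (T : Set (V ⊕ X)) (Q : List (Station V X)) : V → ℤ → Prop
  | base (σ : Station V X) (s : V) (u l : ℤ) : σ ∈ Q → K.Sees T σ s u l → Plan.Cost T Q s u
  | step (t t' : V) (n c : ℤ) : Plan.Cost T Q t n → .inl t' ∈ T → K.Link T t t' c →
      Plan.Cost T Q t' (n + c)

variable (K) in
/-- The least costs of vertices in `T`. -/
def Plan.IsLeastCost (T : Set (V ⊕ X)) (Q : List (Station V X)) (F : V → ℤ) : Prop :=
  ∀ t, .inl t ∈ T → K.Cost T Q t (F t) ∧ ∀ n, K.Cost T Q t n → F t ≤ n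

lemma Plan.Cost.mem {T : Set (V ⊕ X)} {Q : List (Station V X)} {t : V} {n : ℤ}
    (h : K.Cost T Q t n) : .inl t ∈ T := by
  cases h with
  | base σ s u l _ h => exact h.1
  | step t t' n c _ h _ => exact h

lemma Plan.Cost.le {T : Set (V ⊕ X)} {Q : List (Station V X)} {p : ℤ → V} {φ : V → ℤ}
    (hr : K.Route T p φ Q) {t : V} {n : ℤ} (h : K.Cost T Q t n) : φ t ≤ n := by
  induction h with
  | base σ s u l hσ h => exact (hr.guard σ hσ s u l h).2
  | step t t' n c ht ht' hl ih =>
    have := hr.lip t t' c ht.mem ht' hl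
    omega

lemma Plan.exists_cost {T : Set (V ⊕ X)} {Q : List (Station V X)}
    (hconn : ∀ z ∈ T, ∀ z' ∈ T, LinkedIn K.Adj T z z')
    (hsee : ∃ σ ∈ Q, ∃ s u l, K.Sees T σ s u l) {t : V} (ht : .inl t ∈ T) :
    ∃ n, K.Cost T Q t n := by
  obtain ⟨σ, hσ, s, u, l, hs⟩ := hsee
  let Pr : V ⊕ X → Prop := Sum.elim (fun t => ∃ n, K.Cost T Q t n)
    fun d => ∃ t n, K.Cost T Q t n ∧ K.inc t d
  have key : ∀ z, Relation.ReflTransGen (fun x y => x ∈ T ∧ y ∈ T ∧ K.Adj x y) (.inl s) z →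
      Pr z := by
    intro z hz
    induction hz with
    | refl => exact ⟨u, .base σ s u l hσ hs⟩
    | @tail x y _ hxy ih =>
      obtain ⟨hx, hy, hadj⟩ := hxy
      rcases x with a | d <;> rcases y with b | e
      · obtain ⟨n, hn⟩ := ih
        exact ⟨_, hn.step a b n 1 hy (Or.inl ⟨hadj, rfl⟩)⟩
      · obtain ⟨n, hn⟩ := ih
        exact ⟨a, n, hn, hadj⟩
      · obtain ⟨t, n, hn, hi⟩ := ih
        exact ⟨_, hn.step t b n _ hy (Or.inr ⟨d, hx, hi, hadj, rfl⟩)⟩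
      · exact hadj.elim
  exact key _ (hconn _ hs.1 _ ht).2

lemma Plan.exists_isLeastCost {T : Set (V ⊕ X)} {Q : List (Station V X)} {p : ℤ → V} {φ : V → ℤ}
    (hr : K.Route T p φ Q) (hconn : ∀ z ∈ T, ∀ z' ∈ T, LinkedIn K.Adj T z z')
    (hsee : ∃ σ ∈ Q, ∃ s u l, K.Sees T σ s u l) : ∃ F, K.IsLeastCost T Q F := by
  have : ∀ t, ∃ n, .inl t ∈ T → K.Cost T Q t n ∧ ∀ m, K.Cost T Q t m → n ≤ m := by
    intro t
    by_cases ht : .inl t ∈ T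
    · obtain ⟨n, hn⟩ := Int.exists_least_of_bdd (P := K.Cost T Q t) ⟨φ t, fun z hz => hz.le hr⟩
        (exists_cost hconn hsee ht)
      exact ⟨n, fun _ => hn⟩
    · exact ⟨0, fun h => absurd h ht⟩
  choose F hF using this
  exact ⟨F, hF⟩

lemma Plan.IsLeastCost.lip {T : Set (V ⊕ X)} {Q : List (Station V X)} {F : V → ℤ}
    (h : K.IsLeastCost T Q F) : K.Lip T F :=
  fun a b c ha hb hl => (h b hb).2 _ ((h a ha).1.step a b _ c hb hl)

/-- Walks may be joined when there is enough time to get from the first to the second. -/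
lemma exists_splice (hG : G.Connected) {p q : ℤ → V} (hp : ∀ m, G.dist (p m) (p (m + 1)) ≤ 1)
    (hq : ∀ m, G.dist (q m) (q (m + 1)) ≤ 1) {n n' : ℤ} (h : (G.dist (p n) (q n') : ℤ) ≤ n' - n) :
    ∃ w : ℤ → V, (∀ m, G.dist (w m) (w (m + 1)) ≤ 1) ∧ (∀ m ≤ n, w m = p m) ∧
      ∀ m, n' ≤ m → w m = q m := by
  obtain ⟨f, hf, h0, hn⟩ : ∃ f : ℕ → V, (∀ i, G.dist (f i) (f (i + 1)) ≤ 1) ∧ f 0 = p n ∧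
      f (n' - n).toNat = q n' := by
    obtain ⟨w, hw⟩ := hG.exists_walk_length_eq_dist (p n) (q n')
    refine ⟨w.getVert, fun i => ?_, w.getVert_zero, w.getVert_of_length_le (by omega)⟩
    by_cases hi : i < w.length
    · exact (dist_le_one_iff hG).2 (Or.inr (w.adj_getVert_succ hi))
    · rw [w.getVert_of_length_le (by omega), w.getVert_of_length_le (by omega)]
      simp
  have hnn : n ≤ n' := by omega
  refine ⟨fun m => if m ≤ n then p m else if m < n' then f (m - n).toNat else q m,
    fun m => ?_, fun m hm => if_pos hm, fun m hm => ?_⟩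
  · have hmid : ¬ m + 1 ≤ n → m + 1 ≤ n' → G.dist (if m ≤ n then p m else
        if m < n' then f (m - n).toNat else q m) (f (m + 1 - n).toNat) ≤ 1 := by
      intro h1 h2
      rw [show (m + 1 - n).toNat = (m - n).toNat + 1 by omega]
      by_cases h3 : m ≤ n
      · obtain rfl : m = n := by omega
        simpa [h0] using hf 0
      · rw [if_neg h3, if_pos (by omega)]
        exact hf _
    by_cases h1 : m + 1 ≤ n
    · simp only [if_pos h1, if_pos (by omega : m ≤ n)]
      exact hp m
    by_cases h2 : m + 1 < n'
    · simp only [if_neg h1, if_pos h2]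
      exact hmid h1 h2.le
    · simp only [if_neg h1, if_neg h2]
      by_cases h4 : m + 1 = n'
      · subst h4
        have := hmid h1 le_rfl
        rwa [hn] at this
      · rw [if_neg (by omega : ¬ m < n')]
        by_cases h3 : m ≤ n
        · obtain rfl : m = n := by omega
          obtain rfl : n' = m := by omega
          have : p n' = q n' := by simpa [h0] using hn
          simpa [this] using hq n'
        · rw [if_neg h3]
          exact hq m
  · by_cases h1 : m ≤ n
    · obtain rfl : m = n := by omega
      obtain rfl : n' = m := by omega
      simpa [h0] using hn
    · simp only [if_neg h1, if_neg (by omega : ¬ m < n')]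

/-- The station at the vertex `s` served at time `n`. -/
def visit (s : V) (n : ℤ) : Station V X :=
  ⟨.inl s, n, n, s, s, fun _ => 0, fun _ => 0⟩

variable (K) in
/-- The station at the crossing point `d` served by being at `a` at time `m` and at `b` at
time `n`. -/
def Plan.transit (d : X) (a b : V) (m n : ℤ) : Station V X :=
  ⟨.inr d, m, n, a, b, fun s => n - |K.pos d b - K.pos d s|,
    fun s => m + |K.pos d a - K.pos d s|⟩

variable (K) in
/-- Stations which can be served consecutively by a walk along a path in the planarization. -/
def Plan.Succ (σ τ : Station V X) : Prop :=
  K.Adj σ.h τ.h ∧ (∀ d, σ.h = .inr d → τ.h = .inl σ.ph) ∧ (∀ d, τ.h = .inr d → σ.h = .inl τ.pl) ∧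
    σ.hi ≤ τ.lo ∧ τ.lo ≤ τ.hi

lemma Plan.exists_chain_link {T : Set (V ⊕ X)} {L : List (Station V X)} {α β : Station V X}
    (hch : (L ++ [α]).IsChain K.Succ) {a b : V} (hα : α.h = .inl a) (hβ : β.h = .inl b)
    {m n c : ℤ} (hαm : α.hi ≤ m) (hnβ : n ≤ β.lo) (hβ' : β.lo ≤ β.hi) (hmn : m < n)
    (hl : K.Link T a b c) :
    ∃ M : List (Station V X), (L ++ [α] ++ M ++ [β]).IsChain K.Succ ∧
      ∀ σ ∈ M, ∃ d, .inr d ∈ T ∧ K.inc a d ∧ K.inc b d ∧ σ = K.transit d a b m n := by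
  rcases hl with ⟨hd, -⟩ | ⟨d, hd, ia, ib, -⟩
  · refine ⟨[], ?_, by simp⟩
    rw [List.append_nil, List.isChain_append]
    refine ⟨hch, by simp, ?_⟩
    simp only [List.getLast?_concat, Option.mem_def, Option.some.injEq, List.head?_cons]
    rintro _ rfl _ rfl
    refine ⟨by rw [hα, hβ]; exact hd, ?_, ?_, by omega, hβ'⟩
    · rw [hα]; simp
    · rw [hβ]; simp
  · refine ⟨[K.transit d a b m n], ?_, ?_⟩
    · rw [List.append_assoc, List.isChain_append]
      refine ⟨hch, ?_, ?_⟩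
      · simp only [List.cons_append, List.nil_append, List.isChain_cons_cons,
          List.isChain_singleton, and_true]
        refine ⟨?_, ?_, ?_, hnβ, hβ'⟩
        · rw [hβ]; exact ib
        · intro _ _; exact hβ
        · rw [hβ]; simp
      · simp only [List.getLast?_concat, Option.mem_def, Option.some.injEq, List.cons_append,
          List.head?_cons]
        rintro _ rfl _ rfl
        refine ⟨?_, ?_, fun _ _ => hα, hαm, hmn.le⟩
        · rw [hα]; exact ia
        · rw [hα]; simp
    · simp only [List.mem_singleton]
      rintro _ rfl
      exact ⟨d, hd, ia, ib, rfl⟩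

end Trails

end CopsRobbersOnePlanar

namespace CopsRobbersOnePlanar

section Reaching

variable {V X : Type} {G G₀ : SimpleGraph V} {K : Plan G G₀ X}

/-- The vertex `v` is visited at time `n`, either as a vertex of `T` at its cost, or as
the station `x`. -/
def Anchor (T : Set (V ⊕ X)) (F : V → ℤ) (B : ℤ) (x : Station V X) (v : V) (n : ℤ) : Prop :=
  (.inl v ∈ T ∧ n = F v ∧ F v ≤ B) ∨ (x.h = .inl v ∧ n = x.lo)

variable (K) in
/-- A station in `T` which is served by the walk `p` on the way from `x` to `y`. -/
def Plan.Served (T : Set (V ⊕ X)) (F : V → ℤ) (B : ℤ) (x y : Station V X) (p : ℤ → V)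
    (σ : Station V X) : Prop :=
  (∃ s, .inl s ∈ T ∧ F s ≤ B ∧ p (F s) = s ∧ σ = visit s (F s)) ∨
    ∃ d a b m n, .inr d ∈ T ∧ K.inc a d ∧ K.inc b d ∧ m < n ∧ p m = a ∧ p n = b ∧
      Anchor T F B x a m ∧ Anchor T F B y b n ∧ σ = K.transit d a b m n

variable (K) in
/-- The station `x'` is what remains of `x` when the walk `p` enters `T` from `x`. -/
def Plan.Leaving (T : Set (V ⊕ X)) (p : ℤ → V) (x x' : Station V X) : Prop :=
  (x' = x ∧ ∃ a, x.h = .inl a) ∨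
    ∃ d s, x.h = .inr d ∧ .inl s ∈ T ∧ K.inc s d ∧ p (x.up s) = s ∧ x' = x.cutHi K d (x.up s) s

lemma Plan.Served.congr {T : Set (V ⊕ X)} {F : V → ℤ} {B : ℤ} {x y : Station V X} {p p' : ℤ → V}
    {σ : Station V X} (h : K.Served T F B x y p σ) (hp : ∀ m ≤ σ.hi, p' m = p m) :
    K.Served T F B x y p' σ := by
  rcases h with ⟨s, hs, hB, hps, rfl⟩ | ⟨d, a, b, m, n, hd, ia, ib, hmn, hm, hn, ha, hb, rfl⟩
  · exact Or.inl ⟨s, hs, hB, by rwa [hp (F s) le_rfl], rfl⟩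
  · exact Or.inr ⟨d, a, b, m, n, hd, ia, ib, hmn, by rwa [hp m hmn.le], by rwa [hp n le_rfl],
      ha, hb, rfl⟩

lemma Plan.Leaving.congr {T : Set (V ⊕ X)} {x x' : Station V X} {p p' : ℤ → V}
    (h : K.Leaving T p x x') (hp : ∀ m ≤ x'.hi, p' m = p m) : K.Leaving T p' x x' := by
  rcases h with h | ⟨d, s, h1, h2, h3, h4, rfl⟩
  · exact Or.inl h
  · exact Or.inr ⟨d, s, h1, h2, h3, by rwa [hp (x.up s) le_rfl], rfl⟩

/-- From a list of stations one can reach each vertex in `T` along a walk which follows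
a least cost path. -/
lemma Plan.exists_trail (hG : G.Connected) {T : Set (V ⊕ X)} {p₁ : ℤ → V} {φ₁ : V → ℤ}
    {Q₁ : List (Station V X)} (hr : K.Route T p₁ φ₁ Q₁) {F : V → ℤ} (hF : K.IsLeastCost T Q₁ F)
    (B : ℤ) (y : Station V X) {t : V} {n : ℤ} (h : K.Cost T Q₁ t n) (hn : n = F t)
    (hB : F t ≤ B) : ∃ L₁ x M₁, Q₁ = L₁ ++ x :: M₁ ∧ ∃ (x' : Station V X)
      (P : List (Station V X)) (p : ℤ → V), (∀ m, G.dist (p m) (p (m + 1)) ≤ 1) ∧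
      (∀ m ≤ x.lo, p m = p₁ m) ∧ (∀ m, F t ≤ m → p m = t) ∧ K.Leaving T p x x' ∧ x'.hi ≤ F t ∧
      ((x' :: P) ++ [visit t (F t)]).IsChain K.Succ ∧
      ∀ σ ∈ P ++ [visit t (F t)], K.Served T F B x y p σ ∧ σ.hi ≤ F t := by
  have hconst : ∀ t : V, ∀ m : ℤ, G.dist ((fun _ => t) m) ((fun _ => t) (m + 1)) ≤ 1 := by simp
  induction h with
  | base x s u l hx hs =>
    subst hn
    obtain ⟨L₁, M₁, hQ⟩ := List.append_of_mem hx
    refine ⟨L₁, x, M₁, hQ, ?_⟩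
    have hok := hr.ok x hx
    have hlo : p₁ x.lo = x.pl := hok.2.2.2.1
    obtain ⟨p, hp, hp1, hp2⟩ := exists_splice hG hr.lazy (hconst s) (n := x.lo) (n' := F s)
      (by simpa [hlo] using (hok.sees_dist hs).1)
    have hpF : p (F s) = s := hp2 _ le_rfl
    have hvis : K.Served T F B x y p (visit s (F s)) := Or.inl ⟨s, hs.1, hB, hpF, rfl⟩
    obtain ⟨hsT, ⟨a, c, ha, hl, hu, hl'⟩ | ⟨d, hd, hi, hu, hl'⟩⟩ := hs
    · obtain ⟨h1, -, -, -, -, ⟨a', ha', e1, e2, e3⟩ | ⟨d, hd, -⟩⟩ := hok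
      swap
      · rw [ha] at hd; cases hd
      rw [ha] at ha'; cases ha'
      have hc : 0 < c := hl.pos_of_ne fun h => h1 (by rw [ha, h]; exact hsT)
      obtain ⟨M, hM, hM'⟩ := exists_chain_link (L := []) (α := x) (β := visit s (F s))
        (m := x.lo) (n := F s) (by simp) ha rfl e3.ge le_rfl le_rfl (by omega) hl
      refine ⟨x, M, p, hp, hp1, hp2, Or.inl ⟨rfl, a, ha⟩, by omega, by simpa using hM, ?_⟩
      intro σ hσ
      rcases List.mem_append.1 hσ with hσ | hσ
      · obtain ⟨d, hd, ia, ib, rfl⟩ := hM' σ hσ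
        exact ⟨Or.inr ⟨d, a, s, _, _, hd, ia, ib, by omega, by rw [hp1 _ le_rfl, hlo, e1], hpF,
          Or.inr ⟨ha, rfl⟩, Or.inl ⟨hsT, rfl, hB⟩, rfl⟩, le_rfl⟩
      · rw [List.mem_singleton] at hσ
        subst hσ
        exact ⟨hvis, le_rfl⟩
    · refine ⟨x.cutHi K d (x.up s) s, [], p, hp, hp1, hp2,
        Or.inr ⟨d, s, hd, hsT, hi, hu ▸ hpF, rfl⟩, hu.ge, ?_, ?_⟩
      · simp only [List.cons_append, List.nil_append, List.isChain_cons_cons,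
          List.isChain_singleton, and_true]
        refine ⟨?_, fun _ _ => rfl, ?_, hu.ge, le_rfl⟩
        · change K.Adj x.h _
          rw [hd]; exact hi
        · simp [visit]
      · intro σ hσ
        simp only [List.nil_append, List.mem_singleton] at hσ
        subst hσ
        exact ⟨hvis, le_rfl⟩
  | step t t' n c ht ht' hl ih =>
    have h1 := (hF t ht.mem).2 n ht
    have h2 := hF.lip t t' c ht.mem ht' hl
    by_cases htt : t = t'
    · subst htt
      exact ih (by have := hl.nonneg; omega) hB
    have hc := hl.pos_of_ne htt
    obtain ⟨L₁, x, M₁, hQ, x', P, p, hp, hp1, hp2, hlv, hhi, hch, hsv⟩ := ih (by omega) (by omega)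
    have hlo : x.lo ≤ F t := by
      have hle := (hr.ok x (by simp [hQ])).lo_le_hi
      rcases hlv with ⟨rfl, -⟩ | ⟨d, s, hd, hsT, hsd, -, rfl⟩
      · exact hle.trans hhi
      · exact ((hr.ok x (by simp [hQ])).sees_bounds ⟨hsT, Or.inr ⟨d, hd, hsd, rfl, rfl⟩⟩).1.trans hhi
    obtain ⟨M, hM, hM'⟩ := exists_chain_link (α := visit t (F t)) (β := visit t' (F t'))
        (m := F t) (n := F t') hch rfl rfl le_rfl le_rfl le_rfl (by omega) hl
    obtain ⟨p', hp', hp1', hp2'⟩ := exists_splice hG hp (hconst t') (n := F t) (n' := F t')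
      (by rw [hp2 _ le_rfl]; have := hl.dist_le; omega)
    refine ⟨L₁, x, M₁, hQ, x', P ++ [visit t (F t)] ++ M, p', hp',
      fun m hm => by rw [hp1' m (by omega), hp1 m hm], hp2', ?_, by omega, by simpa using hM, ?_⟩
    · exact hlv.congr fun m hm => hp1' m (by omega)
    · intro σ hσ
      rcases List.mem_append.1 hσ with hσ | hσ
      · rcases List.mem_append.1 hσ with hσ | hσ
        · obtain ⟨hσ1, hσ2⟩ := hsv σ hσ
          exact ⟨hσ1.congr fun m hm => hp1' m (by omega), by omega⟩
        · obtain ⟨d, hd, ia, ib, rfl⟩ := hM' σ hσ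
          exact ⟨Or.inr ⟨d, t, t', _, _, hd, ia, ib, by omega, by rw [hp1' _ le_rfl, hp2 _ le_rfl],
            hp2' _ le_rfl, Or.inl ⟨ht.mem, rfl, by omega⟩, Or.inl ⟨ht', rfl, hB⟩, rfl⟩, le_rfl⟩
      · rw [List.mem_singleton] at hσ
        subst hσ
        exact ⟨Or.inl ⟨t', ht', hB, hp2' _ le_rfl, rfl⟩, le_rfl⟩

end Reaching

end CopsRobbersOnePlanar

namespace CopsRobbersOnePlanar

section Connecting

variable {V X : Type} {G G₀ : SimpleGraph V} {K : Plan G G₀ X}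

lemma exists_isChain_pred {α : Type*} {R : α → α → Prop} {l₁ l₂ : List α} {a : α}
    (h : (l₁ ++ a :: l₂).IsChain R) (hl : l₁ ≠ []) : ∃ b ∈ l₁, R b a := by
  rw [List.isChain_append] at h
  exact ⟨l₁.getLast hl, List.getLast_mem hl, h.2.2 _ (List.getLast?_eq_some_getLast hl) a (by simp)⟩

lemma exists_isChain_succ {α : Type*} {R : α → α → Prop} {l₁ l₂ : List α} {a : α}
    (h : (l₁ ++ a :: l₂).IsChain R) (hl : l₂ ≠ []) : ∃ b ∈ l₂, R a b := by
  obtain ⟨b, l, rfl⟩ := List.exists_cons_of_ne_nil hl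
  exact ⟨b, by simp, (List.isChain_cons_cons.1 (List.isChain_append.1 h).2.1).1⟩

lemma exists_of_not_pairwise {α : Type*} {R : α → α → Prop} {l : List α} (h : ¬ l.Pairwise R) :
    ∃ A a B b C, l = A ++ a :: B ++ b :: C ∧ ¬ R a b := by
  induction l with
  | nil => simp at h
  | cons a l ih =>
    rw [List.pairwise_cons, not_and_or] at h
    rcases h with h | h
    · push Not at h
      obtain ⟨b, hb, hab⟩ := h
      obtain ⟨B, C, rfl⟩ := List.append_of_mem hb
      exact ⟨[], a, B, b, C, by simp, hab⟩
    · obtain ⟨A, a', B, b, C, rfl, hab⟩ := ih h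
      exact ⟨a :: A, a', B, b, C, by simp, hab⟩

lemma Plan.Succ.pairwise {l : List (Station V X)} (h : l.IsChain K.Succ) :
    l.Pairwise fun σ τ => σ.hi ≤ τ.lo ∧ τ.lo ≤ τ.hi := by
  have : IsTrans (Station V X) fun σ τ => σ.hi ≤ τ.lo ∧ τ.lo ≤ τ.hi :=
    ⟨fun a b c h1 h2 => ⟨h1.1.trans (h1.2.trans h2.1), h2.2⟩⟩
  exact (h.imp fun _ _ h => h.2.2.2).pairwise

variable (K) in
/-- The station `y'` is what remains of `y` when the walk `p` enters `y` from the vertex `t`. -/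
def Plan.Arriving (T : Set (V ⊕ X)) (p : ℤ → V) (t : V) (y y' : Station V X) : Prop :=
  (y' = y ∧ ∃ b, y.h = .inl b) ∨
    ∃ d, y.h = .inr d ∧ .inl t ∈ T ∧ K.inc t d ∧ p (y.dn t) = t ∧ y' = y.cutLo K d (y.dn t) t

/-- From a list of stations one can reach a station `y` through `T` along a least cost path. -/
lemma Plan.exists_path (hG : G.Connected) {T : Set (V ⊕ X)} {p₁ p₂ : ℤ → V} {φ₁ φ₂ : V → ℤ}
    {Q₁ Q₂ : List (Station V X)} (h₁ : K.Route T p₁ φ₁ Q₁) (h₂ : K.Route T p₂ φ₂ Q₂) {F : V → ℤ}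
    (hF : K.IsLeastCost T Q₁ F) {y : Station V X} (hy : y ∈ Q₂) {t : V} {u : ℤ}
    (hs : K.Sees T y t u (F t)) : ∃ L₁ x M₁, Q₁ = L₁ ++ x :: M₁ ∧ ∃ (x' y' : Station V X)
      (P : List (Station V X)) (q : ℤ → V), (∀ m, G.dist (q m) (q (m + 1)) ≤ 1) ∧
      (∀ m ≤ x.lo, q m = p₁ m) ∧ (∀ m, y.hi ≤ m → q m = p₂ m) ∧ K.Leaving T q x x' ∧
      K.Arriving T q t y y' ∧ x'.hi ≤ F t ∧ F t ≤ y'.lo ∧ P ≠ [] ∧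
      ((x' :: P) ++ [y']).IsChain K.Succ ∧ ∀ σ ∈ P, K.Served T F (F t) x y q σ := by
  obtain ⟨L₁, x, M₁, hQ, x', P, p, hp, hp1, hp2, hlv, hhi, hch, hsv⟩ :=
    K.exists_trail hG h₁ hF (F t) y (hF t hs.1).1 rfl le_rfl
  refine ⟨L₁, x, M₁, hQ, x', ?_⟩
  have hok := h₂.ok y hy
  have hxlo : x.lo ≤ F t := by
    have hle := (h₁.ok x (by simp [hQ])).lo_le_hi
    rcases hlv with ⟨rfl, -⟩ | ⟨d, s, hd, hsT, hsd, -, rfl⟩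
    · exact hle.trans hhi
    · exact ((h₁.ok x (by simp [hQ])).sees_bounds ⟨hsT, Or.inr ⟨d, hd, hsd, rfl, rfl⟩⟩).1.trans hhi
  obtain ⟨q, hq, hq1, hq2⟩ := exists_splice hG hp h₂.lazy (n := F t) (n' := y.hi)
    (by rw [hp2 _ le_rfl, hok.2.2.2.2.1]; exact (hok.sees_dist hs).2)
  have hqt : q (F t) = t := by rw [hq1 _ le_rfl, hp2 _ le_rfl]
  have hsv' : ∀ σ ∈ P ++ [visit t (F t)], K.Served T F (F t) x y q σ := fun σ hσ =>
    (hsv σ hσ).1.congr fun m hm => hq1 m (hm.trans (hsv σ hσ).2)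
  have hlv' : K.Leaving T q x x' := hlv.congr fun m hm => hq1 m (hm.trans hhi)
  have hx1 : ∀ m ≤ x.lo, q m = p₁ m := fun m hm => by rw [hq1 m (hm.trans hxlo), hp1 m hm]
  obtain ⟨hsT, ⟨b, c, hb, hl, hu, hl'⟩ | ⟨d, hd, hi, hu, hl'⟩⟩ := hs
  · obtain ⟨h1, -, -, -, e5, ⟨b', hb', e1, e2, e3⟩ | ⟨d, hd, -⟩⟩ := hok
    swap
    · rw [hb] at hd; cases hd
    rw [hb] at hb'; cases hb'
    have hc : 0 < c := hl.pos_of_ne fun h => h1 (by rw [hb, h]; exact hsT)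
    obtain ⟨M, hM, hM'⟩ := exists_chain_link (α := visit t (F t)) (β := y)
      (m := F t) (n := y.lo) hch rfl hb le_rfl le_rfl e3.le (by omega) hl.symm
    refine ⟨y, P ++ [visit t (F t)] ++ M, q, hq, hx1, hq2, hlv', Or.inl ⟨rfl, b, hb⟩, hhi, by omega,
      by simp, by simpa using hM, fun σ hσ => ?_⟩
    rcases List.mem_append.1 hσ with hσ | hσ
    · exact hsv' σ hσ
    · obtain ⟨d, hd, ia, ib, rfl⟩ := hM' σ hσ
      exact Or.inr ⟨d, t, b, _, _, hd, ia, ib, by omega, hqt, by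
        rw [hq2 _ e3.ge, e3, e5, e2], Or.inl ⟨hsT, rfl, le_rfl⟩, Or.inr ⟨hb, rfl⟩, rfl⟩
  · refine ⟨y.cutLo K d (y.dn t) t, P ++ [visit t (F t)], q, hq, hx1, hq2, hlv',
      Or.inr ⟨d, hd, hsT, hi, hl' ▸ hqt, rfl⟩, hhi, hl'.le, by simp, ?_, hsv'⟩
    have hb := (hok.sees_bounds ⟨hsT, Or.inr ⟨d, hd, hi, rfl, rfl⟩⟩).2
    rw [← List.cons_append, List.isChain_append]
    refine ⟨hch, List.isChain_singleton _, ?_⟩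
    intro α hα β hβ
    simp only [List.cons_append, List.getLast?_cons, List.getLast?_append,
      Option.some_or, Option.getD_some, Option.mem_def, Option.some.injEq, List.head?_cons]
      at hα hβ
    subst hα hβ
    refine ⟨?_, fun d h => by simp [visit] at h, fun _ _ => rfl, hl'.le, hb⟩
    change K.Adj _ y.h
    rw [hd]
    exact hi

lemma Plan.exists_nodup_path {T : Set (V ⊕ X)} {F : V → ℤ} {B : ℤ} {x y x' y' : Station V X}
    {q : ℤ → V} {P : List (Station V X)} (hP : P ≠ []) (hch : ((x' :: P) ++ [y']).IsChain K.Succ)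
    (hs : ∀ σ ∈ P, K.Served T F B x y q σ) : ∃ P : List (Station V X), P ≠ [] ∧
      ((x' :: P) ++ [y']).IsChain K.Succ ∧ (∀ σ ∈ P, K.Served T F B x y q σ) ∧
      (P.map Station.h).Nodup := by
  induction hn : P.length using Nat.strong_induction_on generalizing P with
  | _ n ih =>
    by_cases hnd : (P.map Station.h).Nodup
    · exact ⟨P, hP, hch, hs, hnd⟩
    rw [List.Nodup, List.pairwise_map] at hnd
    obtain ⟨A, σ, M, τ, C, rfl, hh⟩ := exists_of_not_pairwise hnd
    push Not at hh
    have hle : σ.hi ≤ τ.lo := by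
      have h : ((x' :: A ++ σ :: M) ++ τ :: (C ++ [y'])).IsChain K.Succ := by simpa using hch
      exact ((List.pairwise_append.1 (Plan.Succ.pairwise h)).2.2 σ (by simp) τ (by simp)).1
    have key : ∃ ρ : Station V X, K.Served T F B x y q ρ ∧ ρ.h = σ.h ∧ ρ.lo = σ.lo ∧
        ρ.pl = σ.pl ∧ ρ.hi = τ.hi ∧ ρ.ph = τ.ph ∧ ρ.lo ≤ ρ.hi := by
      rcases hs σ (by simp) with ⟨s, hs1, hB, hps, rfl⟩ |
        ⟨d, a, b, m, n, hd, ia, ib, hmn, hm, hn, ha, hb, rfl⟩ <;>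
      rcases hs τ (by simp) with ⟨s', hs1', hB', hps', rfl⟩ |
        ⟨d', a', b', m', n', hd', ia', ib', hmn', hm', hn', ha', hb', rfl⟩
      · obtain rfl : s = s' := by simpa [visit] using hh
        exact ⟨_, Or.inl ⟨s, hs1, hB, hps, rfl⟩, rfl, rfl, rfl, rfl, rfl, le_rfl⟩
      · simp [visit, Plan.transit] at hh
      · simp [visit, Plan.transit] at hh
      · obtain rfl : d = d' := by simpa [Plan.transit] using hh
        have hle' : n ≤ m' := hle
        have hlt : m < n' := by omega
        exact ⟨_, Or.inr ⟨d, a, b', m, n', hd, ia, ib', hlt, hm, hn', ha, hb', rfl⟩, rfl, rfl, rfl,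
          rfl, rfl, hlt.le⟩
    obtain ⟨ρ, hρ, e1, e2, e3, e4, e5, e6⟩ := key
    refine ih (A ++ ρ :: C).length (by simp at hn ⊢; omega) (P := A ++ ρ :: C) (by simp) ?_ ?_ rfl
    · have c1 : ((x' :: A) ++ σ :: (M ++ τ :: C ++ [y'])).IsChain K.Succ := by simpa using hch
      have c2 : ((x' :: A ++ σ :: M) ++ τ :: (C ++ [y'])).IsChain K.Succ := by simpa using hch
      have c3 : ((x' :: A) ++ ρ :: (C ++ [y'])).IsChain K.Succ := by
        rw [List.isChain_append] at c1 c2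
        have c2' := List.isChain_cons.1 c2.2.1
        refine List.isChain_append.2 ⟨c1.1, List.isChain_cons.2 ⟨fun z hz => ?_, c2'.2⟩,
          fun z hz w hw => ?_⟩
        · have := c2'.1 z hz
          simpa only [Plan.Succ, e1, e4, e5, hh] using this
        · obtain rfl : ρ = w := by simpa using hw
          have := c1.2.2 z hz σ (by simp)
          rw [Plan.Succ, e1, e2, e3]
          exact ⟨this.1, this.2.1, this.2.2.1, this.2.2.2.1, e2 ▸ e6⟩
      simpa using c3
    · intro σ' hσ'
      simp only [List.mem_append, List.mem_cons] at hσ'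
      rcases hσ' with h | rfl | h
      · exact hs σ' (by simp [h])
      · exact hρ
      · exact hs σ' (by simp [h])

end Connecting

end CopsRobbersOnePlanar

namespace CopsRobbersOnePlanar

section Joining

variable {V X : Type} {G G₀ : SimpleGraph V} {K : Plan G G₀ X}

variable (K) in
/-- The walk `q` first follows the beginning `L₁ ++ [x]` of the list `Q₁ = L₁ ++ x :: M₁`, then
a path `P` in `T`, and then the end `y :: M₂` of the list `Q₂ = L₂ ++ y :: M₂`. -/
structure Plan.Joins (T : Set (V ⊕ X)) (Q₁ Q₂ L₁ M₁ L₂ M₂ N₂ P : List (Station V X))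
    (x y x' y' : Station V X) (q : ℤ → V) (ψ : V → ℤ) : Prop where
  left : Q₁ = L₁ ++ x :: M₁
  right : Q₂ = L₂ ++ y :: M₂
  start : x'.h = x.h
  finish : y'.h = y.h
  tail : N₂.map Station.h = M₂.map Station.h
  ne_nil : P ≠ []
  mem : ∀ σ ∈ P, σ.h ∈ T
  nodup : (P.map Station.h).Nodup
  chain : (x.h :: P.map Station.h ++ [y.h]).IsChain K.Adj
  lazy : ∀ m, G.dist (q m) (q (m + 1)) ≤ 1
  lip : K.Lip T ψ
  visits : ∀ s, ∀ σ ∈ P, σ.h = .inl s → q (ψ s) = s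
  route : ∀ T' ⊆ T, (∀ σ ∈ P, σ.h ∉ T') → K.Route T' q ψ (L₁ ++ x' :: P ++ y' :: N₂)

lemma Plan.Served.mem {T : Set (V ⊕ X)} {F : V → ℤ} {B : ℤ} {x y : Station V X} {q : ℤ → V}
    {σ : Station V X} (h : K.Served T F B x y q σ) : σ.h ∈ T := by
  rcases h with ⟨s, hs, -, -, rfl⟩ | ⟨d, a, b, m, n, hd, -, -, -, -, -, -, -, rfl⟩
  · exact hs
  · exact hd

lemma Plan.Served.ne {T : Set (V ⊕ X)} {F : V → ℤ} {B : ℤ} {x y : Station V X} {a b : V} {m n : ℤ}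
    (hx : x.h ∉ T) (hy : y.h ∉ T) (hxy : x.h ≠ y.h) (ha : Anchor T F B x a m)
    (hb : Anchor T F B y b n) (hmn : m < n) : a ≠ b := by
  rintro rfl
  rcases ha with ⟨h1, h2, -⟩ | ⟨h1, -⟩ <;> rcases hb with ⟨h3, h4, -⟩ | ⟨h3, -⟩
  · omega
  · exact hy (h3 ▸ h1)
  · exact hx (h1 ▸ h3)
  · exact hxy (h1.trans h3.symm)

/-- A walk joining two routes at minimal cost guards all the stations it passes. -/
lemma Plan.exists_joins_of_min (hG : G.Connected) {T : Set (V ⊕ X)} {p₁ p₂ : ℤ → V}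
    {φ₁ φ₂ : V → ℤ} {Q₁ Q₂ : List (Station V X)} (h₁ : K.Route T p₁ φ₁ Q₁)
    (h₂ : K.Route T p₂ φ₂ Q₂) {F : V → ℤ} (hF : K.IsLeastCost T Q₁ F)
    (hne : ∀ x ∈ Q₁, ∀ y ∈ Q₂, x.h ≠ y.h)
    (hmin : ∀ y ∈ Q₂, ∀ s u l, K.Sees T y s u l → l ≤ F s) {y : Station V X} (hy : y ∈ Q₂) {t : V}
    {u : ℤ} (hs : K.Sees T y t u (F t)) :
    ∃ L₁ M₁ L₂ M₂ N₂ P x y x' y' q ψ, K.Joins T Q₁ Q₂ L₁ M₁ L₂ M₂ N₂ P x y x' y' q ψ := by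
  obtain ⟨L₁, x, M₁, hQ₁, x', y', P, q, hq, hq1, hq2, hlv, har, hhi, hlo, hP, hch, hsv⟩ :=
    K.exists_path hG h₁ h₂ hF hy hs
  obtain ⟨P, hP, hch, hsv, hnd⟩ := exists_nodup_path hP hch hsv
  obtain ⟨L₂, M₂, hQ₂⟩ := List.append_of_mem hy
  have hx : x ∈ Q₁ := by simp [hQ₁]
  have okx := h₁.ok x hx
  have oky := h₂.ok y hy
  have hxh : x'.h = x.h := by rcases hlv with ⟨rfl, -⟩ | ⟨d, s, -, -, -, -, rfl⟩ <;> rfl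
  have hyh : y'.h = y.h := by rcases har with ⟨rfl, -⟩ | ⟨d, -, -, -, -, rfl⟩ <;> rfl
  have hxlo : x'.lo = x.lo := by rcases hlv with ⟨rfl, -⟩ | ⟨d, s, -, -, -, -, rfl⟩ <;> rfl
  have hyhi : y'.hi = y.hi := by rcases har with ⟨rfl, -⟩ | ⟨d, -, -, -, -, rfl⟩ <;> rfl
  have hx' : x'.lo ≤ x'.hi := by
    rcases hlv with ⟨rfl, -⟩ | ⟨d, s, hd, hsT, hsd, -, rfl⟩
    · exact okx.lo_le_hi
    · exact (okx.sees_bounds ⟨hsT, Or.inr ⟨d, hd, hsd, rfl, rfl⟩⟩).1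
  have hy' : y'.lo ≤ y'.hi := by
    rcases har with ⟨rfl, -⟩ | ⟨d, hd, hsT, hsd, -, rfl⟩
    · exact oky.lo_le_hi
    · exact (oky.sees_bounds ⟨hsT, Or.inr ⟨d, hd, hsd, rfl, rfl⟩⟩).2
  have hF2 : ∀ σ ∈ Q₁, ∀ s u l, K.Sees T σ s u l → l ≤ F s ∧ F s ≤ u := fun σ hσ s u l h =>
    ⟨(h₁.guard σ hσ s u l h).1.trans ((hF s h.1).1.le h₁), (hF s h.1).2 u (.base σ s u l hσ h)⟩
  set ψ : V → ℤ := fun s => min (F s) (max (φ₂ s) (F t)) with hψ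
  have hord : (L₁ ++ x' :: P ++ y' :: M₂).Pairwise fun σ τ => σ.hi ≤ τ.lo := by
    have o1 := h₁.ordered
    have o2 := h₂.ordered
    rw [hQ₁, List.pairwise_append] at o1
    rw [hQ₂, List.pairwise_append, List.pairwise_cons] at o2
    have o3 := Plan.Succ.pairwise hch
    have e : L₁ ++ x' :: P ++ y' :: M₂ = L₁ ++ ((x' :: P ++ [y']) ++ M₂) := by simp
    have b1 : ∀ τ ∈ x' :: P ++ [y'], x.lo ≤ τ.lo := by
      intro τ hτ
      rw [List.cons_append] at o3 hτ
      rcases List.mem_cons.1 hτ with rfl | hτ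
      · exact hxlo.ge
      · have := ((List.pairwise_cons.1 o3).1 τ hτ).1
        omega
    have b2 : ∀ τ ∈ x' :: P ++ [y'], τ.hi ≤ y.hi := by
      intro τ hτ
      rcases List.mem_append.1 hτ with hτ | hτ
      · have := (List.pairwise_append.1 o3).2.2 τ hτ y' (by simp)
        omega
      · rw [List.mem_singleton] at hτ
        rw [hτ, hyhi]
    rw [e, List.pairwise_append, List.pairwise_append]
    refine ⟨o1.1, ⟨o3.imp fun h => h.1, o2.2.1.2, fun σ hσ τ hτ =>
      (b2 σ hσ).trans (o2.2.1.1 τ hτ)⟩, fun σ hσ τ hτ => ?_⟩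
    have h1 := o1.2.2 σ hσ x (by simp)
    rcases List.mem_append.1 hτ with hτ | hτ
    · exact h1.trans (b1 τ hτ)
    · have := o2.2.1.1 τ hτ
      omega
  have hlip : K.Lip T ψ := by
    intro a b c ha hb hl
    have e1 := hF.lip a b c ha hb hl
    have e2 := h₂.lip a b c ha hb hl
    have e3 := hl.nonneg
    simp only [hψ]
    omega
  have hguard : ∀ σ ∈ L₁ ++ x' :: P ++ y' :: M₂, ∀ s u l, K.Sees T σ s u l → l ≤ ψ s ∧ ψ s ≤ u := by
    intro σ hσ s u l hsee
    simp only [List.mem_append, List.mem_cons] at hσ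
    rcases hσ with (hσ | rfl | hσ) | rfl | hσ
    · have e1 := hF2 σ (by simp [hQ₁, hσ]) s u l hsee
      have e2 := (h₁.ok σ (by simp [hQ₁, hσ])).sees_bounds hsee
      have o1 := h₁.ordered
      rw [hQ₁, List.pairwise_append] at o1
      have e3 := o1.2.2 σ hσ x (by simp)
      simp only [hψ]
      omega
    · rcases hlv with ⟨rfl, -⟩ | ⟨d, s', hd, hsT, hsd, -, rfl⟩
      · have e1 := hF2 _ hx s u l hsee
        have e2 := okx.sees_bounds hsee
        simp only [hψ]
        omega
      · obtain ⟨hs1, ⟨a, c, ha, -⟩ | ⟨d', hd', hi, rfl, rfl⟩⟩ := hsee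
        · rw [hxh, hd] at ha; cases ha
        rw [hxh, hd] at hd'; cases hd'
        have e1 := hF2 _ hx s _ _ ⟨hs1, Or.inr ⟨d, hd, hi, rfl, rfl⟩⟩
        simp only [hψ, Station.cutHi] at hhi ⊢
        have := abs_nonneg (K.pos d s' - K.pos d s)
        omega
    · rcases hsv σ hσ with ⟨s', hs', hB, hps, rfl⟩ |
        ⟨d, a, b, m, n, hd, ia, ib, hmn, hm, hn, ha, hb, rfl⟩
      · obtain ⟨hs1, ⟨a, c, ha, hl, rfl, rfl⟩ | ⟨d', hd', -⟩⟩ := hsee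
        swap
        · simp [visit] at hd'
        obtain rfl : s' = a := by simpa [visit] using ha
        have e1 := hF.lip _ _ c hs' hs1 hl
        have e2 := hF.lip _ _ c hs1 hs' hl.symm
        simp only [hψ, visit]
        omega
      · obtain ⟨hs1, ⟨a, c, ha, -⟩ | ⟨d', hd', hi, rfl, rfl⟩⟩ := hsee
        · simp [Plan.transit] at ha
        obtain rfl : d = d' := by simpa [Plan.transit] using hd'
        have e1 : F s ≤ m + |K.pos d a - K.pos d s| := by
          rcases ha with ⟨h1, rfl, -⟩ | ⟨h1, rfl⟩
          · exact hF.lip _ _ _ h1 hs1 (Or.inr ⟨d, hd, ia, hi, rfl⟩)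
          · exact (hF2 x hx s _ _ ⟨hs1, Or.inl ⟨a, _, h1, Or.inr ⟨d, hd, ia, hi, rfl⟩, rfl, rfl⟩⟩).2
        have e2 : n - |K.pos d b - K.pos d s| ≤ ψ s := by
          rcases hb with ⟨h1, rfl, h2⟩ | ⟨h1, rfl⟩
          · have := hF.lip _ _ _ hs1 h1 (Or.inr ⟨d, hd, hi, ib, rfl⟩)
            have e3 := abs_sub_comm (K.pos d s) (K.pos d b)
            have e4 := abs_nonneg (K.pos d b - K.pos d s)
            simp only [hψ]
            omega
          · have hsee : K.Sees T y s _ _ :=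
              ⟨hs1, Or.inl ⟨b, _, h1, Or.inr ⟨d, hd, ib, hi, rfl⟩, rfl, rfl⟩⟩
            have e3 := hmin y hy s _ _ hsee
            have e4 := h₂.guard y hy s _ _ hsee
            simp only [hψ]
            omega
        exact ⟨e2, (min_le_left _ _).trans e1⟩
    · rcases har with ⟨rfl, b, hb⟩ | ⟨d, hd, hsT, hsd, -, rfl⟩
      · have e1 := h₂.guard _ hy s u l hsee
        have e2 := oky.sees_bounds hsee
        have e3 := hmin _ hy s u l hsee
        simp only [hψ]
        omega
      · obtain ⟨hs1, ⟨a, c, ha, -⟩ | ⟨d', hd', hi, rfl, rfl⟩⟩ := hsee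
        · rw [hyh, hd] at ha; cases ha
        rw [hyh, hd] at hd'; cases hd'
        have hsee : K.Sees T y s _ _ := ⟨hs1, Or.inr ⟨d, hd, hi, rfl, rfl⟩⟩
        have e1 := h₂.guard _ hy s _ _ hsee
        have e3 := hmin _ hy s _ _ hsee
        simp only [hψ, Station.cutLo] at hlo ⊢
        have := abs_nonneg (K.pos d t - K.pos d s)
        omega
    · have hσ' : σ ∈ Q₂ := by simp [hQ₂, hσ]
      have e1 := h₂.guard σ hσ' s u l hsee
      have e2 := (h₂.ok σ hσ').sees_bounds hsee
      have e3 := hmin _ hσ' s u l hsee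
      have o2 := h₂.ordered
      rw [hQ₂, List.pairwise_append, List.pairwise_cons] at o2
      have e4 := o2.2.1.1 σ hσ
      simp only [hψ]
      omega
  have hchain : (x.h :: P.map Station.h ++ [y.h]).IsChain K.Adj := by
    rw [← hxh, ← hyh]
    have : (((x' :: P) ++ [y']).map Station.h).IsChain K.Adj :=
      List.isChain_map_of_isChain _ (fun _ _ h => h.1) hch
    simpa using this
  refine ⟨L₁, M₁, L₂, M₂, M₂, P, x, y, x', y', q, ψ, hQ₁, hQ₂, hxh, hyh, rfl, hP,
    fun σ hσ => (hsv σ hσ).mem, hnd, hchain, hq, hlip, ?_, fun T' hT' hPT' => ?_⟩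
  · intro s σ hσ hh
    rcases hsv σ hσ with ⟨s', hs', hB, hps, rfl⟩ | ⟨d, a, b, m, n, -, -, -, -, -, -, -, -, rfl⟩
    · obtain rfl : s' = s := by simpa [visit] using hh
      have : ψ s' = F s' := by simp only [hψ]; omega
      rw [this, hps]
    · simp [Plan.transit] at hh
  have hxT : x'.h ∉ T' := fun h => okx.1 (hxh ▸ hT' h)
  have hyT : y'.h ∉ T' := fun h => oky.1 (hyh ▸ hT' h)
  refine ⟨hq, hlip.mono hT', fun σ hσ => ?_, fun σ hσ s u l h => hguard σ hσ s u l (h.mono hT'),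
    hord⟩
  simp only [List.mem_append, List.mem_cons] at hσ
  rcases hσ with (hσ | rfl | hσ) | rfl | hσ
  · have hσ' : σ ∈ Q₁ := by simp [hQ₁, hσ]
    have o1 := h₁.ordered
    rw [hQ₁, List.pairwise_append] at o1
    have e3 := o1.2.2 σ hσ x (by simp)
    have e4 := (h₁.ok σ hσ').lo_le_hi
    exact ((h₁.ok σ hσ').congr (hq1 _ (e4.trans e3)) (hq1 _ e3)).mono hT'
  · rcases hlv with ⟨rfl, a, ha⟩ | ⟨d, s', hd, hsT, hsd, hqs, rfl⟩
    · obtain ⟨-, -, -, -, -, ⟨_, -, -, -, e⟩ | ⟨d, hd, -⟩⟩ := id okx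
      · exact (okx.congr (hq1 _ le_rfl) (hq1 _ e.ge)).mono hT'
      · rw [hd] at ha; cases ha
    · refine okx.cutHi hd hsT hsd hT' ?_ ((hq1 _ le_rfl).trans okx.2.2.2.1) hqs
      obtain ⟨τ, hτ, hτ'⟩ := exists_isChain_succ (l₁ := []) (l₂ := P ++ [y']) hch (by simp)
      have e := hτ'.2.1 d hd
      rcases List.mem_append.1 hτ with hτ | hτ
      · exact fun h => hPT' τ hτ (e ▸ h)
      · rw [List.mem_singleton] at hτ
        subst hτ
        exact fun h => hyT (e ▸ h)
  · rcases hsv σ hσ with ⟨s', hs', hB, hps, rfl⟩ |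
      ⟨d, a, b, m, n, hd, ia, ib, hmn, hm, hn, ha, hb, rfl⟩
    · exact ⟨hPT' _ hσ, hPT' _ hσ, hPT' _ hσ, hps, hps, Or.inl ⟨s', rfl, rfl, rfl, rfl⟩⟩
    · obtain ⟨A, C, rfl⟩ := List.append_of_mem hσ
      obtain ⟨τ₁, hτ₁, hτ₁'⟩ := exists_isChain_pred (l₁ := x' :: A) (l₂ := C ++ [y'])
        (by simpa using hch) (by simp)
      obtain ⟨τ₂, hτ₂, hτ₂'⟩ := exists_isChain_succ (l₁ := x' :: A) (l₂ := C ++ [y'])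
        (by simpa using hch) (by simp)
      have e1 : τ₁.h ∉ T' := by
        rcases List.mem_cons.1 hτ₁ with rfl | h
        · exact hxT
        · exact hPT' _ (by simp [h])
      have e2 : τ₂.h ∉ T' := by
        rcases List.mem_append.1 hτ₂ with h | h
        · exact hPT' _ (by simp [h])
        · rw [List.mem_singleton] at h
          exact h ▸ hyT
      rw [hτ₁'.2.2.1 d rfl] at e1
      rw [hτ₂'.2.1 d rfl] at e2
      exact ⟨hPT' _ hσ, e1, e2, hm, hn, Or.inr ⟨d, rfl, hmn, ia, ib, fun s hs hi =>
        ⟨le_rfl, le_rfl⟩, Or.inl ⟨Served.ne okx.1 oky.1 (hne x hx y hy) ha hb hmn, fun s hs hi =>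
        ⟨rfl, rfl⟩⟩⟩⟩
  · rcases har with ⟨rfl, b, hb⟩ | ⟨d, hd, hsT, hsd, hqs, rfl⟩
    · obtain ⟨-, -, -, -, -, ⟨_, -, -, -, e⟩ | ⟨d, hd, -⟩⟩ := id oky
      · exact (oky.congr (hq2 _ e.ge) (hq2 _ le_rfl)).mono hT'
      · rw [hd] at hb; cases hb
    · refine oky.cutLo hd hsT hsd hT' ?_ ((hq2 _ le_rfl).trans oky.2.2.2.2.1) hqs
      obtain ⟨τ, hτ, hτ'⟩ := exists_isChain_pred (l₁ := x' :: P) (l₂ := []) hch (by simp)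
      have e := hτ'.2.2.1 d hd
      rcases List.mem_cons.1 hτ with rfl | hτ
      · exact fun h => hxT (e ▸ h)
      · exact fun h => hPT' τ hτ (e ▸ h)
  · have hσ' : σ ∈ Q₂ := by simp [hQ₂, hσ]
    have o2 := h₂.ordered
    rw [hQ₂, List.pairwise_append, List.pairwise_cons] at o2
    have e3 := o2.2.1.1 σ hσ
    have e4 := (h₂.ok σ hσ').lo_le_hi
    exact ((h₂.ok σ hσ').congr (hq2 _ e3) (hq2 _ (e3.trans e4))).mono hT'

/-- Two routes next to the robber's territory can be joined through it. -/
lemma Plan.exists_joins [Finite V] (hG : G.Connected) {T : Set (V ⊕ X)} {p₁ p₂ : ℤ → V}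
    {φ₁ φ₂ : V → ℤ} {Q₁ Q₂ : List (Station V X)} (h₁ : K.Route T p₁ φ₁ Q₁)
    (h₂ : K.Route T p₂ φ₂ Q₂) (hconn : ∀ z ∈ T, ∀ z' ∈ T, LinkedIn K.Adj T z z')
    (hsee₁ : ∃ σ ∈ Q₁, ∃ s u l, K.Sees T σ s u l) (hsee₂ : ∃ σ ∈ Q₂, ∃ s u l, K.Sees T σ s u l)
    (hne : ∀ x ∈ Q₁, ∀ y ∈ Q₂, x.h ≠ y.h) :
    ∃ L₁ M₁ L₂ M₂ N₂ P x y x' y' q ψ, K.Joins T Q₁ Q₂ L₁ M₁ L₂ M₂ N₂ P x y x' y' q ψ := by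
  obtain ⟨F, hF⟩ := exists_isLeastCost h₁ hconn hsee₁
  obtain ⟨b, hb⟩ := (Set.finite_range fun s => F s - φ₂ s).bddBelow
  obtain ⟨k, ⟨y, hy, t, u, l, hs, rfl⟩, hk⟩ := Int.exists_least_of_bdd
    (P := fun k => ∃ y ∈ Q₂, ∃ s u l, K.Sees T y s u l ∧ k = F s - l)
    ⟨b, by
      rintro _ ⟨y, hy, s, u, l, hs, rfl⟩
      have := hb ⟨s, rfl⟩
      have := (h₂.guard y hy s u l hs).1
      simp only at *
      omega⟩
    (by
      obtain ⟨y, hy, s, u, l, hs⟩ := hsee₂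
      exact ⟨_, y, hy, s, u, l, hs, rfl⟩)
  obtain ⟨L₁, M₁, L₂, M₂, N₂, P, x, y, x', y', q, ψ, h⟩ :=
    K.exists_joins_of_min hG h₁ (h₂.shift (F t - l)) hF
      (by
        intro x hx y hy
        obtain ⟨y, hy', rfl⟩ := List.mem_map.1 hy
        exact hne x hx y hy')
      (by
        intro y hy s u' l' hs
        obtain ⟨y, hy', rfl⟩ := List.mem_map.1 hy
        have := hk _ ⟨y, hy', s, _, _, hs.unshift, rfl⟩
        omega)
      (List.mem_map_of_mem hy) (t := t) (u := u + (F t - l))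
      (by simpa using hs.shift (k := F t - l))
  obtain ⟨L, R, hQ, rfl, hR⟩ := List.map_eq_append_iff.1 h.right
  obtain ⟨z, M, rfl, rfl, rfl⟩ := List.map_eq_cons_iff.1 hR
  refine ⟨L₁, M₁, L, M, N₂, P, x, z, x', y', q, ψ, h.left, hQ, h.start, h.finish, ?_, h.ne_nil,
    h.mem, h.nodup, h.chain, h.lazy, h.lip, h.visits, h.route⟩
  rw [h.tail, List.map_map]
  rfl

/-- A station next to the robber's territory sees a vertex in it. -/
lemma Plan.exists_sees {T : Set (V ⊕ X)} {σ : Station V X} {r : V} (hr : .inl r ∈ T)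
    (hconn : ∀ z ∈ T, ∀ z' ∈ T, LinkedIn K.Adj T z z') {z : V ⊕ X} (hz : z ∈ T)
    (hσ : K.Adj σ.h z) : ∃ s u l, K.Sees T σ s u l := by
  rcases hh : σ.h with a | d
  · rcases z with s | d
    · rw [hh] at hσ
      exact ⟨s, _, _, hz, Or.inl ⟨a, 1, hh, Or.inl ⟨hσ, rfl⟩, rfl, rfl⟩⟩
    · rcases (hconn _ hz _ hr).2.cases_head with h | ⟨z', ⟨-, hz', h⟩, -⟩
      · cases h
      rcases z' with s | d'
      · rw [hh] at hσ
        exact ⟨s, _, _, hz', Or.inl ⟨a, _, hh, Or.inr ⟨d, hz, hσ, h, rfl⟩, rfl, rfl⟩⟩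
      · exact h.elim
  · rcases z with s | d'
    · rw [hh] at hσ
      exact ⟨s, _, _, hz, Or.inr ⟨d, hh, hσ, rfl, rfl⟩⟩
    · rw [hh] at hσ
      exact hσ.elim

end Joining

end CopsRobbersOnePlanar

namespace CopsRobbersOnePlanar

section Separating

variable {V X : Type} {G G₀ : SimpleGraph V} {K : Plan G G₀ X}

lemma linkedIn_of_isChain {α : Type} {R : α → α → Prop} {W : List α} {a w : α}
    (h : (a :: W).IsChain R) (hw : w ∈ W) : LinkedIn R {z : α | z = a ∨ z ∈ W} a w := by
  induction W generalizing a with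
  | nil => simp at hw
  | cons b W ih =>
    rw [List.isChain_cons_cons] at h
    refine ⟨Or.inl rfl, .head ⟨Or.inl rfl, Or.inr (by simp), h.1⟩ ?_⟩
    rcases List.mem_cons.1 hw with rfl | hw
    · exact .refl
    · refine Relation.ReflTransGen.mono (fun x y ⟨hx, hy, hr⟩ => ⟨Or.inr ?_, Or.inr ?_, hr⟩) _ _ (ih h.2 hw).2
      · simpa using hx
      · simpa using hy

variable (K) in
/-- The territory `T` is next to `z`. -/
def Plan.Meets (T : Set (V ⊕ X)) (z : V ⊕ X) : Prop := ∃ w ∈ T, K.Adj w z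

/-- If two vertices of the planarization are joined by three disjoint paths then each connected set
avoiding them is away from the interior of one of the paths. -/
lemma Plan.exists_forall_not_meets {T : Set (V ⊕ X)} {a b r : V ⊕ X} (hab : a ≠ b) (ha : a ∉ T)
    (hb : b ∉ T) (hr : r ∈ T) (hconn : ∀ z ∈ T, ∀ z' ∈ T, LinkedIn K.Adj T z z')
    (W : Fin 3 → List (V ⊕ X)) (hch : ∀ i, (a :: W i ++ [b]).IsChain K.Adj)
    (hW : ∀ i j, i ≠ j → ∀ z ∈ W i, z ∉ W j) (haW : ∀ i, a ∉ W i) (hbW : ∀ i, b ∉ W i)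
    (hWT : ∀ i, ∀ z ∈ W i, z ∉ T) : ∃ i, ∀ z ∈ W i, ¬ K.Meets T z := by
  by_contra! hcon
  choose w hw t ht hadj using hcon
  let U : Fin 3 → Fin 3 → Set (V ⊕ X) := fun i j =>
    ![{z | z = a ∨ z ∈ W j}, {z | z = b ∨ z ∈ W j}, {z | z ∈ T ∨ z = w j}] i
  refine K.not_K33 ![a, b, r] w U ?_ ?_
  · intro i j
    fin_cases i
    · exact linkedIn_of_isChain (List.isChain_append.1 (hch j)).1 (hw j)
    · have h1 : (b :: (W j).reverse).IsChain K.Adj := by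
        have h := (List.isChain_cons.1 (hch j)).2
        rw [← List.isChain_reverse] at h
        simp only [List.append_eq, List.reverse_append, List.reverse_cons, List.reverse_nil,
          List.nil_append, List.cons_append] at h
        exact h.imp fun _ _ h => adj_symm h
      have h2 := linkedIn_of_isChain h1 (List.mem_reverse.2 (hw j))
      simp only [List.mem_reverse] at h2
      exact h2
    · refine ⟨Or.inl hr, (Relation.ReflTransGen.mono (fun x y ⟨hx, hy, hr⟩ =>
        ⟨Or.inl hx, Or.inl hy, hr⟩) _ _ (hconn r hr (t j) (ht j)).2).tail ⟨Or.inl (ht j), Or.inr rfl, hadj j⟩⟩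
  · intro i j k l hik hjl
    have h1 : ∀ z ∈ W j, z ∉ W l := hW j l hjl
    have h3 := hWT j
    have h4 := hWT l
    have h5 := haW j
    have h6 := hbW j
    have h7 := haW l
    have h8 := hbW l
    have h9 := hw j
    have h10 := hw l
    rw [Set.disjoint_left]
    fin_cases i <;> fin_cases k <;> first | exact absurd rfl hik | skip
    all_goals
      rintro z hz hz'
      simp [U] at hz hz'
      grind

/-- Two paths starting at the same vertex can be concatenated. -/
lemma isChain_glue {α : Type*} {R : α → α → Prop} (hR : ∀ a b, R a b → R b a) {u : α}
    {A B : List α} (hA : (u :: A).IsChain R) (hB : (u :: B).IsChain R) :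
    (A.reverse ++ u :: B).IsChain R := by
  have h : (A.reverse ++ [u]).IsChain R := by
    have := hA
    rw [← List.isChain_reverse, List.reverse_cons] at this
    exact this.imp fun _ _ h => hR _ _ h
  exact List.isChain_split.2 ⟨h, hB⟩

end Separating

end CopsRobbersOnePlanar

namespace CopsRobbersOnePlanar

section Confining

variable {V X : Type} {G G₀ : SimpleGraph V} {K : Plan G G₀ X}

lemma exists_third (g g' : Fin 3) : ∃ g'', g'' ≠ g ∧ g'' ≠ g' := by
  revert g g'; decide

/-- A free group of cops joins two routes next to the robber's territory. -/
lemma Plan.Confined.join [Finite V] [Finite X] (hG : G.Connected) {T : Set (V ⊕ X)}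
    {A : Set (Fin 3)} {p : Fin 3 → ℤ → V} {φ : Fin 3 → V → ℤ} {Q : Fin 3 → List (Station V X)}
    {g : Fin 3} (hg : g ∉ A) {p₁ p₂ : ℤ → V} {φ₁ φ₂ : V → ℤ} {Q₁ Q₂ : List (Station V X)}
    (h₁ : K.Route T p₁ φ₁ Q₁) (h₂ : K.Route T p₂ φ₂ Q₂) (hm₁ : ∃ σ ∈ Q₁, K.Meets T σ.h)
    (hm₂ : ∃ σ ∈ Q₂, K.Meets T σ.h) (hne : ∀ x ∈ Q₁, ∀ y ∈ Q₂, x.h ≠ y.h)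
    {c : Fin 3 × Fin 7 → V} {r : V} (h : K.Confined c r T A p φ Q)
    (hwin : ∀ c r, ∀ T' ⊆ T, T'.ncard < T.ncard →
      ∀ L₁ M₁ L₂ M₂ N₂ P x y x' y' q ψ, K.Joins T Q₁ Q₂ L₁ M₁ L₂ M₂ N₂ P x y x' y' q ψ →
      (∀ σ ∈ P, σ.h ∉ T') →
      (∀ z ∈ T', ∀ z' ∉ T', K.Adj z z' →
        (∃ h ∈ A, ∃ σ ∈ Q h, σ.h = z') ∨ ∃ σ ∈ P, σ.h = z') →
      ∀ p' φ' Q', (∀ h ∈ A, Q' h = Q h) → Q' g = L₁ ++ x' :: P ++ y' :: N₂ →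
      K.Confined c r T' (insert g A) p' φ' Q' → Win G G₀ c r) :
    Win G G₀ c r := by
  have see : ∀ L : List (Station V X), (∃ σ ∈ L, K.Meets T σ.h) →
      ∃ σ ∈ L, ∃ s u l, K.Sees T σ s u l := fun L ⟨σ, hσ, w, hw, hadj⟩ =>
    ⟨σ, hσ, K.exists_sees h.mem h.conn hw (adj_symm hadj)⟩
  obtain ⟨L₁, M₁, L₂, M₂, N₂, P, x, y, x', y', q, ψ, J⟩ :=
    K.exists_joins hG h₁ h₂ h.conn (see _ hm₁) (see _ hm₂) hne
  refine h.extend hG (N := {z | ∃ σ ∈ P, σ.h = z}) hg J.lazy J.lip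
    (R := L₁ ++ x' :: P ++ y' :: N₂) ?_ ?_ ?_ ?_
  · rintro z ⟨σ, hσ, rfl⟩
    exact ⟨σ, by simp [hσ], rfl⟩
  · exact fun T' hT' => J.route T' (fun z hz => (hT' hz).1)
      fun σ hσ hz => (hT' hz).2 ⟨σ, hσ, rfl⟩
  · rintro s ⟨σ, hσ, e⟩
    exact J.visits s σ hσ e
  · intro c r T' hT' hb hc
    have hP : ∀ σ ∈ P, σ.h ∉ T' := fun σ hσ hz => (hT' hz).2 ⟨σ, hσ, rfl⟩
    have hT : T' ⊆ T := fun z hz => (hT' hz).1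
    refine hwin c r T' hT ?_ _ _ _ _ _ _ _ _ _ _ _ _ J hP hb _ _ _ ?_ ?_ hc
    · obtain ⟨σ, hσ⟩ := List.exists_mem_of_ne_nil _ J.ne_nil
      exact Set.ncard_lt_ncard ((Set.ssubset_iff_of_subset hT).2 ⟨_, J.mem σ hσ, hP σ hσ⟩)
        (Set.toFinite _)
    · intro k hk
      exact Function.update_of_ne (fun (e : k = g) => hg (e ▸ hk)) _ _
    · exact Function.update_self _ _ _

variable (K) in
/-- The cops win if one group confines the robber to `T` by guarding a path. -/
def Plan.WinsPath (T : Set (V ⊕ X)) : Prop :=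
  ∀ c r g p φ Q, K.Confined c r T {g} p φ Q → ((Q g).map Station.h).IsChain K.Adj →
    ((Q g).map Station.h).Nodup → Win G G₀ c r

variable (K) in
/-- The two lists of stations lie on paths from `u` to `v` which are disjoint otherwise. -/
structure Plan.Loop (Q₁ Q₂ : List (Station V X)) (u v : V ⊕ X) (A₁ A₂ : List (V ⊕ X)) : Prop where
  left : Q₁.map Station.h = u :: A₁ ++ [v]
  right : Q₂.map Station.h = u :: A₂ ++ [v]
  nodup : (u :: A₁ ++ v :: A₂).Nodup
  chain₁ : (u :: A₁ ++ [v]).IsChain K.Adj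
  chain₂ : (u :: A₂ ++ [v]).IsChain K.Adj

variable (K) in
/-- The cops win if two groups confine the robber to `T` by guarding a cycle. -/
def Plan.WinsLoop (T : Set (V ⊕ X)) : Prop :=
  ∀ c r g₁ g₂ p φ Q u v A₁ A₂, g₁ ≠ g₂ → K.Confined c r T {g₁, g₂} p φ Q →
    K.Loop (Q g₁) (Q g₂) u v A₁ A₂ → Win G G₀ c r

lemma Plan.WinsPath.win {T : Set (V ⊕ X)} (hw : K.WinsPath T) {c : Fin 3 × Fin 7 → V} {r : V}
    {A : Set (Fin 3)} {p : Fin 3 → ℤ → V} {φ : Fin 3 → V → ℤ} {Q : Fin 3 → List (Station V X)}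
    (h : K.Confined c r T A p φ Q) (g : Fin 3) (hg : g ∈ A) (R : List (Station V X))
    (hR : R.Sublist (Q g)) (hch : (R.map Station.h).IsChain K.Adj) (hnd : (R.map Station.h).Nodup)
    (hb : ∀ z ∉ T, K.Meets T z → (∃ g ∈ A, ∃ σ ∈ Q g, σ.h = z) → ∃ σ ∈ R, σ.h = z) :
    Win G G₀ c r := by
  refine hw c r g p φ (fun _ => R) (h.restrict (by simpa using hg) (by simpa using hR) ?_) hch hnd
  intro z hz z' hz' hadj
  exact ⟨g, rfl, hb z' hz' ⟨z, hz, hadj⟩ (h.bound z hz z' hz' hadj)⟩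

lemma Plan.WinsLoop.win {T : Set (V ⊕ X)} (hw : K.WinsLoop T) {c : Fin 3 × Fin 7 → V} {r : V}
    {A : Set (Fin 3)} {p : Fin 3 → ℤ → V} {φ : Fin 3 → V → ℤ} {Q : Fin 3 → List (Station V X)}
    (h : K.Confined c r T A p φ Q) (g₁ g₂ : Fin 3) (hne : g₁ ≠ g₂) (hg₁ : g₁ ∈ A) (hg₂ : g₂ ∈ A)
    (R₁ R₂ : List (Station V X)) (hR₁ : R₁.Sublist (Q g₁)) (hR₂ : R₂.Sublist (Q g₂))
    {u v : V ⊕ X} {A₁ A₂ : List (V ⊕ X)} (hl : K.Loop R₁ R₂ u v A₁ A₂)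
    (hb : ∀ z ∉ T, K.Meets T z → (∃ g ∈ A, ∃ σ ∈ Q g, σ.h = z) →
      (∃ σ ∈ R₁, σ.h = z) ∨ ∃ σ ∈ R₂, σ.h = z) :
    Win G G₀ c r := by
  refine hw c r g₁ g₂ p φ (fun g => if g = g₁ then R₁ else R₂) u v A₁ A₂ hne
    (h.restrict ?_ ?_ ?_) (by simpa [hne.symm] using hl)
  · rintro g (rfl | rfl) <;> assumption
  · rintro g (rfl | rfl)
    · simpa using hR₁
    · simpa [hne.symm] using hR₂
  · intro z hz z' hz' hadj
    rcases hb z' hz' ⟨z, hz, hadj⟩ (h.bound z hz z' hz' hadj) with h | h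
    · exact ⟨g₁, by simp, by simpa using h⟩
    · exact ⟨g₂, by simp, by simpa [hne.symm] using h⟩

/-- The cops win if they guard a vertex. -/
lemma Plan.win_of_short [Finite V] [Finite X] (hG : G.Connected) {T : Set (V ⊕ X)}
    (ih : ∀ T' : Set (V ⊕ X), T'.ncard < T.ncard → K.WinsPath T') {c : Fin 3 × Fin 7 → V} {r : V}
    {g : Fin 3} {p : Fin 3 → ℤ → V} {φ : Fin 3 → V → ℤ} {Q : Fin 3 → List (Station V X)}
    (h : K.Confined c r T {g} p φ Q) (hlen : (Q g).length ≤ 1) : Win G G₀ c r := by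
  have hsingle : ((Q g).map Station.h).IsChain K.Adj ∧ ((Q g).map Station.h).Nodup := by
    match hQ : Q g with
    | [] => simp
    | [x] => simp
    | x :: y :: L => simp [hQ] at hlen
  obtain ⟨g', hg'⟩ : ∃ g', g' ≠ g := exists_ne g
  obtain ⟨g'', hg'', hg'''⟩ := exists_third g g'
  have hrT := h.mem
  refine h.extend hG (N := {.inl r}) (g := g') (by simpa using hg') (q := fun _ => r) (by simp)
    (ψ := fun _ => 0) ?_ (R := [visit r 0]) ?_ ?_ ?_ ?_
  · intro a b n ha hb hl
    simpa using hl.nonneg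
  · rintro z rfl
    simp [visit]
  · intro T' hT'
    have hr' : .inl r ∉ T' := fun hz => (hT' hz).2 rfl
    refine ⟨by simp, ?_, ?_, ?_, by simp⟩
    · intro a b n ha hb hl
      simpa using hl.nonneg
    · simp only [List.mem_singleton]
      rintro σ rfl
      exact ⟨hr', hr', hr', rfl, rfl, Or.inl ⟨r, rfl, rfl, rfl, rfl⟩⟩
    · simp only [List.mem_singleton]
      rintro σ rfl s u l ⟨-, ⟨x, n, -, hl, rfl, rfl⟩ | ⟨d, hd, -⟩⟩
      · have := hl.nonneg
        simp only [visit]; omega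
      · cases hd
  · rintro s hs
    cases hs
    rfl
  · intro c r₁ T' hT' hb hc
    have hlt : T'.ncard < T.ncard := Set.ncard_lt_ncard
      ((Set.ssubset_iff_of_subset fun z hz => (hT' hz).1).2 ⟨_, hrT, fun hz => (hT' hz).2 rfl⟩)
      (Set.toFinite _)
    set Q₁ := Function.update Q g' [visit r 0] with hQ₁
    have e1 : Q₁ g = Q g := Function.update_of_ne hg'.symm _ _
    have e2 : Q₁ g' = [visit r 0] := Function.update_self _ _ _
    have hbd : ∀ z : V ⊕ X, (∃ k ∈ (insert g' {g} : Set (Fin 3)), ∃ σ ∈ Q₁ k, σ.h = z) ↔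
        (∃ σ ∈ Q g, σ.h = z) ∨ z = .inl r := by
      intro z
      simp [e1, e2, or_comm, eq_comm, visit]
    by_cases m1 : ∃ σ ∈ Q g, K.Meets T' σ.h
    swap
    · push Not at m1
      refine (ih T' hlt).win hc g' (by simp) [visit r 0] (by rw [e2]) (by simp) (by simp) ?_
      intro z hz hm hk
      rcases (hbd z).1 hk with ⟨σ, hσ, rfl⟩ | rfl
      · exact absurd hm (m1 σ hσ)
      · simp [visit]
    by_cases m2 : K.Meets T' (.inl r)
    swap
    · refine (ih T' hlt).win hc g (by simp) (Q g) (by rw [e1]) hsingle.1 hsingle.2 ?_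
      intro z hz hm hk
      rcases (hbd z).1 hk with h | rfl
      · exact h
      · exact absurd hm m2
    by_cases hrg : ∃ σ ∈ Q g, σ.h = .inl r
    · refine (ih T' hlt).win hc g (by simp) (Q g) (by rw [e1]) hsingle.1 hsingle.2 ?_
      intro z hz hm hk
      rcases (hbd z).1 hk with h | rfl
      · exact h
      · exact hrg
    have r1 := hc.route g (by simp)
    have r2 := hc.route g' (by simp)
    rw [e1] at r1
    rw [e2] at r2
    refine hc.join hG (g := g'') (by simp [hg'', hg''']) r1 r2 m1
      ⟨_, List.mem_singleton_self _, m2⟩ ?_ ?_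
    · simp only [List.mem_singleton]
      rintro x hx y rfl e
      exact hrg ⟨x, hx, e⟩
    · intro c r₂ T₂ hT₂ hlt₂ L₁ M₁ L₂ M₂ N₂ P x y x' y' q ψ J hP hbP p₂ φ₂ Q₂ hQ₂ hQg hc₂
      obtain ⟨rfl, rfl⟩ : L₁ = [] ∧ M₁ = [] := by
        have := J.left
        rw [this] at hlen
        simp only [List.length_append, List.length_cons] at hlen
        constructor <;> rw [← List.length_eq_zero_iff] <;> omega
      obtain ⟨rfl, rfl, rfl⟩ : L₂ = [] ∧ visit r 0 = y ∧ M₂ = [] := by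
        have := J.right
        cases L₂ <;> simp_all
      obtain rfl : N₂ = [] := by simpa using J.tail
      have hxT : x.h ∉ T' := (r1.ok x (by simp [J.left])).1
      have hrT' : .inl r ∉ T' := fun hz => (hT' hz).2 rfl
      have hxr : x.h ≠ .inl r := fun e => hrg ⟨x, by simp [J.left], e⟩
      refine (ih T₂ (hlt₂.trans hlt)).win hc₂ g'' (by simp) _ (List.Sublist.refl _) ?_ ?_ ?_
      · simpa [hQg, J.start, J.finish] using J.chain
      · rw [hQg]
        simp [List.nodup_append, J.start, J.finish, J.nodup, visit, hxr]
        constructor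
        · exact fun σ hσ e => hxT (e ▸ J.mem σ hσ)
        · exact fun σ hσ e => hrT' (e ▸ J.mem σ hσ)
      · rintro z hz ⟨w, hw, hadj⟩ -
        rw [hQg]
        rcases hbP w hw z hz hadj with h | ⟨σ, hσ, rfl⟩
        · rcases (hbd z).1 h with ⟨σ, hσ, rfl⟩ | rfl
          · obtain rfl : σ = x := by simpa [J.left] using hσ
            exact ⟨x', by simp, J.start⟩
          · exact ⟨y', by simp, J.finish⟩
        · exact ⟨σ, by simp [hσ], rfl⟩

end Confining

end CopsRobbersOnePlanar

namespace CopsRobbersOnePlanar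

section Winning

variable {V X : Type} {G G₀ : SimpleGraph V} {K : Plan G G₀ X}

lemma isChain_left {α : Type} {R : α → α → Prop} {l t L : List α} (h : L.IsChain R)
    (e : l ++ t = L) : l.IsChain R := by
  subst e
  exact h.left_of_append

lemma isChain_segment {α : Type} {R : α → α → Prop} {l L : List α} (h : L.IsChain R)
    (hl : l <:+: L) : l.IsChain R := by
  obtain ⟨s, t, rfl⟩ := hl
  exact h.left_of_append.right_of_append

lemma exists_eq_cons {α : Type} {l m A : List α} {a u : α} (h : l ++ a :: m = u :: A) :
    ∃ C, l ++ [a] = u :: C ∧ C ++ m = A := by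
  cases l with
  | nil => exact ⟨[], by simp_all⟩
  | cons b l =>
    simp only [List.cons_append, List.cons.injEq] at h
    exact ⟨l ++ [a], by simp [h.1], by simp [← h.2]⟩

lemma exists_eq_concat {α : Type} {l m A : List α} {a v : α} (h : l ++ a :: m = A ++ [v]) :
    ∃ D, a :: m = D ++ [v] ∧ l ++ D = A := by
  rcases m.eq_nil_or_concat with rfl | ⟨m, b, rfl⟩
  · obtain ⟨rfl, h⟩ := List.append_inj' h rfl
    exact ⟨[], by simpa using h⟩
  · rw [List.concat_eq_append, ← List.cons_append, ← List.append_assoc] at h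
    obtain ⟨rfl, h⟩ := List.append_inj' h rfl
    exact ⟨a :: m, by simpa using h⟩

lemma nodup_replace_right {α : Type} {l₁ m₁ l₂ m₂ B D : List α} {a b v : α}
    (h : (l₁ ++ a :: m₁ ++ (l₂ ++ b :: m₂)).Nodup) (hB : B.Nodup)
    (hdis : ∀ z ∈ B, z ∉ l₁ ++ a :: m₁ ++ (l₂ ++ b :: m₂)) (hD : b :: m₂ = D ++ [v]) :
    (a :: m₁ ++ v :: (B ++ D)).Nodup := by
  rw [hD] at h hdis
  simp only [List.nodup_append, List.nodup_cons, List.mem_append, List.mem_cons,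
    List.cons_append] at h hdis ⊢
  grind

lemma nodup_replace_left {α : Type} {l₁ m₁ l₂ m₂ B C : List α} {a b u : α}
    (h : (l₁ ++ a :: m₁ ++ (l₂ ++ b :: m₂)).Nodup) (hB : B.Nodup)
    (hdis : ∀ z ∈ B, z ∉ l₁ ++ a :: m₁ ++ (l₂ ++ b :: m₂)) (hC : l₁ ++ [a] = u :: C) :
    (u :: (C ++ B) ++ b :: l₂).Nodup := by
  rw [List.append_cons l₁, hC] at h hdis
  simp only [List.nodup_append, List.nodup_cons, List.mem_append, List.mem_cons,
    List.cons_append] at h hdis ⊢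
  grind

lemma Plan.winsPath_of_lt [Finite V] [Finite X] (hG : G.Connected) {T : Set (V ⊕ X)}
    (ih₁ : ∀ T' : Set (V ⊕ X), T'.ncard < T.ncard → K.WinsPath T')
    (ih₂ : ∀ T' : Set (V ⊕ X), T'.ncard < T.ncard → K.WinsLoop T') : K.WinsPath T := by
  have key : ∀ n c r g p φ Q, (Q g).length = n → K.Confined c r T {g} p φ Q →
      ((Q g).map Station.h).IsChain K.Adj → ((Q g).map Station.h).Nodup → Win G G₀ c r := by
    intro n
    induction n with
    | zero => exact fun c r g p φ Q hn h _ _ => win_of_short hG ih₁ h (by omega)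
    | succ n ih =>
      intro c r g p φ Q hn h hch hnd
      by_cases hn0 : n = 0
      · exact win_of_short hG ih₁ h (by omega)
      obtain ⟨x, M, y, hQ⟩ : ∃ x M y, Q g = x :: M ++ [y] := by
        rcases hQ : Q g with _ | ⟨x, L⟩
        · simp [hQ] at hn
        · rcases L.eq_nil_or_concat with rfl | ⟨M, y, rfl⟩
          · simp [hQ] at hn; omega
          · exact ⟨x, M, y, by simp⟩
      have hbd : ∀ z ∈ T, ∀ z' ∉ T, K.Adj z z' → ∃ σ ∈ Q g, σ.h = z' := by
        intro z hz z' hz' hadj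
        simpa using h.bound z hz z' hz' hadj
      have drop : ∀ L : List (Station V X), L.Sublist (Q g) → (L.map Station.h) <:+: ((Q g).map Station.h) →
          L.length = n → (∀ σ ∈ Q g, K.Meets T σ.h → σ ∈ L) → Win G G₀ c r := by
        intro L hs hi hl hm
        refine ih c r g p φ (fun _ => L) hl (h.restrict subset_rfl (by simpa using hs) ?_)
          (isChain_segment hch hi) (hnd.sublist hi.sublist)
        intro z hz z' hz' hadj
        obtain ⟨σ, hσ, rfl⟩ := hbd z hz z' hz' hadj
        exact ⟨g, rfl, σ, hm σ hσ ⟨z, hz, hadj⟩, rfl⟩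
      by_cases mx : K.Meets T x.h
      swap
      · refine drop (M ++ [y]) (by simp [hQ]) ?_ (by simpa [hQ] using hn) ?_
        · exact ⟨[x.h], [], by simp [hQ]⟩
        · intro σ hσ hm
          rw [hQ, List.cons_append, List.mem_cons] at hσ
          rcases hσ with rfl | hσ
          · exact absurd hm mx
          · exact hσ
      by_cases my : K.Meets T y.h
      swap
      · refine drop (x :: M) (by simp [hQ]) ?_ (by simpa [hQ] using hn) ?_
        · exact ⟨[], [y.h], by simp [hQ]⟩
        · intro σ hσ hm
          rw [hQ, List.mem_append, List.mem_singleton] at hσ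
          rcases hσ with hσ | rfl
          · exact hσ
          · exact absurd hm my
      have hr := h.route g rfl
      have hxT : x.h ∉ T := (hr.ok x (by simp [hQ])).1
      have hyT : y.h ∉ T := (hr.ok y (by simp [hQ])).1
      have hMT : ∀ σ ∈ M, σ.h ∉ T := fun σ hσ => (hr.ok σ (by simp [hQ, hσ])).1
      rw [hQ] at hnd hch
      obtain ⟨g', hg'⟩ : ∃ g', g' ≠ g := exists_ne g
      refine h.join hG (g := g') (by simpa using hg') (Q₁ := [x]) (Q₂ := [y])
        (hr.mono subset_rfl (by simp [hQ])) (hr.mono subset_rfl (by simp [hQ]))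
        ⟨x, by simp, mx⟩ ⟨y, by simp, my⟩ ?_ ?_
      · simp only [List.mem_singleton]
        rintro _ rfl _ rfl e
        simp [e] at hnd
      · intro c r T' hT' hlt L₁ M₁ L₂ M₂ N₂ P x₁ y₁ x' y' q ψ J hP hbP p' φ' Q' hQ' hQg hc
        obtain ⟨rfl, rfl, rfl⟩ : L₁ = [] ∧ x₁ = x ∧ M₁ = [] := by
          have := J.left
          cases L₁ <;> simp_all
        obtain ⟨rfl, rfl, rfl⟩ : L₂ = [] ∧ y₁ = y ∧ M₂ = [] := by
          have := J.right
          cases L₂ <;> simp_all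
        obtain rfl : N₂ = [] := by simpa using J.tail
        have e := hQ' g rfl
        refine (ih₂ T' hlt).win hc g g' hg'.symm (by simp) (by simp) _ _ (List.Sublist.refl _)
          (List.Sublist.refl _) (u := x₁.h) (v := y₁.h) (A₁ := M.map Station.h)
          (A₂ := P.map Station.h) ⟨?_, ?_, ?_, ?_, ?_⟩ ?_
        · simp [e, hQ]
        · simp [hQg, J.start, J.finish]
        · have h1 := J.nodup
          have h2 : ∀ z ∈ P.map Station.h, z ∈ T := by simpa using J.mem
          have h3 : ∀ z ∈ M.map Station.h, z ∉ T := by simpa using hMT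
          simp only [List.map_append, List.map_cons, List.map_nil] at hnd
          grind
        · simpa using hch
        · exact J.chain
        · rintro z hz ⟨w, hw, hadj⟩ -
          rcases hbP w hw z hz hadj with ⟨k, rfl, hk⟩ | ⟨σ, hσ, rfl⟩
          · exact Or.inl (e ▸ hk)
          · exact Or.inr ⟨σ, by simp [hQg, hσ], rfl⟩
  exact fun c r g p φ Q h hch hnd => key _ c r g p φ Q rfl h hch hnd

variable (K) in
lemma Plan.exists_not_meets_of_loop {T : Set (V ⊕ X)} {a b u v r : V ⊕ X}
    {l₁ m₁ l₂ m₂ B C D : List (V ⊕ X)} (hC : l₁ ++ [a] = u :: C) (hD : b :: m₂ = D ++ [v])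
    (hc₁ : (l₁ ++ a :: m₁ ++ [v]).IsChain K.Adj) (hc₂ : (u :: l₂ ++ b :: m₂).IsChain K.Adj)
    (hB : (a :: B ++ [b]).IsChain K.Adj) (hnd : (l₁ ++ a :: m₁ ++ (l₂ ++ b :: m₂)).Nodup)
    (hBn : ∀ z ∈ B, z ∉ l₁ ++ a :: m₁ ++ (l₂ ++ b :: m₂))
    (hT : ∀ z ∈ l₁ ++ a :: m₁ ++ (l₂ ++ b :: m₂), z ∉ T) (hBT : ∀ z ∈ B, z ∉ T) (hr : r ∈ T)
    (hconn : ∀ z ∈ T, ∀ z' ∈ T, LinkedIn K.Adj T z z') :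
    (∀ z ∈ B, ¬ K.Meets T z) ∨ (∀ z ∈ l₁ ++ l₂, ¬ K.Meets T z) ∨
      ∀ z ∈ m₁ ++ m₂, ¬ K.Meets T z := by
  have hsymm : ∀ a b : V ⊕ X, K.Adj a b → K.Adj b a := fun _ _ => adj_symm
  have w₁ : (a :: l₁.reverse ++ (l₂ ++ [b])).IsChain K.Adj := by
    have h := isChain_glue hsymm (u := u) (A := C) (B := l₂ ++ [b])
      (hC ▸ isChain_left hc₁ (t := m₁ ++ [v]) (by simp)) (isChain_left hc₂ (t := m₂) (by simp))
    rw [List.append_cons, ← List.reverse_cons, ← hC] at h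
    simpa using h
  have w₂ : (a :: m₁ ++ (m₂.reverse ++ [b])).IsChain K.Adj := by
    have h : (b :: m₂).reverse.IsChain K.Adj :=
      (List.isChain_reverse.2 ((hc₂.suffix ⟨u :: l₂, rfl⟩).imp hsymm))
    have e : m₂.reverse ++ [b] = v :: D.reverse := by
      rw [← List.reverse_cons, hD, List.reverse_append]; rfl
    rw [List.reverse_cons, e] at h
    rw [e]
    exact List.isChain_split.2 ⟨hc₁.suffix ⟨l₁, by simp⟩, h⟩
  simp only [List.nodup_append, List.nodup_cons, List.mem_append, List.mem_cons] at hnd hBn hT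
  obtain ⟨i, hi⟩ := K.exists_forall_not_meets (T := T) (a := a) (b := b) (by grind) (by grind)
    (by grind) hr hconn ![B, l₁.reverse ++ l₂, m₁ ++ m₂.reverse] (by
      intro i
      fin_cases i
      · exact hB
      · simpa using w₁
      · simpa using w₂) (by
      intro i j hij z
      fin_cases i <;> fin_cases j <;> first | exact absurd rfl hij | skip
      all_goals
        simp
        grind) (by
      intro i
      fin_cases i <;> simp <;> grind) (by
      intro i
      fin_cases i <;> simp <;> grind) (by
      intro i
      fin_cases i <;> simp <;> grind)
  fin_cases i
  · exact Or.inl hi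
  · exact Or.inr (Or.inl (by simpa using hi))
  · exact Or.inr (Or.inr (by simpa using hi))

lemma Plan.winsLoop_of_lt [Finite V] [Finite X] (hG : G.Connected) {T : Set (V ⊕ X)}
    (hpath : K.WinsPath T) (ih : ∀ T' : Set (V ⊕ X), T'.ncard < T.ncard → K.WinsLoop T') :
    K.WinsLoop T := by
  intro c r g₁ g₂ p φ Q u v A₁ A₂ hg h hl
  obtain ⟨hl₁, hl₂, hnd, hc₁, hc₂⟩ := hl
  obtain ⟨Q₁, R₁, hQ₁, h1, h2⟩ := List.map_eq_append_iff.1 hl₁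
  obtain ⟨σ, rfl, hσ⟩ : ∃ σ, R₁ = [σ] ∧ σ.h = v := by
    simpa using h2
  obtain ⟨τ, Q₂, hQ₂, hτ, h3⟩ := List.map_eq_cons_iff.1 hl₂
  have hbd : ∀ z, (∃ k ∈ ({g₁, g₂} : Set (Fin 3)), ∃ σ ∈ Q k, σ.h = z) →
      z ∈ u :: A₁ ∨ z ∈ A₂ ++ [v] := by
    rintro z ⟨k, rfl | rfl, ρ, hρ, rfl⟩
    · have : ρ.h ∈ (Q k).map Station.h := List.mem_map_of_mem hρ
      rw [hl₁] at this
      simp at this ⊢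
      tauto
    · have : ρ.h ∈ (Q k).map Station.h := List.mem_map_of_mem hρ
      rw [hl₂] at this
      simp at this ⊢
      tauto
  have r₁ := h.route g₁ (by simp)
  have r₂ := h.route g₂ (by simp)
  by_cases m₁ : ∃ ρ ∈ Q₁, K.Meets T ρ.h
  swap
  · refine hpath.win h g₂ (by simp) _ (List.Sublist.refl _) (hl₂ ▸ hc₂) ?_ ?_
    · rw [hl₂]
      simp only [List.cons_append, List.nodup_cons, List.nodup_append, List.mem_append] at hnd ⊢
      grind
    · intro z hz hm hk
      rcases hbd z hk with hk | hk
      · rw [← h1, List.mem_map] at hk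
        obtain ⟨ρ, hρ, rfl⟩ := hk
        exact absurd ⟨ρ, hρ, hm⟩ m₁
      · rw [← List.mem_map, hl₂]
        exact List.mem_cons_of_mem _ hk
  by_cases m₂ : ∃ ρ ∈ Q₂, K.Meets T ρ.h
  swap
  · refine hpath.win h g₁ (by simp) _ (List.Sublist.refl _) (hl₁ ▸ hc₁) ?_ ?_
    · rw [hl₁]
      simp only [List.cons_append, List.nodup_cons, List.nodup_append, List.mem_append] at hnd ⊢
      grind
    · intro z hz hm hk
      rcases hbd z hk with hk | hk
      · rw [← List.mem_map, hl₁]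
        exact List.mem_append_left _ hk
      · simp only [List.append_eq] at h3
        rw [← h3, List.mem_map] at hk
        obtain ⟨ρ, hρ, rfl⟩ := hk
        exact absurd ⟨ρ, hρ, hm⟩ m₂
  obtain ⟨g₃, hg₃, hg₃'⟩ := exists_third g₁ g₂
  have hT₁ : ∀ z ∈ u :: A₁, z ∉ T := by
    rw [← h1]
    simp only [List.mem_map]
    rintro _ ⟨ρ, hρ, rfl⟩
    exact (r₁.ok ρ (by simp [hQ₁, hρ])).1
  have hT₂ : ∀ z ∈ A₂ ++ [v], z ∉ T := by
    simp only [List.append_eq] at h3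
    rw [← h3]
    simp only [List.mem_map]
    rintro _ ⟨ρ, hρ, rfl⟩
    exact (r₂.ok ρ (by simp [hQ₂, hρ])).1
  refine h.join hG (g := g₃) (by simp [hg₃, hg₃']) (Q₁ := Q₁) (Q₂ := Q₂)
    (r₁.mono subset_rfl (by simp [hQ₁])) (r₂.mono subset_rfl (by simp [hQ₂])) m₁ m₂ ?_ ?_
  · intro x hx y hy e
    have hx' := List.mem_map_of_mem (f := Station.h) hx
    have hy' := List.mem_map_of_mem (f := Station.h) hy
    rw [h1] at hx'
    rw [h3] at hy'
    simp only [List.cons_append, List.nodup_cons, List.nodup_append, List.mem_append,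
      List.append_eq] at *
    grind
  intro c r T' hT' hlt L₁ M₁ L₂ M₂ N₂ P x y x' y' q ψ J hP hbP p' φ' Q' hQ' hQg hc
  have e₁ := hQ' g₁ (by simp)
  have e₂ := hQ' g₂ (by simp)
  rw [hQ₁, J.left] at e₁
  rw [hQ₂, J.right] at e₂
  have hx : L₁.map Station.h ++ x.h :: M₁.map Station.h = u :: A₁ := by
    rw [← h1, J.left]; simp
  have hy : L₂.map Station.h ++ y.h :: M₂.map Station.h = A₂ ++ [v] := by
    simp only [List.append_eq] at h3
    rw [← h3, J.right]; simp
  obtain ⟨C, hC, rfl⟩ := exists_eq_cons hx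
  obtain ⟨D, hD, rfl⟩ := exists_eq_concat hy
  have hPT : ∀ z ∈ P.map Station.h, z ∈ T := by simpa using J.mem
  have hPnd := J.nodup
  have hPch := J.chain
  have hkey : ∀ z ∉ T', K.Meets T' z → (z ∈ L₁.map Station.h ++ x.h :: M₁.map Station.h ∨
      z ∈ L₂.map Station.h ++ y.h :: M₂.map Station.h) ∨ z ∈ P.map Station.h := by
    rintro z hz ⟨w, hw, hadj⟩
    rw [List.mem_map, hx, hy]
    exact (hbP w hw z hz hadj).imp_left (hbd z)
  have g₁₃ := hg₃.symm
  have hnd' : (L₁.map Station.h ++ x.h :: M₁.map Station.h ++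
      (L₂.map Station.h ++ y.h :: M₂.map Station.h)).Nodup := by
    rw [hx, hy, ← List.append_assoc, List.nodup_append_comm]
    simpa using List.nodup_middle.1 hnd
  have hdis : ∀ z ∈ P.map Station.h, z ∉ L₁.map Station.h ++ x.h :: M₁.map Station.h ++
      (L₂.map Station.h ++ y.h :: M₂.map Station.h) := by
    intro z hz hm
    rw [hx, hy] at hm
    exact (List.mem_append.1 hm).elim (fun h => hT₁ z h (hPT z hz)) fun h => hT₂ z h (hPT z hz)
  have hch₁ : (L₁.map Station.h ++ x.h :: M₁.map Station.h ++ [v]).IsChain K.Adj := by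
    rw [hx]; exact hc₁
  have hch₂ : (u :: L₂.map Station.h ++ y.h :: M₂.map Station.h).IsChain K.Adj := by
    rw [List.cons_append, hy]; simpa using hc₂
  have hfree := K.exists_not_meets_of_loop (T := T') hC hD hch₁ hch₂ hPch hnd' hdis (by
    intro z hz
    rw [hx, hy] at hz
    exact (List.mem_append.1 hz).elim (fun h hT => hT₁ z h (hT' hT)) fun h hT => hT₂ z h (hT' hT))
    (by simpa using hP) hc.mem hc.conn
  have hPnd' : (P.map Station.h).Nodup := hPnd
  rcases hfree with hi | hi | hi
  · refine (ih T' hlt).win hc g₁ g₂ hg (by simp) (by simp) _ _ (List.Sublist.refl _)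
      (List.Sublist.refl _) (u := u) (v := v) (A₁ := C ++ M₁.map Station.h)
      (A₂ := L₂.map Station.h ++ D) ⟨?_, ?_, hnd, hc₁, hc₂⟩ ?_
    · rw [hQ' g₁ (by simp), hl₁]
    · rw [hQ' g₂ (by simp), hl₂]
    · intro z hz hm _
      rw [← List.mem_map, ← List.mem_map, hQ' g₁ (by simp), hQ' g₂ (by simp), hl₁, hl₂]
      rcases hkey z hz hm with (h | h) | h
      · rw [hx] at h
        exact Or.inl (List.mem_append_left _ h)
      · rw [hy] at h
        exact Or.inr (List.mem_cons_of_mem _ h)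
      · exact absurd hm (hi z h)
  · refine (ih T' hlt).win hc g₁ g₃ g₁₃ (by simp) (by simp) (x :: M₁ ++ [σ])
      (x' :: P ++ y' :: N₂) (by simp [e₁]) (by simp [hQg]) (u := x.h) (v := v)
      (A₁ := M₁.map Station.h) (A₂ := P.map Station.h ++ D) ⟨?_, ?_, ?_, ?_, ?_⟩ ?_
    · simp [hσ]
    · simp [J.start, J.finish, J.tail, hD]
    · exact nodup_replace_right hnd' hPnd' hdis hD
    · exact hch₁.suffix ⟨L₁.map Station.h, by simp⟩
    · rw [List.cons_append, List.append_assoc, ← hD]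
      exact List.isChain_split.2 ⟨hPch, hch₂.suffix ⟨u :: L₂.map Station.h, rfl⟩⟩
    · intro z hz hm _
      have hi' := fun h => hi z h hm
      have := hkey z hz hm
      rw [← List.mem_map, ← List.mem_map]
      simp only [List.map_append, List.map_cons, List.map_nil, J.start, J.finish, J.tail,
        List.mem_append, List.mem_cons] at hi' this ⊢
      tauto
  · refine (ih T' hlt).win hc g₃ g₂ hg₃' (by simp) (by simp) (L₁ ++ x' :: P ++ [y'])
      (τ :: L₂ ++ [y]) (by simp [hQg]) (by simp [e₂]) (u := u) (v := y.h)
      (A₁ := C ++ P.map Station.h) (A₂ := L₂.map Station.h) ⟨?_, ?_, ?_, ?_, ?_⟩ ?_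
    · rw [← List.cons_append, ← hC]
      simp [J.start, J.finish]
    · simp [hτ]
    · exact nodup_replace_left hnd' hPnd' hdis hC
    · rw [← List.cons_append, ← hC, List.append_assoc, List.append_assoc]
      exact List.isChain_split.2 ⟨isChain_left hch₁ (t := M₁.map Station.h ++ [v]) (by simp), hPch⟩
    · exact isChain_left hch₂ (t := M₂.map Station.h) (by simp)
    · intro z hz hm _
      have hi' := fun h => hi z h hm
      have := hkey z hz hm
      rw [← List.mem_map, ← List.mem_map]
      simp only [List.map_append, List.map_cons, List.map_nil, J.start, J.finish,
        List.mem_append, List.mem_cons] at hi' this ⊢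
      tauto

end Winning

end CopsRobbersOnePlanar

namespace CopsRobbersOnePlanar

section CopNumber

variable {V X : Type} {G G₀ : SimpleGraph V} {K : Plan G G₀ X}

lemma Plan.winsPath_and_winsLoop [Finite V] [Finite X] (hG : G.Connected) (T : Set (V ⊕ X)) :
    K.WinsPath T ∧ K.WinsLoop T := by
  induction hn : T.ncard using Nat.strong_induction_on generalizing T with
  | _ n ih =>
    subst hn
    have h : K.WinsPath T :=
      K.winsPath_of_lt hG (fun T' hT' => (ih _ hT' T' rfl).1) fun T' hT' => (ih _ hT' T' rfl).2
    exact ⟨h, K.winsLoop_of_lt hG h fun T' hT' => (ih _ hT' T' rfl).2⟩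

/-- If every crossing of `G₀` has a kite edge in `G`, then three groups of seven cops catch a robber
restricted to `G₀`. -/
lemma Plan.win_const [Finite V] [Finite X] (K : Plan G G₀ X) (hG : G.Connected) (v r : V) :
    Win G G₀ (fun _ : Fin 3 × Fin 7 => v) r := by
  refine (K.winsPath_and_winsLoop hG {z | Relation.ReflTransGen K.Adj (.inl r) z}).1
    _ r 0 (fun _ _ => v) (fun _ _ => 0) (fun _ => []) ⟨.refl, ?_, ?_, ?_, ?_⟩ .nil .nil
  · have link : ∀ z, Relation.ReflTransGen K.Adj (.inl r) z → Relation.ReflTransGen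
        (fun x y => Relation.ReflTransGen K.Adj (.inl r) x ∧
          Relation.ReflTransGen K.Adj (.inl r) y ∧ K.Adj x y) (.inl r) z := by
      intro z hz
      induction hz with
      | refl => exact .refl
      | tail h h' ih => exact ih.tail ⟨h, h.tail h', h'⟩
    intro z hz z' hz'
    refine ⟨hz, Relation.ReflTransGen.trans ?_ (link z' hz')⟩
    have : Std.Symm fun x y => Relation.ReflTransGen K.Adj (.inl r) x ∧
        Relation.ReflTransGen K.Adj (.inl r) y ∧ K.Adj x y :=
      ⟨fun x y hxy => ⟨hxy.2.1, hxy.1, Plan.adj_symm hxy.2.2⟩⟩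
    have hback := Relation.ReflTransGen.stdSymm.symm _ _ (link z hz)
    exact hback
  · exact fun z hz z' hz' h => absurd (Relation.ReflTransGen.tail hz h) hz'
  · intro g _
    refine ⟨fun _ => by simp, fun a b c _ _ h => ?_, by simp, by simp, .nil⟩
    simpa using h.nonneg
  · exact fun g _ => ⟨0, by simp, fun _ => rfl⟩

/-- The subgraph of the edges which avoid a set of vertices. -/
def avoiding (G : SimpleGraph V) (S : Set V) : SimpleGraph V where
  Adj a b := G.Adj a b ∧ a ∉ S ∧ b ∉ S
  symm := ⟨fun _ _ h => ⟨h.1.symm, h.2.2, h.2.1⟩⟩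
  loopless := ⟨fun _ h => h.1.ne rfl⟩

lemma notMem_of_mem_avoiding {S : Set V} {e : Sym2 V} (he : e ∈ (avoiding G S).edgeSet) {v : V}
    (hv : v ∈ e) : v ∉ S := by
  obtain ⟨w, rfl⟩ := Sym2.mem_iff_exists.1 hv
  exact he.2.1

theorem OnePlanarDrawing.copsWin_of_hits [Finite V] (hG : G.Connected) (D : OnePlanarDrawing G)
    (S : Set V) (hS : ∀ e f, D.IsXCrossing e f → ∃ v ∈ S, v ∈ e ∨ v ∈ f) :
    CopsWin G (S.ncard + 21) := by
  have hle : avoiding G S ≤ G := fun _ _ h => h.1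
  have : Finite (D.crossPts (avoiding G S)) := D.finite_crossPts hle
  obtain ⟨K⟩ := D.exists_plan hle hG (by
    intro e he f hf hX
    obtain ⟨v, hv, h | h⟩ := hS e f hX
    · exact notMem_of_mem_avoiding he h hv
    · exact notMem_of_mem_avoiding hf h hv)
  have hcard : Nat.card (Fin (S.ncard + 21)) = Nat.card (S ⊕ (Fin 3 × Fin 7)) := by
    rw [Nat.card_sum, Nat.card_coe_set_eq]
    simp
  obtain ⟨e⟩ := Finite.card_eq.1 hcard
  obtain ⟨v⟩ := hG.nonempty
  refine copsWin_of_win (Sum.elim (fun s : S => (s : V)) (fun _ => v) ∘ e) fun r => ?_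
  refine Win.comp_equiv e ?_
  by_cases hr : r ∈ S
  · exact .capture _ _ (.inl ⟨r, hr⟩) (Or.inl rfl)
  · exact Win.sum_static (R := avoiding G S) (fun a b ha hb h => ⟨h, ha, hb⟩)
      (K.win_const hG v r) hr

end CopNumber

end CopsRobbersOnePlanar

namespace CopsRobbersOnePlanar

/-- Any finite connected graph admitting a 1-planar drawing in
the plane with at most `γ` ×-crossings has cop number at most `γ + 21`.
(×-crossings are counted as unordered pairs of crossing edges.) -/
theorem copNumber_le_gamma_add_21_of_onePlanar_few_xcrossings
    {V : Type} [Fintype V] (G : SimpleGraph V) (hconn : G.Connected)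
    (γ : ℕ) (D : OnePlanarDrawing G)
    (hfew : {p : Sym2 (Sym2 V) |
      ∃ e f : Sym2 V, p = s(e, f) ∧ D.IsXCrossing e f}.ncard ≤ γ) :
    copNumber G ≤ γ + 21 := by
  have hends : ∀ p : Sym2 (Sym2 V), ∃ v : V, ∀ e f, p = s(e, f) → v ∈ e ∨ v ∈ f := by
    intro p
    induction p with
    | h e f =>
      refine ⟨(Quot.out e).1, fun e' f' h => ?_⟩
      rcases Sym2.eq_iff.1 h with ⟨rfl, rfl⟩ | ⟨rfl, rfl⟩
      · exact Or.inl (Sym2.out_fst_mem _)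
      · exact Or.inr (Sym2.out_fst_mem _)
  choose pt hpt using hends
  have hwin := D.copsWin_of_hits hconn
    (pt '' {p | ∃ e f : Sym2 V, p = s(e, f) ∧ D.IsXCrossing e f})
    fun e f h => ⟨_, ⟨_, ⟨e, f, rfl, h⟩, rfl⟩, hpt _ e f rfl⟩
  refine (Nat.sInf_le hwin).trans ?_
  have := Set.ncard_image_le (f := pt)
    (Set.toFinite {p : Sym2 (Sym2 V) | ∃ e f : Sym2 V, p = s(e, f) ∧ D.IsXCrossing e f})
  omega

end CopsRobbersOnePlanar
end

section
/- Let G be a finite connected graph, let S be a set of γ vertices of G, and let F be a set of edges of G each of which is incident with at least one vertex of S. If the graph G' = G − F obtained by deleting the edges of F from G is connected, then the cop-number of G satisfies c(G) ≤ γ + c(G'). (The γ extra cops are placed permanently, one on each vertex of S, and the remaining cops simulate a winning strategy for G'; any robber move along a deleted edge places the robber on a vertex occupied by one of the γ stationary cops.) -/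
namespace CopsRobbersOnePlanar

/-- Placing one cop on every vertex of a finite graph captures the robber. -/
theorem copsWin_card {V : Type} [Fintype V] (G : SimpleGraph V) :
    CopsWin G (Fintype.card V) := by
  refine ⟨⟨(Fintype.equivFin V).symm, fun c _ => c, fun _ _ _ => Or.inl rfl⟩, ?_⟩
  intro π hπ
  refine ⟨0, Fintype.equivFin V (π.rob 0), Or.inl ?_⟩
  rw [hπ.1]
  simp

/-- On a finite graph the cop number is attained by a winning strategy. -/
theorem copsWin_copNumber {V : Type} [Fintype V] (G : SimpleGraph V) :
    CopsWin G (copNumber G) :=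
  Nat.sInf_mem (s := {k | CopsWin G k}) ⟨_, copsWin_card G⟩

/-- The strategy on `G` keeping `γ` cops fixed on the vertices `s`, while the
remaining cops play a strategy for a spanning subgraph `H` of `G`. -/
def CopStrategy.addStationary {V : Type} {G H : SimpleGraph V} (hle : H ≤ G) {γ k : ℕ}
    (s : Fin γ → V) (cs : CopStrategy H k) : CopStrategy G (γ + k) where
  init := Fin.append s cs.init
  move c r := Fin.append (fun i => c (Fin.castAdd k i))
    (cs.move (fun j => c (Fin.natAdd γ j)) r)
  move_valid c r i := by
    refine Fin.addCases (fun i => ?_) (fun j => ?_) i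
    · simp
    · simpa using (cs.move_valid (fun j => c (Fin.natAdd γ j)) r j).imp_right
        (fun h => hle h)

/-- If every deleted edge meets `S`, then `S.card` stationary cops on `S` together
with a winning team on `G.deleteEdges F` win on `G`. -/
theorem CopsWin.of_deleteEdges {V : Type} {G : SimpleGraph V} {S : Finset V}
    {F : Set (Sym2 V)} (hinc : ∀ e ∈ F, ∃ v ∈ S, v ∈ e) {k : ℕ}
    (h : CopsWin (G.deleteEdges F) k) : CopsWin G (S.card + k) := by
  obtain ⟨cs, hcs⟩ := h
  refine ⟨cs.addStationary (G.deleteEdges_le F) (fun i => (S.equivFin.symm i : V)), ?_⟩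
  rintro π ⟨hinit, hmove⟩
  by_contra! hfree
  have hstat : ∀ n i, π.cop n (Fin.castAdd k i) = S.equivFin.symm i := by
    intro n i
    induction n with
    | zero => simp [hinit, CopStrategy.addStationary]
    | succ n ih => simp [hmove, CopStrategy.addStationary, ih]
  have hrob : ∀ n, π.rob n ∉ S := fun n hn =>
    hfree n ⟨Fin.castAdd k (S.equivFin ⟨π.rob n, hn⟩), Or.inl (by simp [hstat])⟩
  have hstep : ∀ n, (fun j => π.cop (n + 1) (Fin.natAdd S.card j)) =
      cs.move (fun j => π.cop n (Fin.natAdd S.card j)) (π.rob n) := by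
    intro n
    funext j
    simp [hmove, CopStrategy.addStationary]
  let π' : GamePlay (G.deleteEdges F) k :=
    { cop := fun n j => π.cop n (Fin.natAdd S.card j)
      rob := π.rob
      cop_valid := fun n i => by
        have := cs.move_valid (fun j => π.cop n (Fin.natAdd S.card j)) (π.rob n) i
        rwa [← hstep n] at this
      rob_valid := fun n => (π.rob_valid n).imp_right fun hadj => by
        refine SimpleGraph.deleteEdges_adj.mpr ⟨hadj, fun hmem => ?_⟩
        obtain ⟨v, hv, hve⟩ := hinc _ hmem
        rcases Sym2.mem_iff.mp hve with rfl | rfl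
        · exact hrob n hv
        · exact hrob (n + 1) hv }
  obtain ⟨n, j, hj⟩ := hcs π' ⟨by
    funext j
    simp [π', hinit, CopStrategy.addStationary], hstep⟩
  exact hfree n ⟨Fin.natAdd S.card j, hj⟩

/-- If `S` is a set of `γ` vertices of a finite connected
graph `G`, `F` is a set of edges of `G` each incident with at least one vertex
of `S`, and `G' = G − F` is connected, then `c(G) ≤ γ + c(G')`. -/
theorem copNumber_le_card_add_copNumber_deleteEdges
    {V : Type} [Fintype V] (G : SimpleGraph V) (hconn : G.Connected)
    (γ : ℕ) (S : Finset V) (hcard : S.card = γ)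
    (F : Set (Sym2 V)) (hF : F ⊆ G.edgeSet)
    (hinc : ∀ e ∈ F, ∃ v ∈ S, v ∈ e)
    (hconn' : (G.deleteEdges F).Connected) :
    copNumber G ≤ γ + copNumber (G.deleteEdges F) := by
  subst hcard
  exact Nat.sInf_le ((copsWin_copNumber (G.deleteEdges F)).of_deleteEdges hinc)

end CopsRobbersOnePlanar
end
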